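/- The family T_2 is helpful; that is, for every t > 0 there exists c = c(t) such that every T_2-free graph with treewidth more than c contains K_t, K_{t,t}, a subdivision of the t-by-t wall W_{t×t}, or the line graph of a subdivision of W_{t×t} as an induced subgraph. -/

import Mathlib

open SimpleGraph Set List

namespace Paper

variable {V : Type} {W : Type}

/-- The closed neighborhood `N[v]` of a vertex. -/
def closedNbhd (G : SimpleGraph V) (v : V) : Set V := insert v (G.neighborSet v)

/-- The degree of a vertex (as the number of its neighbors). -/
noncomputable def deg (G : SimpleGraph V) (v : V) : ℕ := (G.neighborSet v).ncard

/-- `G` contains `H` as an induced subgraph, i.e. some induced subgraph of `G` is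
isomorphic to `H`. -/
def ContainsInduced (G : SimpleGraph V) (H : SimpleGraph W) : Prop :=
  ∃ s : Set V, Nonempty (H ≃g G.induce s)

/-- `(A, C, B)` is a separation of `G`. -/
def IsSeparation (G : SimpleGraph V) (A C B : Set V) : Prop :=
  A ∪ C ∪ B = Set.univ ∧ Disjoint A C ∧ Disjoint A B ∧ Disjoint C B ∧
    ∀ a ∈ A, ∀ b ∈ B, ¬G.Adj a b

/-- `G` admits a star cutset. -/
def HasStarCutset (G : SimpleGraph V) : Prop :=
  ∃ A C B : Set V, IsSeparation G A C B ∧ A.Nonempty ∧ B.Nonempty ∧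
    ∃ v ∈ C, C ⊆ closedNbhd G v

/-- `G` admits a clique cutset. -/
def HasCliqueCutset (G : SimpleGraph V) : Prop :=
  ∃ A C B : Set V, IsSeparation G A C B ∧ A.Nonempty ∧ B.Nonempty ∧ G.IsClique C

/-- `D` is a connected component of `G \ X`: a maximal connected subset of `Xᶜ`. -/
def IsComponentOf (G : SimpleGraph V) (X : Set V) (D : Set V) : Prop :=
  D.Nonempty ∧ D ⊆ Xᶜ ∧ (G.induce D).Connected ∧
    ∀ D' : Set V, D ⊆ D' → D' ⊆ Xᶜ → (G.induce D').Connected → D' = D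

/-- An induced path in `G` ("path" in the paper always means induced path). -/
def IsIPath (G : SimpleGraph V) {u v : V} (P : G.Walk u v) : Prop :=
  P.IsPath ∧ P.toSubgraph.IsInduced

/-- A hole: an induced cycle of length at least four. -/
def IsHole (G : SimpleGraph V) {v : V} (c : G.Walk v v) : Prop :=
  c.IsCycle ∧ 4 ≤ c.length ∧ c.toSubgraph.IsInduced

/-- `G` is sparse: for every hole and every vertex not in it, there is an edge `ab` of the
hole containing all neighbors of the vertex in the hole. -/
def Sparse (G : SimpleGraph V) : Prop :=
  ∀ (v : V) (c : G.Walk v v), IsHole G c → ∀ x, x ∉ c.support →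
    ∃ a b, c.toSubgraph.Adj a b ∧ ∀ y ∈ c.support, G.Adj x y → y = a ∨ y = b

/-- `G` contains a pyramid (necessarily as an induced subgraph). -/
def ContainsPyramid (G : SimpleGraph V) : Prop :=
  ∃ (a b₁ b₂ b₃ : V) (P₁ : G.Walk a b₁) (P₂ : G.Walk a b₂) (P₃ : G.Walk a b₃),
    G.Adj b₁ b₂ ∧ G.Adj b₂ b₃ ∧ G.Adj b₁ b₃ ∧
    IsIPath G P₁ ∧ IsIPath G P₂ ∧ IsIPath G P₃ ∧
    1 ≤ P₁.length ∧ 1 ≤ P₂.length ∧ 1 ≤ P₃.length ∧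
    ¬(P₁.length = 1 ∧ P₂.length = 1) ∧ ¬(P₁.length = 1 ∧ P₃.length = 1) ∧
    ¬(P₂.length = 1 ∧ P₃.length = 1) ∧
    (∀ p ∈ P₁.support, p ≠ a → ∀ q ∈ P₂.support, q ≠ a →
      p ≠ q ∧ (G.Adj p q → p = b₁ ∧ q = b₂)) ∧
    (∀ p ∈ P₁.support, p ≠ a → ∀ q ∈ P₃.support, q ≠ a →
      p ≠ q ∧ (G.Adj p q → p = b₁ ∧ q = b₃)) ∧
    (∀ p ∈ P₂.support, p ≠ a → ∀ q ∈ P₃.support, q ≠ a →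
      p ≠ q ∧ (G.Adj p q → p = b₂ ∧ q = b₃))

/-- `G` contains a prism (necessarily as an induced subgraph). -/
def ContainsPrism (G : SimpleGraph V) : Prop :=
  ∃ (a₁ a₂ a₃ b₁ b₂ b₃ : V) (P₁ : G.Walk a₁ b₁) (P₂ : G.Walk a₂ b₂) (P₃ : G.Walk a₃ b₃),
    G.Adj a₁ a₂ ∧ G.Adj a₂ a₃ ∧ G.Adj a₁ a₃ ∧
    G.Adj b₁ b₂ ∧ G.Adj b₂ b₃ ∧ G.Adj b₁ b₃ ∧
    IsIPath G P₁ ∧ IsIPath G P₂ ∧ IsIPath G P₃ ∧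
    1 ≤ P₁.length ∧ 1 ≤ P₂.length ∧ 1 ≤ P₃.length ∧
    (∀ p ∈ P₁.support, ∀ q ∈ P₂.support,
      p ≠ q ∧ (G.Adj p q → (p = a₁ ∧ q = a₂) ∨ (p = b₁ ∧ q = b₂))) ∧
    (∀ p ∈ P₁.support, ∀ q ∈ P₃.support,
      p ≠ q ∧ (G.Adj p q → (p = a₁ ∧ q = a₃) ∨ (p = b₁ ∧ q = b₃))) ∧
    (∀ p ∈ P₂.support, ∀ q ∈ P₃.support,
      p ≠ q ∧ (G.Adj p q → (p = a₂ ∧ q = a₃) ∨ (p = b₂ ∧ q = b₃)))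

/-- `G` is very sparse: sparse, pyramid-free and prism-free. -/
def VerySparse (G : SimpleGraph V) : Prop :=
  Sparse G ∧ ¬ContainsPyramid G ∧ ¬ContainsPrism G

/-- `G ∈ 𝓕_t`: `G` is very sparse with no clique of size at least `t+1`. -/
def MemF (t : ℕ) (G : SimpleGraph V) : Prop :=
  VerySparse G ∧ ∀ s : Set V, G.IsClique s → s.ncard ≤ t

/-- `G` has a tree decomposition of width at most `k`. -/
def HasTreewidthAtMost (G : SimpleGraph V) (k : ℕ) : Prop :=
  ∃ (ι : Type) (T : SimpleGraph ι) (χ : ι → Finset V),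
    T.IsTree ∧
    (∀ v : V, ∃ t, v ∈ χ t) ∧
    (∀ u v : V, G.Adj u v → ∃ t, u ∈ χ t ∧ v ∈ χ t) ∧
    (∀ v : V, (T.induce {t | v ∈ χ t}).Connected) ∧
    ∀ t, (χ t).card ≤ k + 1

/-- The `n`-by-`n` wall, as a brick wall graph: `n` rows of `2n` vertices each,
with horizontal path edges in each row, and vertical edges between consecutive
rows placed alternately. -/
def Wall (n : ℕ) : SimpleGraph (Fin n × Fin (2 * n)) :=
  SimpleGraph.fromRel (fun a b =>
    (a.1 = b.1 ∧ a.2.val + 1 = b.2.val) ∨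
    (a.2 = b.2 ∧ a.1.val + 1 = b.1.val ∧ (a.1.val + a.2.val) % 2 = 0))

/-- The graph obtained from `G` by subdividing the edge `uv` once (the new vertex
is `none`). -/
def subdivideEdge (G : SimpleGraph V) (u v : V) : SimpleGraph (Option V) :=
  SimpleGraph.fromRel (fun a b =>
    (∃ x y : V, a = some x ∧ b = some y ∧ G.Adj x y ∧ ¬(x = u ∧ y = v) ∧ ¬(x = v ∧ y = u)) ∨
    (a = none ∧ (b = some u ∨ b = some v)))

/-- `IsSubdivision G H`: `G` is (isomorphic to) a graph obtained from `H` by repeatedly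
subdividing edges. -/
inductive IsSubdivision : {α : Type} → SimpleGraph α → {β : Type} → SimpleGraph β → Prop where
  | base {α β : Type} {G : SimpleGraph α} {H : SimpleGraph β} :
      Nonempty (G ≃g H) → IsSubdivision G H
  | step {α β : Type} {G : SimpleGraph α} {H : SimpleGraph β} (u v : β) :
      H.Adj u v → IsSubdivision G (subdivideEdge H u v) → IsSubdivision G H

/-- `G` contains a subdivision of the `t`-by-`t` wall as an induced subgraph. -/
def ContainsWallSubdiv (G : SimpleGraph V) (t : ℕ) : Prop :=
  ∃ (α : Type) (S : SimpleGraph α), IsSubdivision S (Wall t) ∧ ContainsInduced G S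

/-- `G` contains the line graph of a subdivision of the `t`-by-`t` wall as an induced
subgraph. -/
def ContainsLineWallSubdiv (G : SimpleGraph V) (t : ℕ) : Prop :=
  ∃ (α : Type) (S : SimpleGraph α), IsSubdivision S (Wall t) ∧
    ContainsInduced G S.lineGraph

/-- `G` is `𝓣₁`-free: no vertex has two or more neighbors in a hole not containing it. -/
def T1Free (G : SimpleGraph V) : Prop :=
  ∀ (v : V) (c : G.Walk v v), IsHole G c → ∀ x, x ∉ c.support →
    ∀ y z, y ∈ c.support → z ∈ c.support → G.Adj x y → G.Adj x z → y = z

/-- `G` is `𝓣₂`-free: no vertex has two non-adjacent neighbors in a hole not containing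
it, and `G` is pyramid-free and prism-free. -/
def T2Free (G : SimpleGraph V) : Prop :=
  (∀ (v : V) (c : G.Walk v v), IsHole G c → ∀ x, x ∉ c.support →
    ∀ y z, y ∈ c.support → z ∈ c.support → G.Adj x y → G.Adj x z → y ≠ z → G.Adj y z) ∧
  ¬ContainsPyramid G ∧ ¬ContainsPrism G

/-- The weight `w(X)` of a set of vertices. -/
noncomputable def setW (w : V → ℝ) (X : Set V) : ℝ := ∑ᶠ x ∈ X, w x

/-- `w` is a weight function on `G`: values in `[0,1]` with total weight `1`. -/
def IsWeightFn (w : V → ℝ) : Prop :=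
  (∀ v, 0 ≤ w v ∧ w v ≤ 1) ∧ setW w Set.univ = 1

/-- `X` is a `(w, c)`-balanced separator. -/
def IsBalSep (G : SimpleGraph V) (w : V → ℝ) (c : ℝ) (X : Set V) : Prop :=
  ∀ D, IsComponentOf G X D → setW w D ≤ c

/-- `(G, w)` is `d`-unbalanced: `w` is a weight function and there is no
`(w, 1/2)`-balanced separator of size at most `d`. -/
def Unbalanced (G : SimpleGraph V) (w : V → ℝ) (d : ℕ) : Prop :=
  IsWeightFn w ∧ ∀ X : Set V, X.ncard ≤ d → ¬IsBalSep G w (1 / 2 : ℝ) X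

/-- `B = B(K₁,K₂)` is the (unique) component of `G ∖ (K₁ ∪ K₂)` of weight more
than `1/2`.  Then `A(K₁,K₂) = (B ∪ K₁ ∪ K₂)ᶜ` and `S(K₁,K₂) = (A, K₁ ∪ K₂, B)` is the
canonical two-clique-separation for `{K₁, K₂}`. -/
def IsCanonicalB (G : SimpleGraph V) (w : V → ℝ) (K₁ K₂ B : Set V) : Prop :=
  IsComponentOf G (K₁ ∪ K₂) B ∧ (1 / 2 : ℝ) < setW w B

/-- The open neighborhood `N(D)` of a set of vertices. -/
def nbhdOfSet (G : SimpleGraph V) (D : Set V) : Set V :=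
  {v | v ∉ D ∧ ∃ d ∈ D, G.Adj v d}

/-- The canonical two-clique-separation `S(K₁,K₂)` (with big side `B`) is proper. -/
def ProperPair (G : SimpleGraph V) (w : V → ℝ) (K₁ K₂ B : Set V) : Prop :=
  IsCanonicalB G w K₁ K₂ B ∧
  (∃ D, IsComponentOf G (K₁ ∪ K₂) D ∧ D ⊆ (B ∪ K₁ ∪ K₂)ᶜ ∧
    K₁ ∪ K₂ ⊆ nbhdOfSet G D) ∧
  (K₁.ncard = 1 → K₂.ncard = 1 →
    ¬∃ (x y : V) (P : G.Walk x y), K₁ = {x} ∧ K₂ = {y} ∧ IsIPath G P ∧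
      {v | v ∈ P.support} = (B ∪ K₁ ∪ K₂)ᶜ ∪ K₁ ∪ K₂)

/-- The canonical two-clique-separation `S(K₁,K₂)` (with big side `B`) is active,
where `K` bounds the size of the cliques considered. -/
def ActivePair (G : SimpleGraph V) (w : V → ℝ) (K : ℕ) (K₁ K₂ B : Set V) : Prop :=
  ProperPair G w K₁ K₂ B ∧
  ∀ K₁' K₂' B' : Set V, G.IsClique K₁' → G.IsClique K₂' →
    K₁'.ncard ≤ K → K₂'.ncard ≤ K → ProperPair G w K₁' K₂' B' →
    K₁ ∪ K₂ ≠ K₁' ∪ K₂' →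
      ¬(B' ∪ K₁' ∪ K₂' ⊂ B ∪ K₁ ∪ K₂) ∧
      (B' ∪ K₁' ∪ K₂' = B ∪ K₁ ∪ K₂ → B' ⊂ B)

/-- The interiors of two paths from `a` to `b` are disjoint and anticomplete. -/
def IntDisjAnti (G : SimpleGraph V) {a b : V} (P Q : G.Walk a b) : Prop :=
  ∀ x ∈ P.support, x ≠ a → x ≠ b → ∀ y ∈ Q.support, y ≠ a → y ≠ b → x ≠ y ∧ ¬G.Adj x y

/-- `Q₁, Q₂, Q₃` form a theta (as an induced subgraph of `G`) with ends `a, b`. -/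
def ThetaCfg (G : SimpleGraph V) {a b : V} (Q₁ Q₂ Q₃ : G.Walk a b) : Prop :=
  ¬G.Adj a b ∧
  IsIPath G Q₁ ∧ IsIPath G Q₂ ∧ IsIPath G Q₃ ∧
  2 ≤ Q₁.length ∧ 2 ≤ Q₂.length ∧ 2 ≤ Q₃.length ∧
  IntDisjAnti G Q₁ Q₂ ∧ IntDisjAnti G Q₁ Q₃ ∧ IntDisjAnti G Q₂ Q₃

/-- There is a theta through the seagull `a-v-u` in `G`: a theta one of whose ends is
`a` or `u` and which contains the seagull. -/
def ThetaThroughSeagull (G : SimpleGraph V) (a v u : V) : Prop :=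
  (∃ (b : V) (Q₁ Q₂ Q₃ : G.Walk a b), ThetaCfg G Q₁ Q₂ Q₃ ∧ [a, v, u] <+: Q₁.support) ∨
  (∃ (b : V) (Q₁ Q₂ Q₃ : G.Walk u b), ThetaCfg G Q₁ Q₂ Q₃ ∧ [u, v, a] <+: Q₁.support)

/-- `a-v-u` is a heavy seagull in `G`: an induced three-vertex path whose ends both
have degree at least three. -/
def HeavySeagull (G : SimpleGraph V) (a v u : V) : Prop :=
  a ≠ u ∧ G.Adj a v ∧ G.Adj v u ∧ ¬G.Adj a u ∧ 3 ≤ deg G a ∧ 3 ≤ deg G u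

end Paper

namespace Paper

section toolkit
variable {V : Type} {G : SimpleGraph V}

def PConn (G : SimpleGraph V) (S : Set V) : Prop :=
  ∀ T : Set V, (∃ a ∈ S, a ∈ T) → (∀ a ∈ S, a ∈ T → ∀ b ∈ S, G.Adj a b → b ∈ T) → S ⊆ T

def Conn (G : SimpleGraph V) (S : Set V) : Prop := S.Nonempty ∧ PConn G S

def Reach (G : SimpleGraph V) (S : Set V) : V → V → Prop :=
  Relation.ReflTransGen (fun x y => G.Adj x y ∧ y ∈ S)

def comp (G : SimpleGraph V) (S : Set V) (a : V) : Set V := {b | Reach G S a b}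

theorem Conn.single (a : V) : Conn G {a} :=
  ⟨⟨a, rfl⟩, fun T ⟨_, h1, h2⟩ _ x hx => by rw [mem_singleton_iff] at *; grind⟩

theorem mem_comp_self {S : Set V} {a : V} : a ∈ comp G S a := Relation.ReflTransGen.refl

theorem comp_step {S : Set V} {a b c : V} (h : b ∈ comp G S a) (hc : c ∈ S) (hbc : G.Adj b c) :
    c ∈ comp G S a := Relation.ReflTransGen.tail h ⟨hbc, hc⟩

theorem comp_sub {S : Set V} {a : V} (ha : a ∈ S) : comp G S a ⊆ S := by
  intro b hb
  induction hb with
  | refl => exact ha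
  | tail _ h _ => exact h.2

theorem Reach.symm {S : Set V} {a b : V} (ha : a ∈ S) (h : Reach G S a b) : Reach G S b a := by
  induction h with
  | refl => exact .refl
  | tail h1 h ih => exact .head ⟨h.1.symm, comp_sub ha h1⟩ ih

theorem comp_conn {S : Set V} {a : V} (ha : a ∈ S) : Conn G (comp G S a) := by
  refine ⟨⟨a, mem_comp_self⟩, ?_⟩
  rintro T ⟨b, hb, hbT⟩ hT c hc
  have key : ∀ d, Reach G S b d → d ∈ comp G S a ∧ d ∈ T := by
    intro d hd
    induction hd with
    | refl => exact ⟨hb, hbT⟩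
    | tail _ h ih =>
      have := comp_step ih.1 h.2 h.1
      exact ⟨this, hT _ ih.1 ih.2 _ this h.1⟩
  exact (key c ((Reach.symm ha hb).trans hc)).2

theorem PConn.reach {S : Set V} (h : PConn G S) {a b : V} (ha : a ∈ S) (hb : b ∈ S) :
    Reach G S a b :=
  h (comp G S a) ⟨a, ha, mem_comp_self⟩ (fun _ _ h1 _ h2 h3 => comp_step h1 h2 h3) hb

theorem pconn_of_reach {S : Set V} (h : ∀ a ∈ S, ∀ b ∈ S, Reach G S a b) : PConn G S := by
  rintro T ⟨a, ha, haT⟩ hT b hb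
  have : S = comp G S a := Subset.antisymm (fun x hx => h a ha x hx) (comp_sub ha)
  have h2 := (comp_conn (G := G) ha).2
  rw [← this] at h2
  exact h2 T ⟨a, ha, haT⟩ hT hb

theorem Reach.mono {S T : Set V} {G' : SimpleGraph V} (hG : ∀ a b, G.Adj a b → G'.Adj a b)
    (hST : S ⊆ T) {a b : V} (h : Reach G S a b) :
    Reach G' T a b :=
  Relation.ReflTransGen.mono (fun _ _ h => ⟨hG _ _ h.1, hST h.2⟩) a b h

theorem Conn.sub_comp {S T : Set V} (h : Conn G S) (hST : S ⊆ T) {a : V} (ha : a ∈ S) :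
    S ⊆ comp G T a := fun _ hb => (h.2.reach ha hb).mono (fun _ _ h => h) hST

theorem Conn.mono {S : Set V} {G' : SimpleGraph V} (h : Conn G S)
    (hG : ∀ a ∈ S, ∀ b ∈ S, G.Adj a b → G'.Adj a b) :
    Conn G' S :=
  ⟨h.1, fun T hT1 hT2 => h.2 T hT1 fun a ha haT b hb hab => hT2 a ha haT b hb (hG a ha b hb hab)⟩

theorem Conn.union {S T : Set V} (hS : Conn G S) (hT : Conn G T)
    (h : ∃ a ∈ S, ∃ b ∈ T, a = b ∨ G.Adj a b) : Conn G (S ∪ T) := by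
  obtain ⟨a, ha, b, hb, hab⟩ := h
  refine ⟨⟨a, .inl ha⟩, fun U ⟨c, hc, hcU⟩ hU => ?_⟩
  have hS' : ∀ x ∈ S, x ∈ U → S ⊆ U := fun x hx hxU => hS.2 U ⟨x, hx, hxU⟩
    fun a ha h1 b hb h2 => hU a (.inl ha) h1 b (.inl hb) h2
  have hT' : ∀ x ∈ T, x ∈ U → T ⊆ U := fun x hx hxU => hT.2 U ⟨x, hx, hxU⟩
    fun a ha h1 b hb h2 => hU a (.inr ha) h1 b (.inr hb) h2
  have hab1 : a ∈ U → b ∈ U := fun h => by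
    rcases hab with rfl | hab
    · exact h
    · exact hU a (.inl ha) h b (.inr hb) hab
  have hab2 : b ∈ U → a ∈ U := fun h => by
    rcases hab with rfl | hab
    · exact h
    · exact hU b (.inr hb) h a (.inl ha) hab.symm
  rcases hc with hc | hc
  · have h1 := hS' c hc hcU
    exact union_subset h1 (hT' b hb (hab1 (h1 ha)))
  · have h1 := hT' c hc hcU
    exact union_subset (hS' a ha (hab2 (h1 hb))) h1

theorem Conn.insert {S : Set V} {a b : V} (hS : Conn G S) (hb : b ∈ S) (hab : G.Adj a b) :
    Conn G (insert a S) := by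
  have := (Conn.single (G := G) a).union hS ⟨a, rfl, b, hb, .inr hab⟩
  rwa [singleton_union] at this

theorem Conn.iUnion {ι : Type*} {S : Set V} {F : ι → Set V} (hS : Conn G S)
    (hF : ∀ i, Conn G (F i)) (h : ∀ i, ∃ a ∈ S, ∃ b ∈ F i, a = b ∨ G.Adj a b) :
    Conn G (S ∪ ⋃ i, F i) := by
  obtain ⟨s, hs⟩ := hS.1
  have hU : ∀ x, x ∈ (S ∪ ⋃ i, F i) → ∃ U ⊆ (S ∪ ⋃ i, F i), Conn G U ∧ s ∈ U ∧ x ∈ U := by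
    intro x hx
    rcases hx with hx | hx
    · exact ⟨S, subset_union_left, hS, hs, hx⟩
    · obtain ⟨i, hi⟩ := mem_iUnion.1 hx
      exact ⟨S ∪ F i, union_subset_union_right _ (subset_iUnion F i), hS.union (hF i) (h i),
        .inl hs, .inr hi⟩
  refine ⟨⟨s, .inl hs⟩, pconn_of_reach fun a ha b hb => ?_⟩
  obtain ⟨U, hU1, hU2, hU3, hU4⟩ := hU a ha
  obtain ⟨U', hU1', hU2', hU3', hU4'⟩ := hU b hb
  exact ((hU2.2.reach hU4 hU3).mono (fun _ _ h => h) hU1).trans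
    ((hU2'.2.reach hU3' hU4').mono (fun _ _ h => h) hU1')

def Ch (G : SimpleGraph V) (S : Set V) (f : ℕ → V) (n : ℕ) : Prop :=
  (∀ i ≤ n, f i ∈ S) ∧ ∀ i < n, G.Adj (f i) (f (i+1))

def IP (G : SimpleGraph V) (f : ℕ → V) (n : ℕ) : Prop :=
  ∀ i j, i < j → j ≤ n → f i ≠ f j ∧ (G.Adj (f i) (f j) ↔ j = i + 1)

theorem Reach.chain {S : Set V} {a b : V} (ha : a ∈ S) (h : Reach G S a b) :
    ∃ f n, Ch G S f n ∧ f 0 = a ∧ f n = b := by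
  induction h with
  | refl => exact ⟨fun _ => a, 0, ⟨fun _ _ => ha, by simp⟩, rfl, rfl⟩
  | @tail b c h1 h ih =>
    obtain ⟨f, n, hf, h0, hn⟩ := ih
    refine ⟨fun i => if i ≤ n then f i else c, n+1, ⟨?_, ?_⟩, by simp [h0], by simp⟩
    · intro i hi
      by_cases h' : i ≤ n
      · simpa [h'] using hf.1 i h'
      · simpa [h'] using h.2
    · intro i hi
      by_cases h' : i < n
      · simpa [h', h'.le, Nat.succ_le_of_lt h'] using hf.2 i h'
      · obtain rfl : i = n := by omega
        simpa [hn] using h.1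

theorem Ch.conn {S : Set V} {f : ℕ → V} {n : ℕ} (h : Ch G S f n) : Conn G (f '' Iic n) := by
  refine ⟨⟨f 0, mem_image_of_mem f (by simp)⟩, ?_⟩
  rintro T ⟨_, ⟨i, hi, rfl⟩, hiT⟩ hT _ ⟨j, hj, rfl⟩
  simp only [mem_Iic] at hi hj
  have m : ∀ k ≤ n, f k ∈ f '' Iic n := fun k hk => mem_image_of_mem f hk
  have up : ∀ k, i + k ≤ n → f (i + k) ∈ T := by
    intro k
    induction k with
    | zero => intro _; exact hiT
    | succ k ih => intro hk; exact hT _ (m _ (by omega)) (ih (by omega)) _ (m _ (by omega))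
                    (h.2 (i+k) (by omega))
  have down : ∀ k, k ≤ i → f (i - k) ∈ T := by
    intro k
    induction k with
    | zero => intro _; exact hiT
    | succ k ih =>
      intro hk
      have := h.2 (i-(k+1)) (by omega)
      rw [show i - (k+1) + 1 = i - k by omega] at this
      exact hT _ (m _ (by omega)) (ih (by omega)) _ (m _ (by omega)) this.symm
  rcases le_total i j with h' | h'
  · have := up (j - i) (by omega); rwa [show i + (j - i) = j by omega] at this
  · have := down (i - j) (by omega); rwa [show i - (i - j) = j by omega] at this

theorem IP.ch {f : ℕ → V} {n : ℕ} (h : IP G f n) : Ch G (f '' Iic n) f n :=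
  ⟨fun _ hi => mem_image_of_mem f hi, fun i hi => ((h i (i+1) (by omega) hi).2).2 rfl⟩

theorem IP.conn {f : ℕ → V} {n : ℕ} (h : IP G f n) : Conn G (f '' Iic n) := h.ch.conn

theorem IP.inj {f : ℕ → V} {n : ℕ} (h : IP G f n) {i j : ℕ} (hi : i ≤ n) (hj : j ≤ n)
    (hij : f i = f j) : i = j := by
  rcases lt_trichotomy i j with h' | h' | h'
  · exact absurd hij (h i j h' hj).1
  · exact h'
  · exact absurd hij.symm (h j i h' hi).1

theorem IP.adj {f : ℕ → V} {n : ℕ} (h : IP G f n) {i j : ℕ} (hi : i ≤ n) (hj : j ≤ n) :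
    G.Adj (f i) (f j) ↔ (j = i + 1 ∨ i = j + 1) := by
  rcases lt_trichotomy i j with h' | h' | h'
  · rw [(h i j h' hj).2]; omega
  · subst h'; simp
  · rw [G.adj_comm, (h j i h' hi).2]; omega

theorem IP.sub {f : ℕ → V} {n : ℕ} (h : IP G f n) {i m : ℕ} (hi : i + m ≤ n) :
    IP G (fun k => f (i + k)) m := by
  intro a b hab hb
  refine ⟨(h (i+a) (i+b) (by omega) (by omega)).1, ?_⟩
  simp only
  rw [(h (i+a) (i+b) (by omega) (by omega)).2]; omega

theorem IP.rev {f : ℕ → V} {n : ℕ} (h : IP G f n) : IP G (fun k => f (n - k)) n := by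
  intro a b hab hb
  refine ⟨(h (n-b) (n-a) (by omega) (by omega)).1.symm, ?_⟩
  simp only
  rw [G.adj_comm, (h (n-b) (n-a) (by omega) (by omega)).2]; omega

theorem img_rev (f : ℕ → V) (n : ℕ) : (fun k => f (n - k)) '' Iic n = f '' Iic n := by
  ext x; constructor
  · rintro ⟨i, hi, rfl⟩; exact ⟨n - i, by simp, rfl⟩
  · rintro ⟨i, hi, rfl⟩; exact ⟨n - i, by simp, by simp only [mem_Iic] at hi; simp [Nat.sub_sub_self hi]⟩

theorem exists_ip {S : Set V} (P : V → V → Prop)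
    (h : ∃ a ∈ S, ∃ b, Reach G S a b ∧ P a b) :
    ∃ f n, IP G f n ∧ (∀ i ≤ n, f i ∈ S) ∧ P (f 0) (f n) ∧
      ∀ i j, i ≤ j → j ≤ n → P (f i) (f j) → i = 0 ∧ j = n := by
  classical
  obtain ⟨a, ha, b, hab, hP⟩ := h
  obtain ⟨f, n, hf, h0, hn⟩ := hab.chain ha
  have hex : ∃ n f, Ch G S f n ∧ P (f 0) (f n) := ⟨n, f, hf, by rw [h0, hn]; exact hP⟩
  clear! f n
  obtain ⟨f, hf, hPf⟩ := Nat.find_spec hex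
  generalize hn : Nat.find hex = n at *
  have hmin : ∀ m f, Ch G S f m → P (f 0) (f m) → n ≤ m :=
    fun m f h1 h2 => hn ▸ Nat.find_min' hex ⟨f, h1, h2⟩
  have cut : ∀ i d, i + d ≤ n → 0 < d → (i + d < n → ¬ G.Adj (f i) (f (i + d + 1))) ∧
      (i + d = n → f i ≠ f n) := by
    intro i d hd h0
    constructor
    · intro hlt hadj
      have := hmin (n - d) (fun k => if k ≤ i then f k else f (k + d)) ⟨?_, ?_⟩ ?_
      · omega
      · intro k hk
        dsimp only
        split_ifs
        · exact hf.1 _ (by omega)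
        · exact hf.1 _ (by omega)
      · intro k hk
        dsimp only
        split_ifs with h1 h2 h3
        · exact hf.2 _ (by omega)
        · obtain rfl : k = i := by omega
          rw [show k + 1 + d = k + d + 1 by omega]; exact hadj
        · omega
        · rw [show k + 1 + d = k + d + 1 by omega]; exact hf.2 _ (by omega)
      · simp only [Nat.zero_le, if_true]
        rw [if_neg (by omega), show n - d + d = n by omega]; exact hPf
    · intro hlt heq
      have := hmin i f ⟨fun k hk => hf.1 k (by omega), fun k hk => hf.2 k (by omega)⟩
        (by rw [heq]; exact hPf)
      omega
  refine ⟨f, n, ?_, hf.1, hPf, ?_⟩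
  · intro i j hij hj
    have hne : ∀ i j, i < j → j ≤ n → f i ≠ f j := by
      intro i j hij hj heq
      rcases hj.eq_or_lt with hj | hj
      · rw [hj] at heq
        exact (cut i (j - i) (by omega) (by omega)).2 (by omega) heq
      · refine (cut i (j - i) (by omega) (by omega)).1 (by omega) ?_
        rw [heq, show i + (j - i) + 1 = j + 1 by omega]; exact hf.2 j hj
    refine ⟨hne i j hij hj, fun hadj => ?_, fun h => h ▸ hf.2 i (by omega)⟩
    by_contra hc
    refine (cut i (j - 1 - i) (by omega) (by omega)).1 (by omega) ?_
    rwa [show i + (j - 1 - i) + 1 = j by omega]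
  · intro i j hij hj hp
    have := hmin (j - i) (fun k => f (i + k))
      ⟨fun k hk => hf.1 _ (by omega), fun k hk => hf.2 (i + k) (by omega)⟩
      (by simpa [show i + (j - i) = j by omega] using hp)
    omega

theorem exists_ip_sets {S A B : Set V} (hS : PConn G S) (hA : (A ∩ S).Nonempty)
    (hB : (B ∩ S).Nonempty) :
    ∃ f n, IP G f n ∧ (∀ i ≤ n, f i ∈ S) ∧ (∀ i ≤ n, f i ∈ A ↔ i = 0) ∧
      (∀ i ≤ n, f i ∈ B ↔ i = n) := by
  obtain ⟨a, haA, haS⟩ := hA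
  obtain ⟨b, hbB, hbS⟩ := hB
  obtain ⟨f, n, h1, h2, h3, h4⟩ := exists_ip (G := G) (S := S) (fun x y => x ∈ A ∧ y ∈ B)
    ⟨a, haS, b, hS.reach haS hbS, haA, hbB⟩
  refine ⟨f, n, h1, h2, fun i hi => ⟨fun h => (h4 i n hi le_rfl ⟨h, h3.2⟩).1, fun h => h ▸ h3.1⟩,
    fun i hi => ⟨fun h => (h4 0 i (by omega) hi ⟨h3.1, h⟩).2, fun h => h ▸ h3.2⟩⟩

def Hole (G : SimpleGraph V) (c : ℕ → V) (n : ℕ) : Prop :=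
  4 ≤ n ∧ ∀ i j, i < j → j < n → c i ≠ c j ∧ (G.Adj (c i) (c j) ↔ (j = i + 1 ∨ (i = 0 ∧ j + 1 = n)))

def HoleSet (G : SimpleGraph V) (H : Set V) : Prop := ∃ c n, Hole G c n ∧ H = c '' Iio n

theorem hole_cone {f : ℕ → V} {m : ℕ} {x : V} (hf : IP G f m) (hm : 2 ≤ m)
    (hx : ∀ i ≤ m, x ≠ f i) (hadj : ∀ i ≤ m, G.Adj x (f i) ↔ (i = 0 ∨ i = m)) :
    Hole G (fun i => if i = 0 then x else f (i - 1)) (m + 2) := by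
  refine ⟨by omega, fun i j hij hj => ?_⟩
  dsimp only
  rw [if_neg (show j ≠ 0 by omega)]
  split_ifs with hi
  · exact ⟨hx _ (by omega), by rw [hadj _ (by omega)]; omega⟩
  · have := hf (i-1) (j-1) (by omega) (by omega)
    exact ⟨this.1, by rw [this.2]; omega⟩

theorem holeSet_cone {f : ℕ → V} {m : ℕ} {x : V} (hf : IP G f m) (hm : 2 ≤ m)
    (hx : ∀ i ≤ m, x ≠ f i) (hadj : ∀ i ≤ m, G.Adj x (f i) ↔ (i = 0 ∨ i = m)) :
    HoleSet G (insert x (f '' Iic m)) := by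
  refine ⟨_, _, hole_cone hf hm hx hadj, ?_⟩
  ext y
  simp only [mem_insert_iff, mem_image, mem_Iic, mem_Iio]
  constructor
  · rintro (rfl | ⟨i, hi, rfl⟩)
    · exact ⟨0, by omega, by simp⟩
    · exact ⟨i+1, by omega, by simp⟩
  · rintro ⟨i, hi, rfl⟩
    split_ifs with h
    · exact .inl rfl
    · exact .inr ⟨i-1, by omega, rfl⟩

theorem HoleSet.cone {H : Set V} (h : HoleSet G H) {x : V} (hx : x ∈ H) :
    ∃ f m, IP G f m ∧ 2 ≤ m ∧ (∀ i ≤ m, x ≠ f i) ∧ (∀ i ≤ m, G.Adj x (f i) ↔ (i = 0 ∨ i = m)) ∧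
      H = insert x (f '' Iic m) := by
  obtain ⟨c, n, ⟨hn, hc⟩, rfl⟩ := h
  obtain ⟨k, hk, rfl⟩ := hx
  simp only [mem_Iio] at hk
  have inj : ∀ i j, i < n → j < n → c i = c j → i = j := by
    intro i j hi hj hij
    rcases lt_trichotomy i j with h' | h' | h'
    · exact absurd hij (hc i j h' hj).1
    · exact h'
    · exact absurd hij.symm (hc j i h' hi).1
  have adj : ∀ i j, i < n → j < n → (G.Adj (c i) (c j) ↔
      (j = i + 1 ∨ i = j + 1 ∨ (i = 0 ∧ j + 1 = n) ∨ (j = 0 ∧ i + 1 = n))) := by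
    intro i j hi hj
    rcases lt_trichotomy i j with h' | h' | h'
    · rw [(hc i j h' hj).2]; omega
    · subst h'; simp; omega
    · rw [G.adj_comm, (hc j i h' hi).2]; omega
  have hidx : ∀ i ≤ n - 2, ∃ r, r < n ∧ r ≠ k ∧ (r = k + 1 + i ∨ r + n = k + 1 + i) ∧
      (if k + 1 + i < n then k + 1 + i else k + 1 + i - n) = r := by
    intro i hi
    split_ifs with h
    · exact ⟨_, h, by omega, by omega, rfl⟩
    · exact ⟨_, by omega, by omega, by omega, rfl⟩
  refine ⟨fun i => c (if k + 1 + i < n then k + 1 + i else k + 1 + i - n), n - 2, ?_, by omega,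
    ?_, ?_, ?_⟩
  · intro i j hij hj
    obtain ⟨r, h1, h2, h3, h4⟩ := hidx i (by omega)
    obtain ⟨s, g1, g2, g3, g4⟩ := hidx j (by omega)
    simp only [h4, g4]
    refine ⟨fun h => ?_, ?_⟩
    · have := inj _ _ h1 g1 h; omega
    · rw [adj _ _ h1 g1]; omega
  · intro i hi h
    obtain ⟨r, h1, h2, h3, h4⟩ := hidx i (by omega)
    simp only [h4] at h
    exact h2 (inj _ _ hk h1 h).symm
  · intro i hi
    obtain ⟨r, h1, h2, h3, h4⟩ := hidx i (by omega)
    simp only [h4]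
    rw [adj _ _ hk h1]; omega
  · ext y
    simp only [mem_insert_iff, mem_image, mem_Iic, mem_Iio]
    constructor
    · rintro ⟨i, hi, rfl⟩
      rcases lt_trichotomy i k with h' | h' | h'
      · refine .inr ⟨n + i - (k+1), by omega, ?_⟩
        rw [if_neg (by omega)]; congr 1; omega
      · left; rw [h']
      · refine .inr ⟨i - (k+1), by omega, ?_⟩
        rw [if_pos (by omega)]; congr 1; omega
    · rintro (rfl | ⟨i, hi, rfl⟩)
      · exact ⟨k, hk, rfl⟩
      · obtain ⟨r, h1, h2, h3, h4⟩ := hidx i (by omega)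
        exact ⟨r, h1, by rw [h4]⟩


end toolkit
end Paper
namespace Paper

section conv
variable {V : Type} {G : SimpleGraph V}

theorem exists_walk (n : ℕ) : ∀ f : ℕ → V, (∀ i < n, G.Adj (f i) (f (i+1))) →
    ∃ P : G.Walk (f 0) (f n), P.length = n ∧ ∀ i ≤ n, P.getVert i = f i := by
  induction n with
  | zero => intro f _; exact ⟨.nil, rfl, fun i hi => by obtain rfl : i = 0 := by omega
                                                        rfl⟩
  | succ n ih =>
    intro f hf
    obtain ⟨P, h1, h2⟩ := ih (fun i => f (i+1)) (fun i hi => hf (i+1) (by omega))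
    refine ⟨.cons (hf 0 (by omega)) P, by simp [h1], fun i hi => ?_⟩
    rcases i with _ | i
    · simp
    · simpa using h2 i (by omega)

theorem IP.walk {f : ℕ → V} {n : ℕ} (h : IP G f n) :
    ∃ P : G.Walk (f 0) (f n), P.length = n ∧ IsIPath G P ∧ (∀ x, x ∈ P.support ↔ ∃ i ≤ n, f i = x) ∧
      (∀ i < n, P.toSubgraph.Adj (f i) (f (i+1))) ∧
      ∀ u v, s(u, v) ∈ P.edges → ∃ i < n, s(f i, f (i+1)) = s(u, v) := by
  obtain ⟨P, h1, h2⟩ := exists_walk n f h.ch.2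
  have hs : ∀ x, x ∈ P.support ↔ ∃ i ≤ n, f i = x := by
    intro x
    rw [Walk.mem_support_iff_exists_getVert]
    constructor
    · rintro ⟨i, hi, hi'⟩; exact ⟨i, by omega, by rw [← h2 i (by omega), hi]⟩
    · rintro ⟨i, hi, hi'⟩; exact ⟨i, by rw [h2 i hi, hi'], by omega⟩
  have ha : ∀ i < n, P.toSubgraph.Adj (f i) (f (i+1)) := by
    intro i hi
    have := P.toSubgraph_adj_getVert (i := i) (by omega)
    rwa [h2 i (by omega), h2 (i+1) (by omega)] at this
  refine ⟨P, h1, ⟨?_, ?_⟩, hs, ha, ?_⟩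
  · rw [← Walk.IsPath.getVert_injOn_iff]
    intro i hi j hj hij
    simp only [h1, mem_ofPred_eq] at hi hj
    rw [h2 i hi, h2 j hj] at hij
    exact h.inj hi hj hij
  · intro v hv w hw hadj
    rw [Walk.mem_verts_toSubgraph, hs] at hv hw
    obtain ⟨i, hi, rfl⟩ := hv
    obtain ⟨j, hj, rfl⟩ := hw
    rcases (h.adj hi hj).1 hadj with rfl | rfl
    · exact ha i (by omega)
    · exact (ha j (by omega)).symm
  · intro u v huv
    rw [← Walk.mem_edges_toSubgraph, Subgraph.mem_edgeSet, Walk.toSubgraph_adj_iff] at huv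
    obtain ⟨i, h3, hi⟩ := huv
    refine ⟨i, by omega, ?_⟩
    rw [← h3, h2 i (by omega), h2 (i+1) (by omega)]

structure T2F (G : SimpleGraph V) : Prop where
  hole : ∀ H, HoleSet G H → ∀ x ∉ H, ∀ y ∈ H, ∀ z ∈ H, G.Adj x y → G.Adj x z → y ≠ z → G.Adj y z
  pyr : ∀ f n g m h l, IP G f n → IP G g m → IP G h l → f 0 = g 0 → f 0 = h 0 →
    G.Adj (f n) (g m) → G.Adj (g m) (h l) → G.Adj (f n) (h l) → 1 ≤ n → 1 ≤ m → 1 ≤ l →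
    ¬(n = 1 ∧ m = 1) → ¬(n = 1 ∧ l = 1) → ¬(m = 1 ∧ l = 1) →
    (∀ i j, 0 < i → i ≤ n → 0 < j → j ≤ m → f i ≠ g j ∧ (G.Adj (f i) (g j) → i = n ∧ j = m)) →
    (∀ i j, 0 < i → i ≤ n → 0 < j → j ≤ l → f i ≠ h j ∧ (G.Adj (f i) (h j) → i = n ∧ j = l)) →
    (∀ i j, 0 < i → i ≤ m → 0 < j → j ≤ l → g i ≠ h j ∧ (G.Adj (g i) (h j) → i = m ∧ j = l)) →
    False
  pri : ∀ f n g m h l, IP G f n → IP G g m → IP G h l →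
    G.Adj (f 0) (g 0) → G.Adj (g 0) (h 0) → G.Adj (f 0) (h 0) →
    G.Adj (f n) (g m) → G.Adj (g m) (h l) → G.Adj (f n) (h l) → 1 ≤ n → 1 ≤ m → 1 ≤ l →
    (∀ i j, i ≤ n → j ≤ m → f i ≠ g j ∧ (G.Adj (f i) (g j) → (i = 0 ∧ j = 0) ∨ (i = n ∧ j = m))) →
    (∀ i j, i ≤ n → j ≤ l → f i ≠ h j ∧ (G.Adj (f i) (h j) → (i = 0 ∧ j = 0) ∨ (i = n ∧ j = l))) →
    (∀ i j, i ≤ m → j ≤ l → g i ≠ h j ∧ (G.Adj (g i) (h j) → (i = 0 ∧ j = 0) ∨ (i = m ∧ j = l))) →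
    False

theorem T2Free.t2f (h : T2Free G) : T2F G := by
  obtain ⟨h1, h2, h3⟩ := h
  refine ⟨?_, ?_, ?_⟩
  · intro H hH x hx y hy z hz hxy hxz hne
    obtain ⟨c, n, ⟨hn, hc⟩, rfl⟩ := hH
    have hip : IP G (fun i => c (i+1)) (n - 2) := fun i j hij hj =>
      ⟨(hc (i+1) (j+1) (by omega) (by omega)).1, by
        rw [(hc (i+1) (j+1) (by omega) (by omega)).2]; omega⟩
    obtain ⟨P, hP1, hP2, hP3, hP5, hP4⟩ := hip.walk
    have e1 : G.Adj (c 0) (c 1) := (hc 0 1 (by omega) (by omega)).2.2 (by omega)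
    have e2 : G.Adj (c (n-2+1)) (c 0) := ((hc 0 (n-2+1) (by omega) (by omega)).2.2 (by omega)).symm
    have hQp : (Walk.cons e1 P).IsPath := by
      rw [Walk.cons_isPath_iff]
      refine ⟨hP2.1, fun h => ?_⟩
      obtain ⟨i, hi, h⟩ := (hP3 _).1 h
      exact (hc 0 (i+1) (by omega) (by omega)).1 h.symm
    let Q := Walk.cons e2 (Walk.cons e1 P)
    have hsup : ∀ v, v ∈ Q.support ↔ v ∈ c '' Iio n := by
      intro v
      simp only [Q, Walk.support_cons, List.mem_cons, hP3]
      constructor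
      · rintro (rfl | rfl | ⟨i, hi, rfl⟩)
        · exact ⟨_, by simp only [mem_Iio]; omega, rfl⟩
        · exact ⟨_, by simp only [mem_Iio]; omega, rfl⟩
        · exact ⟨_, by simp only [mem_Iio]; omega, rfl⟩
      · rintro ⟨i, hi, rfl⟩
        simp only [mem_Iio] at hi
        rcases i with _ | i
        · right; left; rfl
        · exact .inr (.inr ⟨i, by omega, rfl⟩)
    refine h1 _ Q ⟨?_, ?_, ?_⟩ x (by rwa [hsup]) y z (by rwa [hsup]) (by rwa [hsup]) hxy hxz hne
    · rw [Walk.cons_isCycle_iff]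
      refine ⟨hQp, ?_⟩
      rw [Walk.edges_cons, List.mem_cons, not_or]
      constructor
      · intro h
        have h' : c (n-2+1) = c 1 := by
          rw [Sym2.eq_iff] at h
          rcases h with h | h
          · exact absurd h.1.symm (hc 0 (n-2+1) (by omega) (by omega)).1
          · exact h.1
        exact (hc 1 (n-2+1) (by omega) (by omega)).1 h'.symm
      · intro h
        have := Walk.snd_mem_support_of_mem_edges _ h
        obtain ⟨i, hi, h⟩ := (hP3 _).1 this
        exact (hc 0 (i+1) (by omega) (by omega)).1 h.symm
    · simp [Q, hP1]; omega
    · have key : ∀ i j, i < j → j < n → G.Adj (c i) (c j) → Q.toSubgraph.Adj (c i) (c j) := by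
        intro i j hij hj hadj
        rcases (hc i j hij hj).2.1 hadj with rfl | ⟨rfl, hjn⟩
        · rcases i with _ | i
          · simp [Q]
          · have := hP5 i (by omega)
            simp only [Q, Walk.toSubgraph, Subgraph.sup_adj]
            exact .inr (.inr this)
        · obtain rfl : j = n - 2 + 1 := by omega
          simp [Q]
      intro v hv w hw hadj
      rw [Walk.mem_verts_toSubgraph, hsup] at hv hw
      obtain ⟨i, hi, rfl⟩ := hv
      obtain ⟨j, hj, rfl⟩ := hw
      rcases lt_trichotomy i j with h | h | h
      · exact key i j h hj hadj
      · subst h; exact absurd hadj (G.loopless.irrefl _)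
      · exact (key j i h hi hadj.symm).symm
  · intro f n g m h l hf hg hh e1 e2 a1 a2 a3 n1 m1 l1 c1 c2 c3 k1 k2 k3
    apply h2
    obtain ⟨P, p1, p2, p3, -⟩ := hf.walk
    obtain ⟨Q, q1, q2, q3, -⟩ := hg.walk
    obtain ⟨R, r1, r2, r3, -⟩ := hh.walk
    have aux : ∀ (i n : ℕ) (f : ℕ → V), f i ≠ f 0 → 0 < i := fun i n f h => by
      rcases Nat.eq_zero_or_pos i with rfl | h'
      · exact absurd rfl h
      · exact h'
    refine ⟨f 0, f n, g m, h l, P, Q.copy e1.symm rfl, R.copy e2.symm rfl, a1, a2, a3, p2,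
      ?_, ?_, by omega, by simp; omega, by simp; omega, by simp; omega, by simp; omega,
      by simp; omega, ?_, ?_, ?_⟩
    · clear! P R; generalize f 0 = x at *; subst e1; simpa using q2
    · clear! P Q; generalize f 0 = x at *; subst e2; simpa using r2
    · simp only [Walk.support_copy, p3, q3]
      rintro _ ⟨i, hi, rfl⟩ hi0 _ ⟨j, hj, rfl⟩ hj0
      have := k1 i j (aux i n f hi0) hi (aux j n g (by rwa [e1] at hj0)) hj
      exact ⟨this.1, fun h => by obtain ⟨rfl, rfl⟩ := this.2 h; exact ⟨rfl, rfl⟩⟩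
    · simp only [Walk.support_copy, p3, r3]
      rintro _ ⟨i, hi, rfl⟩ hi0 _ ⟨j, hj, rfl⟩ hj0
      have := k2 i j (aux i n f hi0) hi (aux j n h (by rwa [e2] at hj0)) hj
      exact ⟨this.1, fun h => by obtain ⟨rfl, rfl⟩ := this.2 h; exact ⟨rfl, rfl⟩⟩
    · simp only [Walk.support_copy, q3, r3]
      rintro _ ⟨i, hi, rfl⟩ hi0 _ ⟨j, hj, rfl⟩ hj0
      have := k3 i j (aux i n g (by rwa [e1] at hi0)) hi (aux j n h (by rwa [e2] at hj0)) hj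
      exact ⟨this.1, fun h => by obtain ⟨rfl, rfl⟩ := this.2 h; exact ⟨rfl, rfl⟩⟩
  · intro f n g m h l hf hg hh a1 a2 a3 b1 b2 b3 n1 m1 l1 k1 k2 k3
    apply h3
    obtain ⟨P, p1, p2, p3, -⟩ := hf.walk
    obtain ⟨Q, q1, q2, q3, -⟩ := hg.walk
    obtain ⟨R, r1, r2, r3, -⟩ := hh.walk
    refine ⟨_, _, _, _, _, _, P, Q, R, a1, a2, a3, b1, b2, b3, p2, q2, r2,
      by omega, by omega, by omega, ?_, ?_, ?_⟩
    · simp only [p3, q3]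
      rintro _ ⟨i, hi, rfl⟩ _ ⟨j, hj, rfl⟩
      have := k1 i j hi hj
      exact ⟨this.1, fun h => by rcases this.2 h with ⟨rfl, rfl⟩ | ⟨rfl, rfl⟩ <;> simp⟩
    · simp only [p3, r3]
      rintro _ ⟨i, hi, rfl⟩ _ ⟨j, hj, rfl⟩
      have := k2 i j hi hj
      exact ⟨this.1, fun h => by rcases this.2 h with ⟨rfl, rfl⟩ | ⟨rfl, rfl⟩ <;> simp⟩
    · simp only [q3, r3]
      rintro _ ⟨i, hi, rfl⟩ _ ⟨j, hj, rfl⟩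
      have := k3 i j hi hj
      exact ⟨this.1, fun h => by rcases this.2 h with ⟨rfl, rfl⟩ | ⟨rfl, rfl⟩ <;> simp⟩

theorem T2F.induce (h : T2F G) (J : Set V) : T2F (G.induce J) := by
  have hip : ∀ (f : ℕ → J) n, IP (G.induce J) f n → IP G (fun i => (f i : V)) n :=
    fun f n hf i j hij hj => ⟨fun e => (hf i j hij hj).1 (Subtype.ext e), (hf i j hij hj).2⟩
  refine ⟨?_, ?_, ?_⟩
  · rintro H ⟨c, n, hc, rfl⟩ x hx y hy z hz hxy hxz hne
    refine h.hole ((fun i => (c i : V)) '' Iio n) ⟨_, n, ⟨hc.1, fun i j hij hj =>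
      ⟨fun e => (hc.2 i j hij hj).1 (Subtype.ext e), (hc.2 i j hij hj).2⟩⟩, rfl⟩ x ?_ y ?_ z ?_
      hxy hxz (fun e => hne (Subtype.ext e))
    · rintro ⟨i, hi, e⟩; exact hx ⟨i, hi, Subtype.ext e⟩
    · obtain ⟨i, hi, rfl⟩ := hy; exact ⟨i, hi, rfl⟩
    · obtain ⟨i, hi, rfl⟩ := hz; exact ⟨i, hi, rfl⟩
  · intro f n g m h' l hf hg hh e1 e2 a1 a2 a3 n1 m1 l1 c1 c2 c3 k1 k2 k3
    refine h.pyr _ n _ m _ l (hip f n hf) (hip g m hg) (hip h' l hh) (by rw [e1]) (by rw [e2])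
      a1 a2 a3 n1 m1 l1 c1 c2 c3 ?_ ?_ ?_
    · intro i j q1 q2 q3 q4
      exact ⟨fun e => (k1 i j q1 q2 q3 q4).1 (Subtype.ext e), (k1 i j q1 q2 q3 q4).2⟩
    · intro i j q1 q2 q3 q4
      exact ⟨fun e => (k2 i j q1 q2 q3 q4).1 (Subtype.ext e), (k2 i j q1 q2 q3 q4).2⟩
    · intro i j q1 q2 q3 q4
      exact ⟨fun e => (k3 i j q1 q2 q3 q4).1 (Subtype.ext e), (k3 i j q1 q2 q3 q4).2⟩
  · intro f n g m h' l hf hg hh a1 a2 a3 b1 b2 b3 n1 m1 l1 k1 k2 k3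
    refine h.pri _ n _ m _ l (hip f n hf) (hip g m hg) (hip h' l hh)
      a1 a2 a3 b1 b2 b3 n1 m1 l1 ?_ ?_ ?_
    · intro i j q1 q2
      exact ⟨fun e => (k1 i j q1 q2).1 (Subtype.ext e), (k1 i j q1 q2).2⟩
    · intro i j q1 q2
      exact ⟨fun e => (k2 i j q1 q2).1 (Subtype.ext e), (k2 i j q1 q2).2⟩
    · intro i j q1 q2
      exact ⟨fun e => (k3 i j q1 q2).1 (Subtype.ext e), (k3 i j q1 q2).2⟩

end conv
end Paper
namespace Paper

section tw
variable {V : Type} {G : SimpleGraph V}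

structure Br (G : SimpleGraph V) (k : ℕ) (𝓑 : Set (Set V)) : Prop where
  conn : ∀ b ∈ 𝓑, Conn G b
  touch : ∀ b ∈ 𝓑, ∀ b' ∈ 𝓑, ∃ x ∈ b, ∃ y ∈ b', x = y ∨ G.Adj x y
  ord : ∀ X : Finset V, X.card < k → ∃ b ∈ 𝓑, ∀ x ∈ X, x ∉ b

open Classical in
theorem bal_sep [Fintype V] {k : ℕ} (h : ¬∃ 𝓑, Br G k 𝓑) (W : Finset V) :
    ∃ X : Finset V, X.card < k ∧ ∀ b, Conn G b → (∀ x ∈ X, x ∉ b) →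
      2 * (W.filter (· ∈ b)).card ≤ W.card := by
  by_contra hc
  push Not at hc
  refine h ⟨{b | Conn G b ∧ W.card < 2 * (W.filter (· ∈ b)).card}, fun b hb => hb.1, ?_, ?_⟩
  · intro b hb b' hb'
    by_contra hn
    have hd : Disjoint (W.filter (· ∈ b)) (W.filter (· ∈ b')) := by
      rw [Finset.disjoint_left]
      intro x hx hx'
      simp only [Finset.mem_filter] at hx hx'
      exact hn ⟨x, hx.2, x, hx'.2, .inl rfl⟩
    have h1 := Finset.card_union_of_disjoint hd
    have h2 : (W.filter (· ∈ b) ∪ W.filter (· ∈ b')).card ≤ W.card :=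
      Finset.card_le_card (Finset.union_subset (Finset.filter_subset _ _) (Finset.filter_subset _ _))
    have := hb.2; have := hb'.2
    omega
  · intro X hX
    obtain ⟨b, h1, h2, h3⟩ := hc X hX
    exact ⟨b, ⟨h1, h3⟩, h2⟩

def RIP (G : SimpleGraph V) (k : ℕ) (S W : Finset V) : Prop :=
  ∃ (n : ℕ) (χ : ℕ → Finset V) (p : ℕ → ℕ), 0 < n ∧ (∀ i < n, 0 < i → p i < i) ∧
    (∀ i < n, χ i ⊆ S ∧ (χ i).card ≤ k) ∧ W ⊆ χ 0 ∧ (∀ v ∈ S, ∃ i < n, v ∈ χ i) ∧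
    (∀ u ∈ S, ∀ v ∈ S, G.Adj u v → ∃ i < n, u ∈ χ i ∧ v ∈ χ i) ∧
    ∀ i < n, 0 < i → ∀ v ∈ χ i, (∃ j < i, v ∈ χ j) → v ∈ χ (p i)

theorem RIP.single {k : ℕ} {S W : Finset V} (hk : S.card ≤ k) (hW : W ⊆ S) : RIP G k S W :=
  ⟨1, fun _ => S, fun _ => 0, by omega, by omega, fun _ _ => ⟨Finset.Subset.refl _, hk⟩, hW,
    fun v hv => ⟨0, by omega, hv⟩, fun u hu v hv _ => ⟨0, by omega, hu, hv⟩, by omega⟩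

theorem RIP.mono {k : ℕ} {S W W' : Finset V} (h : RIP G k S W) (hW : W' ⊆ W) : RIP G k S W' := by
  obtain ⟨n, χ, p, h1, h2, h3, h4, h5⟩ := h
  exact ⟨n, χ, p, h1, h2, h3, hW.trans h4, h5⟩

theorem RIP.glue [DecidableEq V] {k : ℕ} {S₁ W₁ S₂ W₂ : Finset V} (h1 : RIP G k S₁ W₁)
    (h2 : RIP G k S₂ W₂) (hW1 : S₁ ∩ S₂ ⊆ W₁) (hW2 : S₁ ∩ S₂ ⊆ W₂)
    (hE : ∀ u ∈ S₁, ∀ v ∈ S₂, G.Adj u v → u ∈ S₂ ∨ v ∈ S₁) : RIP G k (S₁ ∪ S₂) W₁ := by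
  obtain ⟨n, χ, p, a1, a2, a3, a4, a5, a6, a7⟩ := h1
  obtain ⟨m, ψ, q, b1, b2, b3, b4, b5, b6, b7⟩ := h2
  have hl : ∀ i, i < n → (if i < n then χ i else ψ (i - n)) = χ i := fun i hi => if_pos hi
  have hr : ∀ i, (if n + i < n then χ (n + i) else ψ (n + i - n)) = ψ i := fun i => by
    rw [if_neg (by omega), Nat.add_sub_cancel_left]
  have key : ∀ u ∈ S₁, ∀ v ∈ S₂, G.Adj u v →
      ∃ i < n + m, u ∈ (if i < n then χ i else ψ (i - n)) ∧ v ∈ (if i < n then χ i else ψ (i - n)) := by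
    intro u hu v hv huv
    rcases hE u hu v hv huv with h | h
    · obtain ⟨i, hi, h⟩ := b6 u h v hv huv
      exact ⟨n + i, by omega, by rwa [hr]⟩
    · obtain ⟨i, hi, h⟩ := a6 u hu v h huv
      exact ⟨i, by omega, by rwa [hl i hi]⟩
  refine ⟨n + m, fun i => if i < n then χ i else ψ (i - n),
    fun i => if i < n then p i else if i = n then 0 else n + q (i - n), by omega, ?_, ?_, ?_, ?_, ?_, ?_⟩
  · intro i hi h0
    dsimp only
    split_ifs with h1 h2
    · exact a2 i h1 h0
    · omega
    · have := b2 (i - n) (by omega) (by omega); omega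
  · intro i hi
    dsimp only
    split_ifs with h1
    · exact ⟨(a3 i h1).1.trans Finset.subset_union_left, (a3 i h1).2⟩
    · have := b3 (i - n) (by omega)
      exact ⟨this.1.trans Finset.subset_union_right, this.2⟩
  · simpa [a1] using a4
  · intro v hv
    rcases Finset.mem_union.1 hv with hv | hv
    · obtain ⟨i, hi, h⟩ := a5 v hv
      exact ⟨i, by omega, by simpa only [hl i hi] using h⟩
    · obtain ⟨i, hi, h⟩ := b5 v hv
      exact ⟨n + i, by omega, by simpa only [hr i] using h⟩
  · intro u hu v hv huv
    rcases Finset.mem_union.1 hu with hu | hu <;> rcases Finset.mem_union.1 hv with hv | hv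
    · obtain ⟨i, hi, h⟩ := a6 u hu v hv huv
      exact ⟨i, by omega, by simpa only [hl i hi] using h⟩
    · exact key u hu v hv huv
    · obtain ⟨i, hi, h1, h2⟩ := key v hv u hu huv.symm
      exact ⟨i, hi, h2, h1⟩
    · obtain ⟨i, hi, h⟩ := b6 u hu v hv huv
      exact ⟨n + i, by omega, by simpa only [hr i] using h⟩
  · intro i hi h0 v hv hj
    obtain ⟨j, hj, hvj⟩ := hj
    dsimp only at hv hvj ⊢
    by_cases hin : i < n
    · simp only [if_pos hin] at hv ⊢
      rw [if_pos (by omega)] at hvj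
      have := a2 i hin h0
      rw [if_pos (by omega)]
      exact a7 i hin h0 v hv ⟨j, hj, hvj⟩
    · simp only [if_neg hin] at hv ⊢
      obtain ⟨i, rfl⟩ : ∃ i', i = n + i' := ⟨i - n, by omega⟩
      simp only [Nat.add_sub_cancel_left] at hv ⊢
      have hvS := (b3 i (by omega)).1 hv
      by_cases hjn : j < n
      · rw [if_pos hjn] at hvj
        have hvS' := (a3 j hjn).1 hvj
        have hvI := Finset.mem_inter.2 ⟨hvS', hvS⟩
        rcases Nat.eq_zero_or_pos i with rfl | hi0
        · simpa [a1] using a4 (hW1 hvI)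
        · rw [if_neg (by omega : ¬ n + i = n), hr]
          exact b7 i (by omega) hi0 v hv ⟨0, hi0, b4 (hW2 hvI)⟩
      · rw [if_neg hjn] at hvj
        rw [if_neg (by omega : ¬ n + i = n), hr]
        exact b7 i (by omega) (by omega) v hv ⟨j - n, by omega, hvj⟩

open Classical in
theorem rip_exists [Fintype V] {k : ℕ} (h : ¬∃ 𝓑, Br G k 𝓑) (N : ℕ) :
    ∀ S W : Finset V, S.card ≤ N → W ⊆ S → W.card ≤ 2 * k → RIP G (3 * k) S W := by
  induction N with
  | zero => intro S W hS hW _; exact RIP.single (by omega) hW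
  | succ N ih =>
    intro S W hS hW hWk
    by_cases hSk : S.card ≤ 3 * k
    · exact RIP.single hSk hW
    obtain ⟨W', hWW', hW'S, hW'⟩ := Finset.exists_subsuperset_card_eq hW hWk (by omega : 2 * k ≤ S.card)
    refine RIP.mono ?_ hWW'
    obtain ⟨X, hX, hXb⟩ := bal_sep h W'
    set X' := X ∩ S with hX'
    have hX'c : X'.card < k := lt_of_le_of_lt (Finset.card_le_card Finset.inter_subset_left) hX
    have inner : ∀ M : ℕ, ∀ U : Finset V, U.card ≤ M → U ⊆ S \ X →
        (∀ u ∈ U, ∀ v ∈ S \ X, G.Adj u v → v ∈ U) → RIP G (3 * k) (W' ∪ X' ∪ U) (W' ∪ X') := by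
      intro M
      induction M with
      | zero =>
        intro U hU _ _
        obtain rfl : U = ∅ := Finset.card_eq_zero.1 (by omega)
        rw [Finset.union_empty]
        exact RIP.single ((Finset.card_union_le _ _).trans (by omega)) (Finset.Subset.refl _)
      | succ M ihM =>
        intro U hU hUS hcl
        rcases U.eq_empty_or_nonempty with rfl | ⟨a, ha⟩
        · rw [Finset.union_empty]
          exact RIP.single ((Finset.card_union_le _ _).trans (by omega)) (Finset.Subset.refl _)
        set D : Finset V := Finset.univ.filter (· ∈ comp G (↑(S \ X) : Set V) a) with hD
        have haS : a ∈ (↑(S \ X) : Set V) := by simpa using hUS ha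
        have hDm : ∀ v, v ∈ D ↔ v ∈ comp G (↑(S \ X) : Set V) a := fun v => by simp [hD]
        have hDS : ∀ v ∈ D, v ∈ S \ X := fun v hv => by
          have := comp_sub haS ((hDm v).1 hv); simpa using this
        have hDcl : ∀ u ∈ D, ∀ v ∈ S \ X, G.Adj u v → v ∈ D := fun u hu v hv huv => by
          rw [hDm] at hu ⊢; exact comp_step hu (by simpa using hv) huv
        have hDU : D ⊆ U := by
          intro v hv
          rw [hDm] at hv
          refine (comp_conn haS).2 (↑U) ⟨a, mem_comp_self, ha⟩ ?_ hv
          intro x hx hxU y hy hxy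
          exact hcl x hxU y (by simpa using comp_sub haS hy) hxy
        have haD : a ∈ D := (hDm a).2 mem_comp_self
        have r1 := ihM (U \ D) (by
            have := Finset.card_lt_card (Finset.ssubset_iff_subset_ne.2
              ⟨Finset.sdiff_subset, fun e => (Finset.mem_sdiff.1 (e.symm ▸ ha : a ∈ U \ D)).2 haD⟩ : U \ D ⊂ U)
            omega) (Finset.sdiff_subset.trans hUS) (by
            intro u hu v hv huv
            rw [Finset.mem_sdiff] at hu ⊢
            refine ⟨hcl u hu.1 v hv huv, fun hvD => hu.2 (hDcl v hvD u (hUS hu.1) huv.symm)⟩)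
        have hbal := hXb _ (comp_conn (G := G) haS) (fun x hx hx' => by
          have := comp_sub haS hx'; simp [hx] at this)
        have hWD : (W' ∩ D).card ≤ k := by
          have : W' ∩ D = W'.filter (· ∈ comp G (↑(S \ X) : Set V) a) := by
            ext v; simp [hDm]
          rw [this]; omega
        have hDXS : D ∪ X' ⊆ S := Finset.union_subset (fun v hv => (Finset.mem_sdiff.1 (hDS v hv)).1)
          Finset.inter_subset_right
        have r2 := ih (D ∪ X') ((W' ∩ D) ∪ X') (by
            have hss : D ∪ X' ⊂ S := by
              refine Finset.ssubset_iff_subset_ne.2 ⟨hDXS, fun e => ?_⟩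
              have h1 : W' ⊆ (W' ∩ D) ∪ X' := by
                intro v hv
                have := hW'S hv
                rw [← e] at this
                simp only [Finset.mem_union, Finset.mem_inter] at this ⊢
                tauto
              have := (Finset.card_le_card h1).trans (Finset.card_union_le _ _)
              omega
            have := Finset.card_lt_card hss
            omega) (Finset.union_subset_union_left Finset.inter_subset_right)
            ((Finset.card_union_le _ _).trans (by omega))
        have e : W' ∪ X' ∪ U = (W' ∪ X' ∪ (U \ D)) ∪ (D ∪ X') := by
          ext v
          have := @hDU v
          simp only [Finset.mem_union, Finset.mem_sdiff]; tauto
        rw [e]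
        have hint : (W' ∪ X' ∪ (U \ D)) ∩ (D ∪ X') ⊆ (W' ∩ D) ∪ X' := by
          intro v
          simp only [Finset.mem_union, Finset.mem_sdiff, Finset.mem_inter]; tauto
        refine RIP.glue r1 r2 (hint.trans (Finset.union_subset_union_left Finset.inter_subset_left)) hint ?_
        intro u hu v hv huv
        by_cases hvX : v ∈ X'
        · right; simp [hvX]
        · have hvD : v ∈ D := by simpa [hvX] using hv
          left
          by_cases huX : u ∈ X'
          · simp [huX]
          · have huS : u ∈ S := by
              simp only [Finset.mem_union, Finset.mem_sdiff] at hu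
              rcases hu with (hu | hu) | hu
              · exact hW'S hu
              · exact absurd hu huX
              · exact (Finset.mem_sdiff.1 (hUS hu.1)).1
            have : u ∈ S \ X := by
              rw [Finset.mem_sdiff]
              exact ⟨huS, fun h => huX (Finset.mem_inter.2 ⟨h, huS⟩)⟩
            exact Finset.mem_union_left _ (hDcl v hvD u this huv.symm)
    have := inner _ (S \ X) le_rfl (Finset.Subset.refl _) (fun _ _ v hv _ => hv)
    have e : W' ∪ X' ∪ (S \ X) = S := by
      ext v
      have := @hW'S v
      simp only [hX', Finset.mem_union, Finset.mem_sdiff, Finset.mem_inter]; tauto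
    rw [e] at this
    exact this.mono Finset.subset_union_left

theorem tree_of_parent {n : ℕ} (p : ℕ → ℕ) (hn : 0 < n) (hp : ∀ i < n, 0 < i → p i < i) :
    ∃ T : SimpleGraph (Fin n), T.IsTree ∧ ∀ (Q : Set (Fin n)) (r : Fin n), r ∈ Q →
      (∀ i ∈ Q, i ≠ r → ∃ h : 0 < i.val, (⟨p i, (hp i i.2 h).trans i.2⟩ : Fin n) ∈ Q) →
      (T.induce Q).Connected := by
  let T : SimpleGraph (Fin n) := SimpleGraph.fromRel (fun i j => 0 < i.val ∧ p i = j.val)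
  have hC : ∀ (Q : Set (Fin n)) (r : Fin n), r ∈ Q →
      (∀ i ∈ Q, i ≠ r → ∃ h : 0 < i.val, (⟨p i, (hp i i.2 h).trans i.2⟩ : Fin n) ∈ Q) →
      (T.induce Q).Connected := by
    intro Q r hr hQ
    have key : ∀ m : ℕ, ∀ i : Q, i.1.val ≤ m → (T.induce Q).Reachable i ⟨r, hr⟩ := by
      intro m
      induction m with
      | zero =>
        rintro ⟨i, hi⟩ him
        by_cases hir : i = r
        · subst hir; exact Reachable.refl _
        · obtain ⟨h, -⟩ := hQ i hi hir
          simp only at him; omega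
      | succ m ih =>
        rintro ⟨i, hi⟩ him
        by_cases hir : i = r
        · subst hir; exact Reachable.refl _
        · obtain ⟨h, h2⟩ := hQ i hi hir
          have hlt := hp i i.2 h
          refine Reachable.trans (Adj.reachable ?_) (ih ⟨_, h2⟩ (by simp only at him ⊢; omega))
          simp only [comap_adj, Function.Embedding.subtype_apply, T, fromRel_adj]
          refine ⟨fun e => ?_, .inl ⟨h, trivial⟩⟩
          have := congrArg Fin.val e
          simp only at this; omega
    have : Nonempty Q := ⟨⟨r, hr⟩⟩
    exact ⟨fun a b => (key _ a le_rfl).trans (key _ b le_rfl).symm⟩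
  refine ⟨T, ?_, hC⟩
  have hconn : T.Connected := by
    have := hC univ ⟨0, hn⟩ (mem_univ _) (fun i _ hi => ⟨by
      rcases Nat.eq_zero_or_pos i.val with h | h
      · exact absurd (Fin.ext h) hi
      · exact h, mem_univ _⟩)
    exact (Iso.connected_iff (induceUnivIso T)).1 this
  rw [isTree_iff_connected_and_card]
  refine ⟨hconn, le_antisymm ?_ (hconn.card_vert_le_card_edgeSet_add_one)⟩
  have hsub : T.edgeSet ⊆ (fun i : Fin n => if h : 0 < i.val then
      s(i, (⟨p i, (hp i i.2 h).trans i.2⟩ : Fin n)) else s(i, i)) '' {i | i ≠ ⟨0, hn⟩} := by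
    intro e
    induction e with
    | h a b =>
      intro h
      simp only [mem_edgeSet, T, fromRel_adj] at h
      rcases h.2 with h | h
      · refine ⟨a, fun e => by simp [e] at h, ?_⟩
        simp only [h.1, dif_pos, h.2]
      · refine ⟨b, fun e => by simp [e] at h, ?_⟩
        simp only [h.1, dif_pos, h.2]; rw [Sym2.eq_swap]
  have h1 := Set.ncard_le_ncard hsub (Set.toFinite _)
  have h2 := Set.ncard_image_le (f := (fun i : Fin n => if h : 0 < i.val then
      s(i, (⟨p i, (hp i i.2 h).trans i.2⟩ : Fin n)) else s(i, i))) (s := {i | i ≠ ⟨0, hn⟩}) (Set.toFinite _)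
  have h3 : ({i | i ≠ ⟨0, hn⟩} : Set (Fin n)).ncard = n - 1 := by
    have := Set.ncard_add_ncard_compl ({⟨0, hn⟩} : Set (Fin n))
    rw [Set.ncard_singleton, Nat.card_fin] at this
    have e : ({⟨0, hn⟩}ᶜ : Set (Fin n)) = {i | i ≠ ⟨0, hn⟩} := rfl
    rw [← e]; omega
  rw [Nat.card_fin, Nat.card_coe_set_eq]
  omega

theorem tw_of_no_bramble [Fintype V] {k : ℕ} (h : ¬∃ 𝓑, Br G k 𝓑) :
    HasTreewidthAtMost G (3 * k) := by
  classical
  obtain ⟨n, χ, p, h1, h2, h3, h4, h5, h6, h7⟩ := rip_exists h _ Finset.univ ∅ le_rfl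
    (Finset.empty_subset _) (by simp)
  obtain ⟨T, hT, hC⟩ := tree_of_parent p h1 h2
  refine ⟨Fin n, T, fun i => χ i, hT, fun v => ?_, fun u v huv => ?_, fun v => ?_, fun i => ?_⟩
  · obtain ⟨i, hi, h⟩ := h5 v (Finset.mem_univ _)
    exact ⟨⟨i, hi⟩, h⟩
  · obtain ⟨i, hi, h⟩ := h6 u (Finset.mem_univ _) v (Finset.mem_univ _) huv
    exact ⟨⟨i, hi⟩, h⟩
  · have hex : ∃ i, i < n ∧ v ∈ χ i := by
      obtain ⟨i, hi, h⟩ := h5 v (Finset.mem_univ _); exact ⟨i, hi, h⟩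
    have hr := Nat.find_spec hex
    refine hC _ ⟨Nat.find hex, hr.1⟩ hr.2 fun i hi hir => ?_
    have hle : Nat.find hex ≤ i.val := Nat.find_min' hex ⟨i.2, hi⟩
    have hlt : Nat.find hex < i.val := lt_of_le_of_ne hle fun e => hir (Fin.ext e.symm)
    exact ⟨by omega, h7 i i.2 (by omega) v hi ⟨_, hlt, hr.2⟩⟩
  · exact (h3 i i.2).2.trans (by omega)

end tw
end Paper
namespace Paper

section crit
variable {V : Type} {G : SimpleGraph V} {k : ℕ} {𝓑 : Set (Set V)}

structure Crit (G : SimpleGraph V) (k : ℕ) (𝓑 : Set (Set V)) : Prop where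
  br : Br G k 𝓑
  min : ∀ S : Set V, S ≠ univ → ∀ 𝓑', Br G k 𝓑' → ¬ ∀ b ∈ 𝓑', b ⊆ S

def Small (𝓑 : Set (Set V)) (S : Set V) : Prop := ∀ b ∈ 𝓑, ¬ b ⊆ S

theorem conn_induce {J : Set V} {b : Set J} : Conn (G.induce J) b ↔ Conn G (Subtype.val '' b) := by
  unfold Conn
  rw [image_nonempty]
  refine and_congr Iff.rfl ⟨fun h T ⟨a, ⟨a', ha', e⟩, haT⟩ hT => ?_, fun h T ⟨a, ha, haT⟩ hT => ?_⟩
  · subst e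
    have := h (Subtype.val ⁻¹' T) ⟨a', ha', haT⟩ (fun x hx hxT y hy hxy =>
      hT x ⟨x, hx, rfl⟩ hxT y ⟨y, hy, rfl⟩ hxy)
    rintro _ ⟨x, hx, rfl⟩; exact this hx
  · have := h (Subtype.val '' T) ⟨a, ⟨a, ha, rfl⟩, ⟨a, haT, rfl⟩⟩ (by
      rintro _ ⟨x, hx, rfl⟩ ⟨x', hxT, e⟩ _ ⟨y, hy, rfl⟩ hxy
      obtain rfl := Subtype.ext e
      exact ⟨y, hT _ hx hxT y hy hxy, rfl⟩)
    intro x hx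
    obtain ⟨y, hy, e⟩ := this ⟨x, hx, rfl⟩
    exact Subtype.ext e ▸ hy

theorem exists_crit [Fintype V] (h : ∃ 𝓑, Br G k 𝓑) :
    ∃ (J : Set V) (𝓑 : Set (Set J)), Crit (G.induce J) k 𝓑 := by
  classical
  obtain ⟨𝓑, h⟩ := h
  have hw : ∃ n, ∃ J : Set V, J.ncard = n ∧ ∃ 𝓑, Br G k 𝓑 ∧ ∀ b ∈ 𝓑, b ⊆ J :=
    ⟨_, univ, rfl, 𝓑, h, fun b _ => subset_univ b⟩
  obtain ⟨J, hJn, 𝓑, hB, hBJ⟩ := Nat.find_spec hw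
  have hmin : ∀ J' : Set V, (∃ 𝓑, Br G k 𝓑 ∧ ∀ b ∈ 𝓑, b ⊆ J') → J.ncard ≤ J'.ncard :=
    fun J' h' => hJn ▸ Nat.find_min' hw ⟨J', rfl, h'⟩
  refine ⟨J, (fun b => Subtype.val ⁻¹' b) '' 𝓑, ⟨?_, ?_, ?_⟩, ?_⟩
  · rintro _ ⟨b, hb, rfl⟩
    rw [conn_induce, Subtype.image_preimage_coe, inter_eq_right.2 (hBJ b hb)]
    exact hB.conn b hb
  · rintro _ ⟨b, hb, rfl⟩ _ ⟨b', hb', rfl⟩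
    obtain ⟨x, hx, y, hy, h⟩ := hB.touch b hb b' hb'
    refine ⟨⟨x, hBJ b hb hx⟩, hx, ⟨y, hBJ b' hb' hy⟩, hy, ?_⟩
    rcases h with rfl | h
    · exact .inl rfl
    · exact .inr h
  · intro X hX
    obtain ⟨b, hb, h⟩ := hB.ord (X.map (Function.Embedding.subtype _)) (by simpa using hX)
    refine ⟨_, ⟨b, hb, rfl⟩, fun x hx hxb => h x ?_ hxb⟩
    simp [hx]
  · intro S hS 𝓑' h' hS'
    have : J.ncard ≤ (Subtype.val '' S).ncard := by
      refine hmin _ ⟨(fun b => Subtype.val '' b) '' 𝓑', ⟨?_, ?_, ?_⟩, ?_⟩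
      · rintro _ ⟨b, hb, rfl⟩
        exact conn_induce.1 (h'.conn b hb)
      · rintro _ ⟨b, hb, rfl⟩ _ ⟨b', hb', rfl⟩
        obtain ⟨x, hx, y, hy, h⟩ := h'.touch b hb b' hb'
        refine ⟨x, ⟨x, hx, rfl⟩, y, ⟨y, hy, rfl⟩, ?_⟩
        rcases h with rfl | h
        · exact .inl rfl
        · exact .inr h
      · intro X hX
        obtain ⟨b, hb, h⟩ := h'.ord (X.subtype (· ∈ J)) (by
          rw [Finset.card_subtype]
          exact lt_of_le_of_lt (Finset.card_filter_le _ _) hX)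
        refine ⟨_, ⟨b, hb, rfl⟩, ?_⟩
        rintro x hx ⟨y, hy, rfl⟩
        exact h y (by simpa using hx) hy
      · rintro _ ⟨b, hb, rfl⟩
        exact image_mono (hS' b hb)
    have hlt : (Subtype.val '' S) ⊂ J := by
      obtain ⟨x, hx⟩ := (ne_univ_iff_exists_notMem S).1 hS
      refine ⟨by rintro _ ⟨y, _, rfl⟩; exact y.2, fun h => ?_⟩
      obtain ⟨y, hy, e⟩ := h x.2
      exact hx (Subtype.ext e ▸ hy)
    exact absurd (ncard_lt_ncard hlt (toFinite _)) (by omega)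

theorem Conn.exists_nb {b S : Set V} (hb : Conn G b) (h1 : ∃ x ∈ b, x ∈ S) (h2 : ¬ b ⊆ S) :
    ∃ κ ∈ b, κ ∈ nbhdOfSet G S := by
  by_contra hc
  push Not at hc
  refine h2 (hb.2 S h1 fun x hx hxS y hy hxy => ?_)
  by_contra hyS
  exact hc y hy ⟨hyS, x, hxS, hxy.symm⟩

theorem crit_R (hc : Crit G k 𝓑) {S D : Set V} (ρ : V → V) (hS : Small 𝓑 S) (hDS : D ⊆ S)
    (hne : ∃ s ∈ S, s ∉ D) (hρ : ∀ d ∈ D, ρ d ∈ nbhdOfSet G S)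
    (hF : ∀ κ ∈ nbhdOfSet G S, Conn G (insert κ {d | d ∈ D ∧ ρ d = κ}))
    (hp : ∀ κ ∈ nbhdOfSet G S, ∀ κ' ∈ nbhdOfSet G S, κ ≠ κ' →
      ∃ x ∈ insert κ {d | d ∈ D ∧ ρ d = κ}, ∃ y ∈ insert κ' {d | d ∈ D ∧ ρ d = κ'}, G.Adj x y) :
    False := by
  classical
  let f : Set V → Set V := fun b => (b \ S) ∪ {d | d ∈ D ∧ ρ d ∈ b}
  have hFf : ∀ b κ, κ ∈ b → κ ∈ nbhdOfSet G S → insert κ {d | d ∈ D ∧ ρ d = κ} ⊆ f b := by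
    rintro b κ hκ hκS x (rfl | ⟨hx, rfl⟩)
    · exact .inl ⟨hκ, hκS.1⟩
    · exact .inr ⟨hx, hκ⟩
  have hptch : ∀ κ ∈ nbhdOfSet G S, ∀ κ' ∈ nbhdOfSet G S,
      ∃ x ∈ insert κ {d | d ∈ D ∧ ρ d = κ}, ∃ y ∈ insert κ' {d | d ∈ D ∧ ρ d = κ'}, x = y ∨ G.Adj x y := by
    intro κ h κ' h'
    by_cases e : κ = κ'
    · subst e; exact ⟨κ, .inl rfl, κ, .inl rfl, .inl rfl⟩
    · obtain ⟨x, hx, y, hy, h⟩ := hp κ h κ' h' e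
      exact ⟨x, hx, y, hy, .inr h⟩
  refine hc.min (Sᶜ ∪ D) ?_ (f '' 𝓑) ⟨?_, ?_, ?_⟩ ?_
  · obtain ⟨s, hs, hsD⟩ := hne
    intro e
    have : s ∈ Sᶜ ∪ D := e ▸ mem_univ s
    rcases this with h | h
    · exact h hs
    · exact hsD h
  · rintro _ ⟨b, hb, rfl⟩
    have hbc := hc.br.conn b hb
    obtain ⟨x₀, hx₀, hx₀S⟩ := not_subset.1 (hS b hb)
    refine ⟨⟨x₀, .inl ⟨hx₀, hx₀S⟩⟩, ?_⟩
    rintro T ⟨x, hx, hxT⟩ hT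
    have hFT : ∀ κ ∈ b, κ ∈ nbhdOfSet G S → ∀ y ∈ insert κ {d | d ∈ D ∧ ρ d = κ}, y ∈ T →
        insert κ {d | d ∈ D ∧ ρ d = κ} ⊆ T := by
      intro κ hκ hκS y hy hyT
      exact (hF κ hκS).2 T ⟨y, hy, hyT⟩ fun a ha haT c hcc hac =>
        hT a (hFf b κ hκ hκS ha) haT c (hFf b κ hκ hκS hcc) hac
    have hall : ∀ κ ∈ b, κ ∈ nbhdOfSet G S → κ ∈ T → ∀ κ' ∈ b, κ' ∈ nbhdOfSet G S → κ' ∈ T := by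
      intro κ hκ hκS hκT κ' hκ' hκS'
      have h1 := hFT κ hκ hκS κ (.inl rfl) hκT
      obtain ⟨x, hx, y, hy, h⟩ := hptch κ hκS κ' hκS'
      have hyT : y ∈ T := by
        rcases h with rfl | h
        · exact h1 hx
        · exact hT x (hFf b κ hκ hκS hx) (h1 hx) y (hFf b κ' hκ' hκS' hy) h
      exact hFT κ' hκ' hκS' y hy hyT (.inl rfl)
    have hxT' : ∃ z ∈ b, z ∉ S ∧ z ∈ T := by
      rcases hx with hx | ⟨hx, hx'⟩
      · exact ⟨x, hx.1, hx.2, hxT⟩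
      · exact ⟨ρ x, hx', (hρ x hx).1, hFT _ hx' (hρ x hx) x (.inr ⟨hx, rfl⟩) hxT (.inl rfl)⟩
    obtain ⟨z, hz, hzS, hzT⟩ := hxT'
    have hbT : ∀ y ∈ b, y ∉ S → y ∈ T := by
      by_cases hk : ∃ κ ∈ b, κ ∈ nbhdOfSet G S ∧ κ ∈ T
      · obtain ⟨κ, hκ, hκS, hκT⟩ := hk
        have := hbc.2 (T ∪ S) ⟨z, hz, .inl hzT⟩ (by
          intro a ha haT c hcb hac
          by_cases hcS : c ∈ S
          · exact .inr hcS
          · by_cases haS : a ∈ S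
            · exact .inl (hall κ hκ hκS hκT c hcb ⟨hcS, a, haS, hac.symm⟩)
            · exact .inl (hT a (.inl ⟨ha, haS⟩) (haT.resolve_right haS) c (.inl ⟨hcb, hcS⟩) hac))
        intro y hy hyS
        exact (this hy).resolve_right hyS
      · push Not at hk
        have := hbc.2 (T \ S) ⟨z, hz, hzT, hzS⟩ (by
          intro a ha haT c hcb hac
          by_cases hcS : c ∈ S
          · exact absurd haT.1 (hk a ha ⟨haT.2, c, hcS, hac⟩)
          · exact ⟨hT a (.inl ⟨ha, haT.2⟩) haT.1 c (.inl ⟨hcb, hcS⟩) hac, hcS⟩)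
        intro y hy _
        exact (this hy).1
    rintro y (hy | ⟨hy, hy'⟩)
    · exact hbT y hy.1 hy.2
    · exact hFT _ hy' (hρ y hy) _ (.inl rfl) (hbT _ hy' (hρ y hy).1) (.inr ⟨hy, rfl⟩)
  · rintro _ ⟨b, hb, rfl⟩ _ ⟨b', hb', rfl⟩
    have main : ∀ κ ∈ b, κ ∈ nbhdOfSet G S → ∀ κ' ∈ b', κ' ∈ nbhdOfSet G S →
        ∃ x ∈ f b, ∃ y ∈ f b', x = y ∨ G.Adj x y := by
      intro κ h1 h2 κ' h3 h4
      obtain ⟨x, hx, y, hy, h⟩ := hptch κ h2 κ' h4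
      exact ⟨x, hFf b κ h1 h2 hx, y, hFf b' κ' h3 h4 hy, h⟩
    obtain ⟨x, hx, y, hy, h⟩ := hc.br.touch b hb b' hb'
    have ex : ∀ b ∈ 𝓑, ∀ x ∈ b, x ∈ S → ∃ κ ∈ b, κ ∈ nbhdOfSet G S := fun b hb x hx hxS =>
      (hc.br.conn b hb).exists_nb ⟨x, hx, hxS⟩ (hS b hb)
    by_cases hxS : x ∈ S <;> by_cases hyS : y ∈ S
    · obtain ⟨κ, h1, h2⟩ := ex b hb x hx hxS
      obtain ⟨κ', h3, h4⟩ := ex b' hb' y hy hyS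
      exact main κ h1 h2 κ' h3 h4
    · obtain ⟨κ, h1, h2⟩ := ex b hb x hx hxS
      rcases h with rfl | h
      · exact absurd hxS hyS
      · exact main κ h1 h2 y hy ⟨hyS, x, hxS, h.symm⟩
    · obtain ⟨κ, h1, h2⟩ := ex b' hb' y hy hyS
      rcases h with rfl | h
      · exact absurd hyS hxS
      · exact main x hx ⟨hxS, y, hyS, h⟩ κ h1 h2
    · exact ⟨x, .inl ⟨hx, hxS⟩, y, .inl ⟨hy, hyS⟩, h⟩
  · intro X hX
    obtain ⟨b, hb, h⟩ := hc.br.ord (X.image fun x => if x ∈ D then ρ x else x)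
      (lt_of_le_of_lt Finset.card_image_le hX)
    refine ⟨_, ⟨b, hb, rfl⟩, ?_⟩
    rintro x hx (hxb | hxb)
    · have := h x (Finset.mem_image.2 ⟨x, hx, if_neg fun hD => hxb.2 (hDS hD)⟩)
      exact this hxb.1
    · exact h (ρ x) (Finset.mem_image.2 ⟨x, hx, if_pos hxb.1⟩) hxb.2
  · rintro _ ⟨b, hb, rfl⟩ x (hx | hx)
    · exact .inl hx.2
    · exact .inr hx.1

theorem small_or (hc : Br G k 𝓑) {S T : Set V} (h : ∀ x ∈ S, ∀ y ∈ T, x ≠ y ∧ ¬ G.Adj x y) :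
    Small 𝓑 S ∨ Small 𝓑 T := by
  by_contra hn
  simp only [Small, not_or, not_forall, not_not] at hn
  obtain ⟨⟨b, hb, hbS⟩, b', hb', hbT⟩ := hn
  obtain ⟨x, hx, y, hy, hxy⟩ := hc.touch b hb b' hb'
  have := h x (hbS hx) y (hbT hy)
  tauto

theorem nb_comp {X : Set V} {a : V} : nbhdOfSet G (comp G Xᶜ a) ⊆ X := by
  rintro v ⟨hv, d, hd, hvd⟩
  by_contra h
  exact hv (comp_step hd h hvd.symm)

theorem comp_anti {S : Set V} {a b : V} (hb : b ∈ S) (h : b ∉ comp G S a) :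
    ∀ x ∈ comp G S a, ∀ y ∈ comp G S b, x ≠ y ∧ ¬ G.Adj x y := by
  intro x hx y hy
  have hyb : Reach G S y b := Reach.symm hb hy
  refine ⟨fun e => h ?_, fun e => h ?_⟩
  · subst e; exact Relation.ReflTransGen.trans hx hyb
  · exact Relation.ReflTransGen.trans (comp_step hx (comp_sub hb hy) e) hyb

theorem crit_clique_small (hc : Crit G k 𝓑) {S : Set V} (hS : Small 𝓑 S) (hne : S.Nonempty)
    (hK : G.IsClique (nbhdOfSet G S)) : False := by
  obtain ⟨s, hs⟩ := hne
  refine crit_R hc (D := ∅) id hS (empty_subset _) ⟨s, hs, by simp⟩ (by simp) ?_ ?_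
  · intro κ _
    simpa using Conn.single κ
  · intro κ h κ' h' hne
    exact ⟨κ, .inl rfl, κ', .inl rfl, hK h h' hne⟩

theorem crit_no_clique_cutset (hc : Crit G k 𝓑) {K : Set V} (hK : G.IsClique K) : PConn G Kᶜ := by
  refine pconn_of_reach fun a ha b hb => ?_
  by_contra h
  rcases small_or hc.br (comp_anti hb h) with h' | h'
  · exact crit_clique_small hc h' ⟨a, mem_comp_self⟩ (hK.subset nb_comp)
  · exact crit_clique_small hc h' ⟨b, mem_comp_self⟩ (hK.subset nb_comp)

end crit
end Paper
namespace Paper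

section lemA
variable {V : Type} {G : SimpleGraph V}

def app (f : ℕ → V) (n : ℕ) (g : ℕ → V) : ℕ → V := fun k => if k ≤ n then f k else g (k - (n + 1))

theorem app_l {f g : ℕ → V} {n i : ℕ} (h : i ≤ n) : app f n g i = f i := if_pos h
theorem app_r {f g : ℕ → V} {n : ℕ} (i : ℕ) : app f n g (n + 1 + i) = g i := by
  rw [app, if_neg (by omega), Nat.add_sub_cancel_left]

theorem IP.app {f g : ℕ → V} {n m : ℕ} (hf : IP G f n) (hg : IP G g m)
    (h : ∀ i j, i ≤ n → j ≤ m → f i ≠ g j ∧ (G.Adj (f i) (g j) ↔ (i = n ∧ j = 0))) :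
    IP G (app f n g) (n + 1 + m) := by
  intro i j hij hj
  by_cases h1 : j ≤ n
  · rw [app_l h1, app_l (by omega)]; exact hf i j hij h1
  · obtain ⟨j, rfl⟩ : ∃ j', j = n + 1 + j' := ⟨j - (n+1), by omega⟩
    rw [app_r]
    by_cases h2 : i ≤ n
    · rw [app_l h2]
      have := h i j h2 (by omega)
      refine ⟨this.1, ?_⟩
      rw [this.2]; omega
    · obtain ⟨i, rfl⟩ : ∃ i', i = n + 1 + i' := ⟨i - (n+1), by omega⟩
      rw [app_r]
      have := hg i j (by omega) (by omega)
      refine ⟨this.1, ?_⟩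
      rw [this.2]; omega

theorem app_forall {f g : ℕ → V} {n m : ℕ} {P : V → Prop} :
    (∀ i ≤ n + 1 + m, P (app f n g i)) ↔ (∀ i ≤ n, P (f i)) ∧ ∀ i ≤ m, P (g i) := by
  constructor
  · intro h
    exact ⟨fun i hi => by have := h i (by omega); rwa [app_l hi] at this,
      fun i hi => by have := h (n+1+i) (by omega); rwa [app_r] at this⟩
  · rintro ⟨h1, h2⟩ i hi
    by_cases h : i ≤ n
    · rw [app_l h]; exact h1 i h
    · obtain ⟨i, rfl⟩ : ∃ i', i = n + 1 + i' := ⟨i - (n+1), by omega⟩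
      rw [app_r]; exact h2 i (by omega)

theorem app_img {f g : ℕ → V} {n m : ℕ} :
    app f n g '' Iic (n + 1 + m) = f '' Iic n ∪ g '' Iic m := by
  apply Subset.antisymm
  · rintro _ ⟨i, hi, rfl⟩
    revert i
    change ∀ i ≤ n + 1 + m, app f n g i ∈ _
    rw [app_forall]
    exact ⟨fun i hi => .inl ⟨i, hi, rfl⟩, fun i hi => .inr ⟨i, hi, rfl⟩⟩
  · rintro _ (⟨i, hi, rfl⟩ | ⟨i, hi, rfl⟩)
    · exact ⟨i, by simp only [mem_Iic] at *; omega, app_l hi⟩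
    · exact ⟨n + 1 + i, by simp only [mem_Iic] at *; omega, app_r i⟩

theorem IP.const (a : V) : IP G (fun _ => a) 0 := by intro i j; omega

theorem IP.snoc {f : ℕ → V} {n : ℕ} (hf : IP G f n) {a : V}
    (h : ∀ i ≤ n, f i ≠ a ∧ (G.Adj (f i) a ↔ i = n)) : IP G (Paper.app f n fun _ => a) (n + 1) :=
  hf.app (IP.const a) fun i j hi hj => ⟨(h i hi).1, by rw [(h i hi).2]; omega⟩

structure LA (G : SimpleGraph V) (y : ℕ → V) (L : ℕ) (g : ℕ → V) (N : ℕ) (b b' : V) : Prop where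
  hy : IP G y L
  hL : 1 ≤ L
  bb : G.Adj b b'
  ab' : ∀ i ≤ L, G.Adj (y i) b' ↔ i = 0
  ab : ∀ i ≤ L, G.Adj (y i) b ↔ i = L
  nb' : ∀ i ≤ L, y i ≠ b'
  nb : ∀ i ≤ L, y i ≠ b
  hg : IP G g N
  gb : ∀ i ≤ N, g i ≠ b
  gb' : ∀ i ≤ N, g i ≠ b'
  gy : ∀ i ≤ N, ∀ j ≤ L, g i ≠ y j
  g0 : G.Adj (g 0) b
  g0' : G.Adj (g 0) b'
  gny : ∀ i < N, ∀ j ≤ L, ¬ G.Adj (g i) (y j)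
  gN : ∃ j ≤ L, G.Adj (g N) (y j)

variable {y : ℕ → V} {L : ℕ} {g : ℕ → V} {N : ℕ} {b b' : V}

theorem LA.symm (h : LA G y L g N b b') : LA G (fun k => y (L - k)) L g N b' b where
  hy := h.hy.rev
  hL := h.hL
  bb := h.bb.symm
  ab' i hi := by rw [h.ab _ (by omega)]; omega
  ab i hi := by rw [h.ab' _ (by omega)]; omega
  nb' i hi := h.nb _ (by omega)
  nb i hi := h.nb' _ (by omega)
  hg := h.hg
  gb := h.gb'
  gb' := h.gb
  gy i hi j hj := h.gy i hi _ (by omega)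
  g0 := h.g0'
  g0' := h.g0
  gny i hi j hj := h.gny i hi _ (by omega)
  gN := by
    obtain ⟨j, hj, h'⟩ := h.gN
    exact ⟨L - j, by omega, by rwa [Nat.sub_sub_self hj]⟩

theorem LA.case1 (hT : T2F G) (h : LA G y L g N b b') {s s' : ℕ} (hss : s < s') (hs' : s' ≤ N)
    (h1 : G.Adj (g s) b') (h2 : ∀ i, s < i → i ≤ N → ¬ G.Adj (g i) b') (h3 : G.Adj (g s') b) :
    False := by
  classical
  have hw := Nat.find_spec h.gN
  have hwm : ∀ j < Nat.find h.gN, ¬ G.Adj (g N) (y j) := fun j hj hadj =>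
    Nat.find_min h.gN hj ⟨by omega, hadj⟩
  generalize Nat.find h.gN = w at hw hwm
  have hp := ((h.hg.sub (i := s) (m := N - s) (by omega)).app
    ((h.hy.sub (i := 0) (m := w) (by omega)).rev)) (by
      intro i j hi hj
      refine ⟨h.gy _ (by omega) _ (by omega), ?_⟩
      constructor
      · intro hadj
        have : i = N - s := by
          by_contra hne
          exact h.gny _ (by omega) _ (by omega) hadj
        subst this
        refine ⟨rfl, ?_⟩
        by_contra hj0
        rw [show s + (N - s) = N by omega] at hadj
        exact hwm (0 + (w - j)) (by omega) hadj
      · rintro ⟨rfl, rfl⟩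
        rw [show s + (N - s) = N by omega]
        simpa using hw.2)
  have hH := holeSet_cone (x := b') hp (by omega) (by
      refine (app_forall (P := fun v => b' ≠ v)).2 ⟨fun i hi => (h.gb' _ (by omega)).symm, fun i hi => (h.nb' _ (by omega)).symm⟩) (by
      intro i hi
      by_cases hi' : i ≤ N - s
      · rw [app_l hi', G.adj_comm]
        constructor
        · intro hadj
          by_contra hne
          exact h2 (s + i) (by omega) (by omega) hadj
        · intro h; obtain rfl : i = 0 := by omega
          exact h1
      · obtain ⟨i, rfl⟩ : ∃ i', i = N - s + 1 + i' := ⟨i - (N - s + 1), by omega⟩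
        rw [app_r, G.adj_comm, h.ab' _ (by omega)]; omega)
  rw [app_img] at hH
  have := hT.hole _ hH b ?_ b' (.inl rfl) (g s') (.inr (.inl ⟨s' - s, by
    simp only [mem_Iic]; omega, by simp only; congr 1; omega⟩)) h.bb h3.symm (h.gb' _ hs').symm
  · exact h2 s' hss hs' this.symm
  · rintro (e | ⟨i, hi, e⟩ | ⟨i, hi, e⟩)
    · exact h.bb.ne e
    · exact h.gb _ (by simp only [mem_Iic] at hi; omega) e
    · exact h.nb _ (by simp only [mem_Iic] at hi; omega) e

theorem LA.false (hT : T2F G) (h : LA G y L g N b b') : False := by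
  classical
  have hq := h.hy.snoc (a := b) fun i hi => ⟨h.nb i hi, h.ab i hi⟩
  have hH := holeSet_cone (x := b') hq (by have := h.hL; omega) (by
      refine (app_forall (m := 0) (P := fun v => b' ≠ v)).2 ⟨fun i hi => (h.nb' _ (by omega)).symm, fun i hi => h.bb.ne.symm⟩) (by
      intro i hi
      by_cases hi' : i ≤ L
      · rw [app_l hi', G.adj_comm, h.ab' _ hi']; omega
      · obtain ⟨i, rfl⟩ : ∃ i', i = L + 1 + i' := ⟨i - (L + 1), by omega⟩
        rw [app_r]; simp only [h.bb.symm, true_iff]; omega)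
  have hgH : g N ∉ insert b' (app y L (fun _ => b) '' Iic (L + 1)) := by
    rw [app_img (m := 0)]
    rintro (e | ⟨i, hi, e⟩ | ⟨i, hi, e⟩)
    · exact h.gb' _ le_rfl e
    · exact h.gy _ le_rfl i hi e.symm
    · exact h.gb _ le_rfl e.symm
  have hyH : ∀ j ≤ L, y j ∈ insert b' (app y L (fun _ => b) '' Iic (L + 1)) := fun j hj => by
    rw [app_img (m := 0)]; exact .inr (.inl ⟨j, hj, rfl⟩)
  have hbH : b ∈ insert b' (app y L (fun _ => b) '' Iic (L + 1)) := by
    rw [app_img (m := 0)]; exact .inr (.inr ⟨0, by simp, rfl⟩)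
  have hT' := hT.hole _ hH _ hgH
  have lst : ∀ c, G.Adj (g 0) c → ∃ s ≤ N, G.Adj (g s) c ∧ ∀ i, s < i → i ≤ N → ¬ G.Adj (g i) c := by
    intro c hc
    have := Nat.findGreatest_spec (P := fun i => G.Adj (g i) c) (Nat.zero_le N) hc
    exact ⟨_, Nat.findGreatest_le N, this, fun i hi hi' => Nat.findGreatest_is_greatest hi hi'⟩
  obtain ⟨s, hs, hs1, hs2⟩ := lst b' h.g0'
  obtain ⟨r, hr, hr1, hr2⟩ := lst b h.g0
  rcases lt_trichotomy s r with hlt | rfl | hlt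
  · exact h.case1 hT hlt hr hs1 hs2 hr1
  swap
  · exact h.symm.case1 hT hlt hs hr1 hr2 hs1
  have hw := Nat.find_spec h.gN
  have hwm : ∀ j < Nat.find h.gN, ¬ G.Adj (g N) (y j) := fun j hj hadj =>
    Nat.find_min h.gN hj ⟨by omega, hadj⟩
  generalize Nat.find h.gN = w at hw hwm
  obtain ⟨hwL, hwa⟩ := hw
  have hL := h.hL
  rcases hs.eq_or_lt with rfl | hsN
  · have e1 := hT' b' (.inl rfl) (y w) (hyH w hwL) hs1 hwa (h.nb' w hwL).symm
    have e2 := hT' b hbH (y w) (hyH w hwL) hr1 hwa (h.nb w hwL).symm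
    rw [G.adj_comm, h.ab' w hwL] at e1
    rw [G.adj_comm, h.ab w hwL] at e2
    omega
  have hnb : ∀ j ≤ L, G.Adj (g N) (y j) → j = w ∨ j = w + 1 := by
    intro j hj hadj
    by_contra hne
    have hwj : w < j := by
      by_contra hc
      exact hwm j (by omega) hadj
    have := hT' (y w) (hyH w hwL) (y j) (hyH j hj) hwa hadj (fun e => hne (.inl (h.hy.inj hwL hj e).symm))
    rw [h.hy.adj hwL hj] at this
    omega
  have hleft : IP G (app (fun k => y (w - k)) w fun _ => b') (w + 1) := by
    have := (h.hy.sub (i := 0) (m := w) (by omega)).rev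
    simp only [Nat.zero_add] at this
    exact this.snoc fun i hi => ⟨h.nb' _ (by omega), by rw [h.ab' _ (by omega)]; omega⟩
  have hright : ∀ v, v ≤ L → IP G (app (fun k => y (v + k)) (L - v) fun _ => b) (L - v + 1) := by
    intro v hv
    exact (h.hy.sub (i := v) (m := L - v) (by omega)).snoc fun i hi =>
      ⟨h.nb _ (by omega), by rw [h.ab _ (by omega)]; omega⟩
  by_cases htwo : w + 1 ≤ L ∧ G.Adj (g N) (y (w+1))
  · -- prism
    obtain ⟨hw1, hw2⟩ := htwo
    have hmid : IP G (fun k => g (N - k)) (N - s) := by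
      have := (h.hg.sub (i := s) (m := N - s) (by omega)).rev
      intro i j hij hj
      have := this i j hij hj
      simpa only [show s + (N - s - i) = N - i by omega, show s + (N - s - j) = N - j by omega] using this
    refine hT.pri _ _ _ _ _ _ hmid hleft (hright (w+1) hw1) ?_ ?_ ?_ ?_ ?_ ?_ (by omega) (by omega)
      (by omega) ?_ ?_ ?_
    · rw [app_l (by omega)]; simpa using hwa
    · rw [app_l (by omega), app_l (by omega)]
      simpa using (h.hy.adj hwL hw1).2 (.inl rfl)
    · rw [app_l (by omega)]; simpa using hw2
    · rw [show w + 1 = w + 1 + 0 by omega, app_r, Nat.sub_sub_self hs]; exact hs1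
    · rw [show w + 1 = w + 1 + 0 by omega, app_r, show L - (w + 1 + 0) + 1 = L - (w + 1 + 0) + 1 + 0 by omega, app_r]
      exact h.bb.symm
    · rw [show L - (w + 1) + 1 = L - (w + 1) + 1 + 0 by omega, app_r, Nat.sub_sub_self hs]; exact hr1
    · intro i j hi hj
      by_cases hj' : j ≤ w
      · rw [app_l hj']
        refine ⟨h.gy _ (by omega) _ (by omega), fun hadj => .inl ?_⟩
        have hi0 : i = 0 := by
          by_contra hne
          exact h.gny _ (by omega) _ (by omega) hadj
        subst hi0
        have := hnb _ (by omega) hadj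
        omega
      · obtain ⟨j, rfl⟩ : ∃ j', j = w + 1 + j' := ⟨j - (w + 1), by omega⟩
        rw [app_r]
        refine ⟨h.gb' _ (by omega), fun hadj => .inr ⟨?_, by omega⟩⟩
        by_contra hne
        exact hs2 _ (by omega) (by omega) hadj
    · intro i j hi hj
      by_cases hj' : j ≤ L - (w + 1)
      · rw [app_l hj']
        refine ⟨h.gy _ (by omega) _ (by omega), fun hadj => .inl ?_⟩
        have hi0 : i = 0 := by
          by_contra hne
          exact h.gny _ (by omega) _ (by omega) hadj
        subst hi0
        have := hnb _ (by omega) hadj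
        omega
      · obtain ⟨j, rfl⟩ : ∃ j', j = L - (w + 1) + 1 + j' := ⟨j - (L - (w + 1) + 1), by omega⟩
        rw [app_r]
        refine ⟨h.gb _ (by omega), fun hadj => .inr ⟨?_, by omega⟩⟩
        by_contra hne
        exact hr2 _ (by omega) (by omega) hadj
    · intro i j hi hj
      by_cases hi' : i ≤ w
      · rw [app_l hi']
        by_cases hj' : j ≤ L - (w + 1)
        · rw [app_l hj']
          refine ⟨fun e => ?_, fun hadj => .inl ?_⟩
          · have := h.hy.inj (by omega) (by omega) e; omega
          · rw [h.hy.adj (by omega) (by omega)] at hadj; omega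
        · obtain ⟨j, rfl⟩ : ∃ j', j = L - (w + 1) + 1 + j' := ⟨j - (L - (w + 1) + 1), by omega⟩
          rw [app_r]
          refine ⟨h.nb _ (by omega), fun hadj => ?_⟩
          rw [h.ab _ (by omega)] at hadj; omega
      · obtain ⟨i, rfl⟩ : ∃ j', i = w + 1 + j' := ⟨i - (w + 1), by omega⟩
        rw [app_r]
        by_cases hj' : j ≤ L - (w + 1)
        · rw [app_l hj']
          refine ⟨(h.nb' _ (by omega)).symm, fun hadj => ?_⟩
          rw [G.adj_comm, h.ab' _ (by omega)] at hadj; omega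
        · obtain ⟨j, rfl⟩ : ∃ j', j = L - (w + 1) + 1 + j' := ⟨j - (L - (w + 1) + 1), by omega⟩
          rw [app_r]
          exact ⟨h.bb.ne.symm, fun hadj => .inr ⟨by omega, by omega⟩⟩
  · -- pyramid
    have hone : ∀ j ≤ L, G.Adj (g N) (y j) → j = w := by
      intro j hj hadj
      rcases hnb j hj hadj with rfl | rfl
      · rfl
      · exact absurd ⟨hj, hadj⟩ htwo
    have hmid : IP G (app (fun _ => y w) 0 (fun k => g (N - k))) (0 + 1 + (N - s)) := by
      have hm : IP G (fun k => g (N - k)) (N - s) := by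
        have := (h.hg.sub (i := s) (m := N - s) (by omega)).rev
        intro i j hij hj
        have := this i j hij hj
        simpa only [show s + (N - s - i) = N - i by omega, show s + (N - s - j) = N - j by omega] using this
      refine (IP.const (y w)).app hm fun i j hi hj => ⟨(h.gy _ (by omega) _ hwL).symm, ?_⟩
      rw [G.adj_comm]
      constructor
      · intro hadj
        refine ⟨by omega, ?_⟩
        by_contra hne
        exact h.gny _ (by omega) _ hwL hadj
      · rintro ⟨-, rfl⟩; simpa using hwa
    refine hT.pyr _ _ _ _ _ _ hmid hleft (hright w hwL) ?_ ?_ ?_ ?_ ?_ (by omega) (by omega)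
      (by omega) (by omega) (by omega) (by omega) ?_ ?_ ?_
    · rw [app_l (by omega), app_l (by omega)]; simp
    · rw [app_l (by omega), app_l (by omega)]; simp
    · rw [app_r, show w + 1 = w + 1 + 0 by omega, app_r, Nat.sub_sub_self hs]; exact hs1
    · rw [show w + 1 = w + 1 + 0 by omega, app_r, show L - w + 1 = L - w + 1 + 0 by omega, app_r]
      exact h.bb.symm
    · rw [app_r, show L - w + 1 = L - w + 1 + 0 by omega, app_r, Nat.sub_sub_self hs]; exact hr1
    · intro i j hi0 hi hj0 hj
      obtain ⟨i, rfl⟩ : ∃ j', i = 0 + 1 + j' := ⟨i - 1, by omega⟩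
      rw [app_r]
      by_cases hj' : j ≤ w
      · rw [app_l hj']
        refine ⟨h.gy _ (by omega) _ (by omega), fun hadj => ?_⟩
        have hi0 : i = 0 := by
          by_contra hne
          exact h.gny _ (by omega) _ (by omega) hadj
        subst hi0
        have := hone _ (by omega) hadj
        omega
      · obtain ⟨j, rfl⟩ : ∃ j', j = w + 1 + j' := ⟨j - (w + 1), by omega⟩
        rw [app_r]
        refine ⟨h.gb' _ (by omega), fun hadj => ⟨?_, by omega⟩⟩
        by_contra hne
        exact hs2 _ (by omega) (by omega) hadj
    · intro i j hi0 hi hj0 hj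
      obtain ⟨i, rfl⟩ : ∃ j', i = 0 + 1 + j' := ⟨i - 1, by omega⟩
      rw [app_r]
      by_cases hj' : j ≤ L - w
      · rw [app_l hj']
        refine ⟨h.gy _ (by omega) _ (by omega), fun hadj => ?_⟩
        have hi0 : i = 0 := by
          by_contra hne
          exact h.gny _ (by omega) _ (by omega) hadj
        subst hi0
        have := hone _ (by omega) hadj
        omega
      · obtain ⟨j, rfl⟩ : ∃ j', j = L - w + 1 + j' := ⟨j - (L - w + 1), by omega⟩
        rw [app_r]
        refine ⟨h.gb _ (by omega), fun hadj => ⟨?_, by omega⟩⟩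
        by_contra hne
        exact hr2 _ (by omega) (by omega) hadj
    · intro i j hi0 hi hj0 hj
      by_cases hi' : i ≤ w
      · rw [app_l hi']
        by_cases hj' : j ≤ L - w
        · rw [app_l hj']
          refine ⟨fun e => ?_, fun hadj => ?_⟩
          · have := h.hy.inj (by omega) (by omega) e; omega
          · rw [h.hy.adj (by omega) (by omega)] at hadj; omega
        · obtain ⟨j, rfl⟩ : ∃ j', j = L - w + 1 + j' := ⟨j - (L - w + 1), by omega⟩
          rw [app_r]
          refine ⟨h.nb _ (by omega), fun hadj => ?_⟩
          rw [h.ab _ (by omega)] at hadj; omega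
      · obtain ⟨i, rfl⟩ : ∃ j', i = w + 1 + j' := ⟨i - (w + 1), by omega⟩
        rw [app_r]
        by_cases hj' : j ≤ L - w
        · rw [app_l hj']
          refine ⟨(h.nb' _ (by omega)).symm, fun hadj => ?_⟩
          rw [G.adj_comm, h.ab' _ (by omega)] at hadj; omega
        · obtain ⟨j, rfl⟩ : ∃ j', j = L - w + 1 + j' := ⟨j - (L - w + 1), by omega⟩
          rw [app_r]
          exact ⟨h.bb.ne.symm, fun hadj => ⟨by omega, by omega⟩⟩

end lemA
end Paper
namespace Paper

section lemA2
variable {V : Type} {G : SimpleGraph V}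

theorem last_idx {P : ℕ → Prop} {k : ℕ} (h : ∃ i ≤ k, P i) :
    ∃ i ≤ k, P i ∧ ∀ j, i < j → j ≤ k → ¬ P j := by
  obtain ⟨i, hi⟩ := ((Set.finite_Iic k).subset (t := {i | i ≤ k ∧ P i}) fun i hi => hi.1).exists_maximal
    (h.imp fun _ h => h)
  exact ⟨i, hi.1.1, hi.1.2, fun j h1 h2 h3 => absurd (hi.2 (y := j) ⟨h2, h3⟩ h1.le) (by omega)⟩

theorem first_idx {P : ℕ → Prop} {k : ℕ} (h : ∃ i ≤ k, P i) :
    ∃ i ≤ k, P i ∧ ∀ j < i, ¬ P j := by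
  classical
  obtain ⟨i, hik, hi⟩ := h
  exact ⟨Nat.find ⟨i, hi⟩, (Nat.find_le hi).trans hik, Nat.find_spec _, fun j => Nat.find_min _⟩

theorem lemma_A [Finite V] (hT : T2F G) (hNC : ∀ K, G.IsClique K → PConn G Kᶜ)
    (hnc : ∃ a b, a ≠ b ∧ ¬ G.Adj a b) (a₁ a₂ a₃ : V) (h12 : G.Adj a₁ a₂) (h23 : G.Adj a₂ a₃)
    (h13 : G.Adj a₁ a₃) : False := by
  classical
  have hcl : G.IsClique {a₁, a₂, a₃} := by
    intro x hx y hy hxy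
    simp only [mem_insert_iff, mem_singleton_iff] at hx hy
    grind [SimpleGraph.adj_comm]
  obtain ⟨K, hK1, hK2⟩ := (Set.toFinite {K | G.IsClique K}).exists_le_maximal hcl
  have hKc : G.IsClique K := hK2.1
  have hmax : ∀ m ∉ K, ∃ b ∈ K, ¬ G.Adj m b := by
    intro m hm
    by_contra hcon
    push Not at hcon
    have : G.IsClique (insert m K) := hKc.insert fun b hb _ => hcon b hb
    exact hm (hK2.2 this (subset_insert _ _) (mem_insert _ _))
  have hPC := hNC K hKc
  have hCne : ∃ c, c ∉ K := by
    obtain ⟨a, b, hab, hn⟩ := hnc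
    by_contra hcon
    push Not at hcon
    exact hn (hKc (hcon a) (hcon b) hab)
  have hnb : ∀ b ∈ K, ∃ c ∉ K, G.Adj b c := by
    intro b hb
    by_contra hcon
    push Not at hcon
    obtain ⟨c, hc⟩ := hCne
    have := hNC (K \ {b}) (hKc.subset sdiff_subset) {b} ⟨b, by simp, rfl⟩ (by
      rintro x hx rfl y hy hxy
      by_contra hne
      exact hcon y (fun hyK => hy ⟨hyK, hne⟩) hxy)
    have : c ∈ ({b} : Set V) := this (by simp [hc])
    exact hc (by rw [mem_singleton_iff.1 this]; exact hb)
  obtain ⟨m, hmK, hm⟩ := Set.exists_max_image (Kᶜ) (fun m => {b ∈ K | G.Adj m b}.ncard)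
    (Set.toFinite _) hCne
  obtain ⟨b0, hb0, hmb0⟩ := hmax m hmK
  obtain ⟨c0, hc0, hbc0⟩ := hnb b0 hb0
  obtain ⟨p, k, hp, hpC, hp0, hpk⟩ := exists_ip_sets (A := {m}) (B := {w | ∃ b ∈ K, ¬ G.Adj m b ∧ G.Adj w b})
    hPC ⟨m, rfl, hmK⟩ ⟨c0, ⟨b0, hb0, hmb0, hbc0.symm⟩, hc0⟩
  have hpm : p 0 = m := (hp0 0 (by omega)).2 rfl
  obtain ⟨b, hb, hmb, hpb⟩ := (hpk k le_rfl).2 rfl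
  obtain ⟨b', hb', hmb', hpb'⟩ : ∃ b' ∈ K, G.Adj m b' ∧ ¬ G.Adj (p k) b' := by
    by_contra hcon
    push Not at hcon
    have h1 := hm (p k) (hpC k le_rfl)
    have h2 : {b ∈ K | G.Adj m b}.ncard < {b ∈ K | G.Adj (p k) b}.ncard :=
      ncard_lt_ncard ⟨fun z hz => ⟨hz.1, hcon z hz.1 hz.2⟩, fun h => hmb (h ⟨hb, hpb⟩).2⟩ (toFinite _)
    omega
  obtain ⟨i0, hi0k, hi0, hlast⟩ := last_idx (P := fun i => G.Adj (p i) b') ⟨0, by omega, by rwa [hpm]⟩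
  have hlt : i0 < k := lt_of_le_of_ne hi0k fun e => hpb' (e ▸ hi0)
  have hbb : b ≠ b' := fun e => hmb (e ▸ hmb')
  obtain ⟨y, hy⟩ : ∃ y : ℕ → V, y = fun j => p (i0 + j) := ⟨_, rfl⟩
  obtain ⟨L, hL⟩ : ∃ L, L = k - i0 := ⟨_, rfl⟩
  have yIP : IP G y L := by rw [hy]; exact hp.sub (by omega)
  have yK : ∀ i ≤ L, y i ∉ K := fun i hi => by rw [hy]; exact hpC _ (by omega)
  have yb' : ∀ i ≤ L, G.Adj (y i) b' ↔ i = 0 := fun i hi => by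
    rw [hy]; refine ⟨fun h => ?_, fun h => by subst h; exact hi0⟩
    by_contra hne
    exact hlast _ (by omega) (by omega) h
  have yb : ∀ i ≤ L, G.Adj (y i) b ↔ i = L := fun i hi => by
    rw [hy]; refine ⟨fun h => ?_, fun h => ?_⟩
    · have := (hpk (i0 + i) (by omega)).1 ⟨b, hb, hmb, h⟩; omega
    · subst h; rw [hL]; simpa only [show i0 + (k - i0) = k by omega]
  obtain ⟨x, hxK, hxb, hxb'⟩ : ∃ x ∈ K, x ≠ b ∧ x ≠ b' := by
    by_contra hcon
    push Not at hcon
    have e1 := hcon a₁ (hK1 (by simp))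
    have e2 := hcon a₂ (hK1 (by simp))
    have e3 := hcon a₃ (hK1 (by simp))
    replace h12 := h12.ne; replace h23 := h23.ne; replace h13 := h13.ne
    clear * - e1 e2 e3 h12 h23 h13
    by_cases x1 : a₁ = b <;> by_cases x2 : a₂ = b <;> by_cases x3 : a₃ = b <;> simp_all
  have hne : ∀ i ≤ L, ∀ z ∈ K, y i ≠ z := fun i hi z hz e => yK i hi (e ▸ hz)
  have hH := holeSet_cone (x := b') (yIP.snoc (a := b) fun i hi => ⟨hne i hi b hb, yb i hi⟩) (by omega)
    (by
      refine (app_forall (m := 0) (P := fun z => b' ≠ z)).2 ⟨fun i hi => (hne i hi b' hb').symm, fun _ _ => hbb.symm⟩)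
    (by
      intro i hi
      by_cases h : i ≤ L
      · rw [app_l h, G.adj_comm, yb' i h]; omega
      · obtain rfl : i = L + 1 + 0 := by omega
        rw [app_r]; exact ⟨fun _ => by omega, fun _ => hKc hb' hb hbb.symm⟩)
  rw [show L + 1 = L + 1 + 0 from rfl, app_img] at hH
  have hxy : ∀ i ≤ L, ¬ G.Adj x (y i) := by
    intro i hi hadj
    have hxH : x ∉ insert b' (y '' Iic L ∪ (fun _ => b) '' Iic 0) := by
      rintro (h | ⟨j, hj, h⟩ | ⟨j, hj, h⟩)
      · exact hxb' h
      · exact hne j hj x hxK h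
      · exact hxb h.symm
    have e1 := hT.hole _ hH x hxH (y i) (.inr (.inl ⟨i, hi, rfl⟩)) b (.inr (.inr ⟨0, by simp⟩)) hadj
      (hKc hxK hb hxb) (hne i hi b hb)
    have e2 := hT.hole _ hH x hxH (y i) (.inr (.inl ⟨i, hi, rfl⟩)) b' (.inl rfl) hadj
      (hKc hxK hb' hxb') (hne i hi b' hb')
    rw [yb i hi] at e1; rw [yb' i hi] at e2; omega
  obtain ⟨cx, hcx, hxcx⟩ := hnb x hxK
  obtain ⟨f, n, hf, hfC, hf0, hfn⟩ := exists_ip_sets (A := {w | G.Adj x w})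
    (B := {w | ∃ j ≤ L, G.Adj w (y j)}) hPC ⟨cx, hxcx, hcx⟩
    ⟨y 1, ⟨0, by omega, (yIP.adj (by omega) (by omega)).2 (by omega)⟩, yK 1 (by omega)⟩
  have fy : ∀ i ≤ n, ∀ j ≤ L, f i ≠ y j := by
    intro i hi j hj e
    have hin : i = n := by
      rw [← hfn i hi, e]
      by_cases hj0 : j = 0
      · exact ⟨1, by omega, (yIP.adj (by omega) (by omega)).2 (by omega)⟩
      · exact ⟨j - 1, by omega, (yIP.adj (by omega) (by omega)).2 (by omega)⟩
    by_cases hn0 : n = 0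
    · exact hxy j hj (e ▸ (hf0 i hi).2 (by omega))
    · have := (hfn (n-1) (by omega)).1 ⟨j, hj, by
        rw [← e, hin]; exact (hf.adj (by omega) (by omega)).2 (by omega)⟩
      omega
  have fK : ∀ i ≤ n, ∀ z ∈ K, f i ≠ z := fun i hi z hz e => hfC i hi (e ▸ hz)
  refine LA.false (y := y) (L := L) (g := app (fun _ => x) 0 f) (N := 0 + 1 + n) (b := b) (b' := b') hT
    ⟨yIP, by omega, hKc hb hb' hbb, yb', yb, fun i hi => hne i hi b' hb', fun i hi => hne i hi b hb,
    (IP.const x).app hf fun i j hi hj => ⟨(fK j hj x hxK).symm, ?_⟩, ?_, ?_, ?_, ?_, ?_, ?_, ?_⟩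
  · have := hf0 j hj
    rw [mem_ofPred_eq] at this
    rw [this]; omega
  · exact (app_forall (P := fun z => z ≠ b)).2 ⟨fun _ _ => hxb, fun i hi => fK i hi b hb⟩
  · exact (app_forall (P := fun z => z ≠ b')).2 ⟨fun _ _ => hxb', fun i hi => fK i hi b' hb'⟩
  · exact (app_forall (P := fun z => ∀ j ≤ L, z ≠ y j)).2 ⟨fun _ _ j hj => (hne j hj x hxK).symm, fy⟩
  · exact hKc hxK hb hxb
  · exact hKc hxK hb' hxb'
  · intro i hi j hj
    by_cases h : i = 0
    · subst h; exact hxy j hj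
    · obtain ⟨i, rfl⟩ : ∃ i', i = 0 + 1 + i' := ⟨i - 1, by omega⟩
      rw [app_r]
      intro h'
      have := (hfn i (by omega)).1 ⟨j, hj, h'⟩
      omega
  · rw [app_r]
    exact (hfn n le_rfl).2 rfl

end lemA2
end Paper
namespace Paper

section star
variable {V : Type} {G : SimpleGraph V}

structure TF (G : SimpleGraph V) : Prop where
  tri : ∀ a b c, G.Adj a b → G.Adj b c → G.Adj a c → False
  hole : ∀ H, HoleSet G H → ∀ x ∉ H, ∀ y ∈ H, ∀ z ∈ H, G.Adj x y → G.Adj x z → y = z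

theorem T2F.tf [Finite V] (hT : T2F G) (hNC : ∀ K, G.IsClique K → PConn G Kᶜ)
    (hnc : ∃ a b, a ≠ b ∧ ¬ G.Adj a b) : TF G where
  tri := lemma_A hT hNC hnc
  hole H hH x hx y hy z hz hxy hxz := by
    by_contra hne
    exact lemma_A hT hNC hnc x y z hxy (hT.hole H hH x hx y hy z hz hxy hxz hne) hxz

def NCJ (G : SimpleGraph V) (J : Set V) : Prop := ∀ K, G.IsClique K → PConn G (J \ K)

theorem IP.reach {f : ℕ → V} {n : ℕ} (h : IP G f n) {S : Set V} (hS : ∀ i ≤ n, f i ∈ S) {i j : ℕ}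
    (hi : i ≤ n) (hj : j ≤ n) : Reach G S (f i) (f j) :=
  h.conn.sub_comp (by rintro _ ⟨i, hi, rfl⟩; exact hS i hi) ⟨i, hi, rfl⟩ ⟨j, hj, rfl⟩

theorem isClique_pair' {a b : V} (h : G.Adj a b) : G.IsClique {a, b} :=
  isClique_pair.2 fun _ => h

theorem star_lemma (hT : TF G) {J : Set V} (hJ : NCJ G J) (v : V) (C : Finset V)
    (hC : ∀ c ∈ C, G.Adj v c) : PConn G {x | x ∈ J ∧ x ≠ v ∧ x ∉ C} := by
  classical
  induction C using Finset.induction_on with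
  | empty =>
    have := hJ {v} (by simp)
    convert this using 1; ext x; simp
  | insert t C ht ih =>
    have ih := ih fun c hc => hC c (Finset.mem_insert_of_mem hc)
    have hvt := hC t (Finset.mem_insert_self _ _)
    set S0 := {x | x ∈ J ∧ x ≠ v ∧ x ∉ C} with hS0
    set S := {x | x ∈ J ∧ x ≠ v ∧ x ∉ insert t C} with hS
    have hSS : S ⊆ S0 := fun x hx => ⟨hx.1, hx.2.1, fun h => hx.2.2 (Finset.mem_insert_of_mem h)⟩
    have hS1 : ∀ x ∈ S0, x ≠ t → x ∈ S := fun x hx hxt => ⟨hx.1, hx.2.1, by simp [hxt, hx.2.2]⟩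
    refine pconn_of_reach fun a ha b hb => ?_
    by_contra hab
    have key : ∀ a ∈ S, ∀ b ∈ S, ¬ Reach G S a b → ∃ a' ∈ comp G S a, G.Adj t a' := by
      intro a ha b hb hab
      by_contra hcon
      push Not at hcon
      refine hab (ih (comp G S a) ⟨a, hSS ha, mem_comp_self⟩ (fun x hx hxa y hy hxy => ?_) (hSS hb))
      refine comp_step hxa (hS1 y hy fun e => ?_) hxy
      exact hcon x hxa (e ▸ hxy.symm)
    obtain ⟨a', ha', hta⟩ := key a ha b hb hab
    obtain ⟨b', hb', htb⟩ := key b hb a ha fun h => hab (h.symm hb)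
    have haS := comp_sub ha ha'
    have hbS := comp_sub hb hb'
    have hab' : ¬ Reach G S a' b' := fun h =>
      hab (Relation.ReflTransGen.trans (Relation.ReflTransGen.trans ha' h) (Reach.symm hb hb'))
    have hR : S ⊆ J \ {v, t} := fun x hx => ⟨hx.1, by
      rintro (h | h)
      · exact hx.2.1 h
      · exact hx.2.2 (by rw [h]; exact Finset.mem_insert_self _ _)⟩
    obtain ⟨f, n, hf, hfR, ⟨ht0, htn, h0S, hnS, hP⟩, hmin⟩ := exists_ip (G := G) (S := J \ {v, t})
      (fun x y => G.Adj t x ∧ G.Adj t y ∧ x ∈ S ∧ y ∈ S ∧ ¬ Reach G S x y)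
      ⟨a', hR haS, b', (hJ _ (isClique_pair' hvt)).reach (hR haS) (hR hbS), hta, htb, haS, hbS, hab'⟩
    have hSC : ∀ i ≤ n, f i ∈ S ∨ f i ∈ C := by
      intro i hi
      by_contra hcon
      push Not at hcon
      have h1 := hfR i hi
      exact hcon.1 (hS1 _ ⟨h1.1, fun h => h1.2 (by simp [h]), hcon.2⟩ fun h => h1.2 (by simp [h]))
    have hint : ∀ i ≤ n, G.Adj t (f i) ↔ (i = 0 ∨ i = n) := by
      refine fun i hi => ⟨fun h => ?_, by rintro (rfl | rfl) <;> assumption⟩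
      have hiS : f i ∈ S := (hSC i hi).resolve_right fun h' =>
        hT.tri v t (f i) hvt h (hC _ (Finset.mem_insert_of_mem h'))
      by_cases h1 : Reach G S (f 0) (f i)
      · have := hmin i n hi le_rfl ⟨h, htn, hiS, hnS, fun h2 => hP (Relation.ReflTransGen.trans h1 h2)⟩
        omega
      · have := hmin 0 i (by omega) hi ⟨ht0, h, h0S, hiS, h1⟩
        omega
    have hn2 : 2 ≤ n := by
      by_contra hn
      obtain rfl | rfl : n = 0 ∨ n = 1 := by omega
      · exact hP .refl
      · exact hP (.single ⟨(hf.adj (by omega) (by omega)).2 (by omega), hnS⟩)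
    have htf : ∀ i ≤ n, t ≠ f i := fun i hi e => (hfR i hi).2 (by simp [← e])
    have hH := holeSet_cone hf hn2 htf hint
    obtain ⟨i, hi, hiC⟩ : ∃ i ≤ n, f i ∈ C := by
      by_contra hcon
      push Not at hcon
      exact hP (hf.reach (fun i hi => (hSC i hi).resolve_right (hcon i hi)) (by omega) le_rfl)
    refine htf i hi (hT.hole _ hH v ?_ t (.inl rfl) (f i) (.inr ⟨i, hi, rfl⟩) hvt
      (hC _ (Finset.mem_insert_of_mem hiC)))
    rintro (h | ⟨i, hi, h⟩)
    · exact hvt.ne h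
    · exact (hfR i hi).2 (by simp [h])

theorem star_set [Finite V] (hT : TF G) {J : Set V} (hJ : NCJ G J) (v : V) (A : Set V) :
    PConn G {x | x ∈ J ∧ x ≠ v ∧ (G.Adj v x → x ∈ A)} := by
  classical
  have := Fintype.ofFinite V
  convert star_lemma hT hJ v {x | G.Adj v x ∧ x ∉ A} (by simp +contextual) using 1
  ext x; simp

structure Ear (G : SimpleGraph V) (x : V) (f : ℕ → V) (m : ℕ) (r : ℕ → V) (k j : ℕ) : Prop where
  hf : IP G f m
  xf : ∀ i ≤ m, x ≠ f i
  af : ∀ i ≤ m, G.Adj x (f i) ↔ (i = 0 ∨ i = m)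
  hr : IP G r k
  xr : ∀ i ≤ k, x ≠ r i
  ar : ∀ i ≤ k, G.Adj x (r i) ↔ i = 0
  rf : ∀ i ≤ k, ∀ i' ≤ m, r i ≠ f i'
  ad : ∀ i ≤ k, ∀ i', 0 < i' → i' < m → (G.Adj (r i) (f i') ↔ (i = k ∧ i' = j))
  j0 : 0 < j
  jm : j < m

variable {x : V} {f r : ℕ → V} {m k j : ℕ}

theorem Ear.rev (h : Ear G x f m r k j) : Ear G x (fun i => f (m - i)) m r k (m - j) := by
  obtain ⟨h1, h2, h3, h4, h5, h6, h7, h8, h9, h10⟩ := h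
  refine ⟨h1.rev, fun i _ => h2 _ (by omega), fun i hi => by rw [h3 _ (by omega)]; omega, h4, h5, h6,
    fun i hi i' _ => h7 i hi _ (by omega), fun i hi i' h h' => ?_, by omega, by omega⟩
  rw [h8 i hi _ (by omega) (by omega)]; omega

theorem Ear.arc (h : Ear G x f m r k j) (h0 : ∀ i ≤ k, ¬ G.Adj (r i) (f 0)) :
    HoleSet G (insert x (r '' Iic k ∪ f '' Iic j)) := by
  have hj := h.jm
  have hj0 := h.j0
  have e : (fun i => f (j - i)) '' Iic j = f '' Iic j := img_rev f j
  rw [← e, ← app_img]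
  have hs : IP G (fun i => f (j - i)) j := by
    have := (h.hf.sub (i := 0) (m := j) (by omega)).rev
    simpa using this
  refine holeSet_cone (h.hr.app hs fun i i' hi hi' => ⟨h.rf i hi _ (by omega), ?_⟩) (by omega)
    ((app_forall (P := fun z => x ≠ z)).2 ⟨h.xr, fun i hi => h.xf _ (by omega)⟩) fun i hi => ?_
  · by_cases hij : i' = j
    · subst hij; simp only [Nat.sub_self]
      exact ⟨fun h' => absurd h' (h0 i hi), fun h' => by omega⟩
    · rw [h.ad i hi _ (by omega) (by omega)]; omega
  · by_cases hik : i ≤ k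
    · rw [app_l hik, h.ar i hik]; omega
    · obtain ⟨i, rfl⟩ : ∃ i', i = k + 1 + i' := ⟨i - (k+1), by omega⟩
      rw [app_r, h.af _ (by omega)]; omega

theorem Ear.no (hT : TF G) (h : Ear G x f m r k j) {i : ℕ} (hi : i ≤ k) (h0 : G.Adj (r i) (f 0))
    (hm : ∀ i' < i, ¬ G.Adj (r i') (f m)) : False := by
  have hj := h.jm
  have hj0 := h.j0
  by_cases hex : ∃ i' ≤ k, G.Adj (r i') (f m)
  · obtain ⟨i', hi', ha, hb⟩ := first_idx hex
    have hii : i ≤ i' := by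
      by_contra hc
      exact hm i' (by omega) ha
    have hip : IP G r i' := fun a b hab hb => h.hr a b hab (by omega)
    have hne : i' ≠ 0 := by
      rintro rfl
      obtain rfl : i = 0 := by omega
      exact hT.tri x (r 0) (f 0) ((h.ar 0 (by omega)).2 rfl) h0 ((h.af 0 (by omega)).2 (by omega))
    have hH := holeSet_cone (x := x) (hip.snoc (a := f m) fun s hs => ⟨h.rf s (by omega) m le_rfl,
        fun h' => by by_contra hne; exact hb s (by omega) h', by rintro rfl; exact ha⟩) (by omega)
      ((app_forall (m := 0) (P := fun z => x ≠ z)).2 ⟨fun s hs => h.xr s (by omega),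
        fun _ _ => h.xf m le_rfl⟩) (fun s hs => by
        by_cases hs' : s ≤ i'
        · rw [app_l hs', h.ar s (by omega)]; omega
        · obtain rfl : s = i' + 1 + 0 := by omega
          rw [app_r, h.af m le_rfl]; omega)
    rw [show i' + 1 = i' + 1 + 0 from rfl, app_img] at hH
    refine h.xr i hi (hT.hole _ hH (f 0) ?_ x (.inl rfl) (r i) (.inr (.inl ⟨i, hii, rfl⟩))
      ((h.af 0 (by omega)).2 (by omega)).symm h0.symm)
    rintro (h' | ⟨s, hs, h'⟩ | ⟨s, hs, h'⟩)
    · exact h.xf 0 (by omega) h'.symm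
    · simp only [mem_Iic] at hs
      exact h.rf s (by omega) 0 (by omega) h'
    · have := h.hf.inj le_rfl (by omega) h'; omega
  · push Not at hex
    have hH := h.rev.arc (by simpa using hex)
    refine h.xr i hi (hT.hole _ hH (f 0) ?_ x (.inl rfl) (r i) (.inr (.inl ⟨i, hi, rfl⟩))
      ((h.af 0 (by omega)).2 (by omega)).symm h0.symm)
    rintro (h' | ⟨s, hs, h'⟩ | ⟨s, hs, h'⟩)
    · exact h.xf 0 (by omega) h'.symm
    · exact h.rf s hs 0 (by omega) h'
    · simp only [mem_Iic] at hs
      have := h.hf.inj (by omega) (by omega) h'; omega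

theorem Ear.hole (hT : TF G) (h : Ear G x f m r k j) {a : V} (ha : a ∈ insert x (f '' Iic m)) :
    ∃ H, HoleSet G H ∧ a ∈ H ∧ r 0 ∈ H ∧ H ⊆ insert x (r '' Iic k ∪ f '' Iic m) := by
  have hj := h.jm
  have hj0 := h.j0
  have key : ∀ i ≤ k, ¬ (G.Adj (r i) (f 0) ∨ G.Adj (r i) (f m)) := by
    by_contra hcon
    push Not at hcon
    obtain ⟨i, hi, hcon, hb⟩ := first_idx hcon
    rcases hcon with h' | h'
    · exact h.no hT hi h' fun i' hi' h'' => hb i' hi' (.inr h'')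
    · exact h.rev.no hT hi (by simpa using h') fun i' hi' h'' => hb i' hi' (.inl (by simpa using h''))
  have h1 := h.arc fun i hi h' => key i hi (.inl h')
  have h2 := h.rev.arc fun i hi h' => key i hi (.inr (by simpa using h'))
  have sub1 : f '' Iic j ⊆ f '' Iic m := image_mono fun i hi => by simp only [mem_Iic] at *; omega
  have sub2 : (fun i => f (m - i)) '' Iic (m - j) ⊆ f '' Iic m := by
    rintro _ ⟨i, hi, rfl⟩; exact ⟨m - i, by simp, rfl⟩
  rcases ha with rfl | ⟨i, hi, rfl⟩
  · exact ⟨_, h1, .inl rfl, .inr (.inl ⟨0, by simp, rfl⟩),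
      insert_subset_insert (union_subset_union_right _ sub1)⟩
  · by_cases hij : i ≤ j
    · exact ⟨_, h1, .inr (.inr ⟨i, hij, rfl⟩), .inr (.inl ⟨0, by simp, rfl⟩),
        insert_subset_insert (union_subset_union_right _ sub1)⟩
    · simp only [mem_Iic] at hi
      exact ⟨_, h2, .inr (.inr ⟨m - i, by simp only [mem_Iic]; omega, by
        simp only [Nat.sub_sub_self hi]⟩), .inr (.inl ⟨0, by simp, rfl⟩),
        insert_subset_insert (union_subset_union_right _ sub2)⟩

theorem common_hole [Finite V] (hT : TF G) {J : Set V} (hJ : NCJ G J) {a u : V} (ha : a ∈ J)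
    (hu : u ∈ J) (hau : a ≠ u) (hadj : ¬ G.Adj a u) {y : V} (hy : y ∈ J) :
    ∃ H, HoleSet G H ∧ H ⊆ J ∧ a ∈ H ∧ y ∈ H := by
  have hJP : PConn G J := by simpa using hJ ∅ (by simp)
  refine hJP {y | ∃ H, HoleSet G H ∧ H ⊆ J ∧ a ∈ H ∧ y ∈ H} ⟨a, ha, ?_⟩ ?_ hy
  · obtain ⟨f, n, hf, hfJ, hf0, hfn⟩ := exists_ip_sets (A := {a}) (B := {u}) hJP ⟨a, rfl, ha⟩ ⟨u, rfl, hu⟩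
    have e0 : f 0 = a := (hf0 0 (by omega)).2 rfl
    have en : f n = u := (hfn n le_rfl).2 rfl
    have hn2 : 2 ≤ n := by
      by_contra hn
      obtain rfl | rfl : n = 0 ∨ n = 1 := by omega
      · exact hau (e0.symm.trans en)
      · exact hadj (by rw [← e0, ← en]; exact (hf.adj (by omega) (by omega)).2 (by omega))
    have a01 : G.Adj (f 0) (f 1) := (hf.adj (by omega) (by omega)).2 (by omega)
    have a12 : G.Adj (f 1) (f 2) := (hf.adj (by omega) (by omega)).2 (by omega)
    have h02 := hf 0 2 (by omega) hn2
    obtain ⟨g, l, hg, hgJ, hg0, hgl⟩ := exists_ip_sets (A := {f 0}) (B := {f 2})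
      (star_set hT hJ (f 1) {f 0, f 2}) ⟨f 0, rfl, hfJ 0 (by omega), a01.ne, by simp⟩
      ⟨f 2, rfl, hfJ 2 hn2, a12.ne', by simp⟩
    have e0' : g 0 = f 0 := (hg0 0 (by omega)).2 rfl
    have en' : g l = f 2 := (hgl l le_rfl).2 rfl
    refine ⟨_, holeSet_cone (x := f 1) hg ?_ (fun i hi => (hgJ i hi).2.1.symm) fun i hi => ⟨fun h => ?_, ?_⟩,
      ?_, .inr ⟨0, by simp, e0'.trans e0⟩, .inr ⟨0, by simp, e0'.trans e0⟩⟩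
    · by_contra hn
      obtain rfl | rfl : l = 0 ∨ l = 1 := by omega
      · exact h02.1 (e0'.symm.trans en')
      · have := (hg.adj (i := 0) (j := 1) (by omega) (by omega)).2 (by omega)
        rw [e0', en', h02.2] at this; omega
    · rcases (hgJ i hi).2.2 h with h | h
      · exact .inl ((hg0 i hi).1 h)
      · exact .inr ((hgl i hi).1 h)
    · rintro (rfl | rfl)
      · rw [e0']; exact a01.symm
      · rw [en']; exact a12
    · rintro _ (rfl | ⟨i, hi, rfl⟩)
      · exact hfJ 1 (by omega)
      · exact (hgJ i hi).1
  · rintro x hxJ ⟨H, hH, hHJ, haH, hxH⟩ y hyJ hxy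
    by_cases hyH : y ∈ H
    · exact ⟨H, hH, hHJ, haH, hyH⟩
    obtain ⟨f, m, hf, hm, hxf, hxa, rfl⟩ := hH.cone hxH
    have hfH : ∀ i ≤ m, f i ∈ insert x (f '' Iic m) := fun i hi => .inr ⟨i, hi, rfl⟩
    obtain ⟨r, k, hr, hrJ, hr0, hrk⟩ := exists_ip_sets (A := {y}) (B := {w | ∃ j, 0 < j ∧ j < m ∧ w = f j})
      (star_set hT hJ x {y}) ⟨y, rfl, hyJ, hxy.ne', by simp⟩
      ⟨f 1, ⟨1, by omega, by omega, rfl⟩, hHJ (hfH 1 (by omega)), (hxf 1 (by omega)).symm,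
        by rw [hxa 1 (by omega)]; omega⟩
    have e0 : r 0 = y := (hr0 0 (by omega)).2 rfl
    have hrx : ∀ i ≤ k, G.Adj x (r i) ↔ i = 0 := fun i hi =>
      ⟨fun h => (hr0 i hi).1 ((hrJ i hi).2.2 h), by rintro rfl; rwa [e0]⟩
    obtain ⟨j₁, hj1, hj1m, hrj⟩ := (hrk k le_rfl).2 rfl
    have hk : k ≠ 0 := by
      rintro rfl
      exact hyH (by rw [← e0, hrj]; exact hfH _ hj1m.le)
    have hrH : ∀ i < k, r i ∉ insert x (f '' Iic m) := by
      rintro i hi (h | ⟨i', hi', h⟩)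
      · exact (hrJ i hi.le).2.1 h
      · simp only [mem_Iic] at hi'
        by_cases h0 : i' = 0 ∨ i' = m
        · have := (hrx i hi.le).1 (by rw [← h]; exact (hxa _ hi').2 h0)
          subst this
          exact hyH (by rw [← e0, ← h]; exact hfH _ hi')
        · have := (hrk i hi.le).1 ⟨i', by omega, by omega, h.symm⟩
          omega
    obtain ⟨k', hk', ⟨j, hj0, hjm, hkj⟩, hfirst⟩ := first_idx (k := k - 1)
      (P := fun i => ∃ j, 0 < j ∧ j < m ∧ G.Adj (r i) (f j)) ⟨k - 1, le_rfl, j₁, hj1, hj1m, by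
        rw [← hrj]; exact (hr.adj (by omega) (by omega)).2 (by omega)⟩
    have hear : Ear G x f m r k' j := ⟨hf, hxf, hxa, fun a b h1 h2 => hr a b h1 (by omega),
      fun i hi => (hrJ i (by omega)).2.1.symm, fun i hi => hrx i (by omega),
      fun i hi i' hi' e => hrH i (by omega) (e ▸ hfH i' hi'), fun i hi i' h1 h2 => ⟨fun h => ?_, ?_⟩, hj0, hjm⟩
    · obtain ⟨H', h1, h2, h3, h4⟩ := hear.hole hT haH
      refine ⟨H', h1, fun z hz => ?_, h2, by rwa [← e0]⟩
      rcases h4 hz with rfl | ⟨i, hi, rfl⟩ | ⟨i, hi, rfl⟩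
      · exact hxJ
      · simp only [mem_Iic] at hi
        exact (hrJ i (by omega)).1
      · exact hHJ (hfH i hi)
    · have : i = k' := by
        by_contra hne
        exact hfirst i (by omega) ⟨i', h1, h2, h⟩
      subst this
      exact ⟨rfl, hf.inj (by omega) (by omega) (hT.hole _ hH _ (hrH i (by omega)) _ (hfH i' h2.le) _
        (hfH j hjm.le) h hkj)⟩
    · rintro ⟨rfl, rfl⟩; exact hkj

end star
end Paper
namespace Paper

section seagull
variable {V : Type} {G : SimpleGraph V}

theorem comp_sub_of_closed {S T : Set V} {a : V} (ha : a ∈ T)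
    (h : ∀ x ∈ T, ∀ y ∈ S, G.Adj x y → y ∈ T) : comp G S a ⊆ T := by
  intro b hb
  induction hb with
  | refl => exact ha
  | tail _ h1 ih => exact h _ ih _ h1.2 h1.1

theorem atom_hole [Finite V] (hT : TF G) {a u : V} (hau : a ≠ u) (hadj : ¬ G.Adj a u) (J₀ : Set V)
    (ha : a ∈ J₀) (hu : u ∈ J₀)
    (hP : ∀ K, G.IsClique K → a ∉ K → u ∉ K → u ∈ comp G (J₀ \ K) a) :
    ∃ H, HoleSet G H ∧ H ⊆ J₀ ∧ a ∈ H ∧ u ∈ H := by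
  obtain ⟨J, hJ0, ⟨haJ, huJ, hPJ⟩, hmin⟩ := (Set.toFinite {J : Set V | a ∈ J ∧ u ∈ J ∧
    ∀ K, G.IsClique K → a ∉ K → u ∉ K → u ∈ comp G (J \ K) a}).exists_le_minimal ⟨ha, hu, hP⟩
  have hNC : NCJ G J := by
    intro K' hK'
    refine pconn_of_reach fun x hx y hy => ?_
    by_contra hxy
    have hcl : ∀ x ∈ J \ K', ∀ d ∈ comp G (J \ K') x, ∀ w ∈ J, w ∉ comp G (J \ K') x → G.Adj d w → w ∈ K' := by
      intro x hx d hd w hw hwn hdw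
      by_contra hwK
      exact hwn (comp_step hd ⟨hw, hwK⟩ hdw)
    have key : ∀ x ∈ J \ K', a ∈ comp G (J \ K') x ∨ u ∈ comp G (J \ K') x := by
      intro x hx
      by_contra hcon
      push Not at hcon
      obtain ⟨D, hD⟩ : ∃ D, D = comp G (J \ K') x := ⟨_, rfl⟩
      have hcl := hcl x hx
      rw [← hD] at hcon hcl
      have hDJ : D ⊆ J \ K' := hD ▸ comp_sub hx
      refine (hmin (y := J \ D) ⟨⟨haJ, hcon.1⟩, ⟨huJ, hcon.2⟩, fun K hK haK huK => ?_⟩ sdiff_subset hx.1).2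
        (hD ▸ mem_comp_self)
      set T := comp G ((J \ D) \ K) a with hTd
      have hTJ : T ⊆ (J \ D) \ K := comp_sub ⟨⟨haJ, hcon.1⟩, haK⟩
      have h1 := comp_sub_of_closed (G := G) (S := J \ K) (T := T ∪ {d | d ∈ D ∧ ∃ t ∈ T, t ∈ K'})
        (.inl mem_comp_self) (by
          rintro d (hd | ⟨hd, t, ht, htK⟩) w hw hdw
          · by_cases hwD : w ∈ D
            · exact .inr ⟨hwD, d, hd, hcl w hwD d (hTJ hd).1.1 (hTJ hd).1.2 hdw.symm⟩
            · exact .inl (comp_step hd ⟨⟨hw.1, hwD⟩, hw.2⟩ hdw)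
          · by_cases hwD : w ∈ D
            · exact .inr ⟨hwD, t, ht, htK⟩
            · have hwK := hcl d hd w hw.1 hwD hdw
              left
              by_cases e : t = w
              · rwa [← e]
              · exact comp_step ht ⟨⟨hw.1, hwD⟩, hw.2⟩ (hK' htK hwK e))
      exact (h1 (hPJ K hK haK huK)).resolve_right fun h => hcon.2 h.1
    have hxy' : ∀ z, z ∈ comp G (J \ K') x → z ∉ comp G (J \ K') y := fun z h1 h2 =>
      (comp_anti hy hxy z h1 z h2).1 rfl
    have hs : ∀ x ∈ J \ K', ∀ y ∈ J \ K', a ∈ comp G (J \ K') x → u ∈ comp G (J \ K') y →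
        Reach G (J \ K') x y := by
      intro x hx y hy h1 h2
      have haK := (comp_sub hx h1).2
      have huK := (comp_sub hy h2).2
      exact (Relation.ReflTransGen.trans h1 (hPJ K' hK' haK huK)).trans (Reach.symm hy h2)
    rcases key x hx with h1 | h1 <;> rcases key y hy with h2 | h2
    · exact hxy' _ h1 h2
    · exact hxy (hs x hx y hy h1 h2)
    · exact hxy (Reach.symm hy (hs y hy x hx h2 h1))
    · exact hxy' _ h1 h2
  obtain ⟨H, h1, h2, h3, h4⟩ := common_hole hT hNC haJ huJ hau hadj huJ
  exact ⟨H, h1, h2.trans hJ0, h3, h4⟩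

theorem seagull_cut [Finite V] (hT : TF G) {a v u : V} (hau : a ≠ u) (hav : G.Adj a v) (hvu : G.Adj v u) :
    ∃ K, G.IsClique K ∧ v ∉ K ∧ a ∉ K ∧ u ∉ K ∧ u ∉ comp G (insert v K)ᶜ a := by
  by_contra hcon
  push Not at hcon
  obtain ⟨H, h1, h2, h3, h4⟩ := atom_hole hT hau (fun h => hT.tri a v u hav hvu h) {v}ᶜ hav.ne hvu.ne'
    (fun K hK ha hu => by
      have := hcon (K \ {v}) (hK.subset sdiff_subset) (by simp) (fun h => ha h.1) fun h => hu h.1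
      convert this using 2
      ext z; simp [Set.mem_insert_iff])
  exact hau (hT.hole H h1 v (fun h => h2 h rfl) a h3 u h4 hav.symm hvu)

def Heavy (G : SimpleGraph V) (x : V) : Prop := ∀ A B, ∃ z, G.Adj x z ∧ z ≠ A ∧ z ≠ B

variable {k : ℕ} {𝓑 : Set (Set V)}

theorem crit_D (hc : Crit G k 𝓑) {S D K : Set V} {v : V} (hS : Small 𝓑 S) (hv : v ∈ nbhdOfSet G S)
    (hN : nbhdOfSet G S ⊆ insert v K) (hK : G.IsClique K) (hDS : D ⊆ S) (hD : Conn G (insert v D))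
    (h : ∀ κ ∈ K, κ ∈ nbhdOfSet G S → ∃ d ∈ insert v D, G.Adj d κ) : S ⊆ D := by
  intro s hs
  by_contra hsD
  have e : ∀ κ, κ ≠ v → insert κ {d | d ∈ D ∧ v = κ} = {κ} := by
    intro κ hκ; ext z; simp [hκ.symm]
  have e' : insert v {d | d ∈ D ∧ v = v} = insert v D := by simp
  refine crit_R hc (fun _ => v) hS hDS ⟨s, hs, hsD⟩ (fun _ _ => hv) (fun κ hκ => ?_) fun κ hκ κ' hκ' hne => ?_
  · by_cases hκv : κ = v
    · subst hκv; rwa [e']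
    · rw [e κ hκv]; exact .single κ
  · by_cases hκv : κ = v
    · subst hκv
      obtain ⟨d, hd, hda⟩ := h κ' ((hN hκ').resolve_left hne.symm) hκ'
      exact ⟨d, by rwa [e'], κ', by simp, hda⟩
    · by_cases hκv' : κ' = v
      · subst hκv'
        obtain ⟨d, hd, hda⟩ := h κ ((hN hκ).resolve_left hne) hκ
        exact ⟨κ, by simp, d, by rwa [e'], hda.symm⟩
      · exact ⟨κ, by simp, κ', by simp, hK ((hN hκ).resolve_left hκv) ((hN hκ').resolve_left hκv') hne⟩

theorem H2 (hc : Crit G k 𝓑) {a u s₁ s₂ : V} (ha : Heavy G a) (hu : Heavy G u) {T : Set V} (haT : a ∈ T)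
    (huT : u ∉ T) (h1 : a ≠ s₁) (h2 : a ≠ s₂) (h3 : u ≠ s₁) (h4 : u ≠ s₂)
    (hcl : ∀ x ∈ T, ∀ y, y ≠ s₁ → y ≠ s₂ → G.Adj x y → y ∈ T) : False := by
  have hns : u ∉ comp G ({s₁, s₂} : Set V)ᶜ a := fun h => huT (comp_sub_of_closed (S := ({s₁, s₂} : Set V)ᶜ) haT (fun x hx y hy hxy =>
    hcl x hx y (fun e => hy (by simp [e])) (fun e => hy (by simp [e])) hxy) h)
  have ha' : a ∈ ({s₁, s₂} : Set V)ᶜ := by simp [h1, h2]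
  have hu' : u ∈ ({s₁, s₂} : Set V)ᶜ := by simp [h3, h4]
  have key : ∀ x ∈ ({s₁, s₂} : Set V)ᶜ, Heavy G x → ¬ Small 𝓑 (comp G ({s₁, s₂} : Set V)ᶜ x) := by
    intro x hx hxH hS
    set S := comp G ({s₁, s₂} : Set V)ᶜ x with hSd
    have hN : nbhdOfSet G S ⊆ {s₁, s₂} := nb_comp
    have hb : s₁ ∈ nbhdOfSet G S ∧ s₂ ∈ nbhdOfSet G S := by
      by_contra hcon
      refine crit_clique_small hc hS ⟨x, mem_comp_self⟩ fun p hp q hq hne => absurd ?_ hne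
      have e1 : p = s₁ ∨ p = s₂ := hN hp
      have e2 : q = s₁ ∨ q = s₂ := hN hq
      rcases e1 with e1 | e1 <;> rcases e2 with e2 | e2 <;> subst e1 e2 <;> tauto
    obtain ⟨⟨n1, d1, hd1, a1⟩, n2, d2, hd2, a2⟩ := hb
    have hSc : Conn G S := comp_conn hx
    obtain ⟨f, n, hf, hfS, hf0, hfn⟩ := exists_ip_sets (A := {w | G.Adj s₁ w}) (B := {w | G.Adj s₂ w})
      hSc.2 ⟨d1, a1, hd1⟩ ⟨d2, a2, hd2⟩
    have hSD := crit_D hc (D := f '' Iic n) (K := {s₂}) hS ⟨n1, d1, hd1, a1⟩ hN (by simp)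
      (by rintro _ ⟨i, hi, rfl⟩; exact hfS i hi)
      (hf.conn.insert (b := f 0) ⟨0, by simp, rfl⟩ ((hf0 0 (by omega)).2 rfl))
      (by rintro κ rfl _; exact ⟨f n, .inr ⟨n, by simp, rfl⟩, ((hfn n le_rfl).2 rfl : G.Adj _ _).symm⟩)
    obtain ⟨i, hi, hix⟩ := hSD (mem_comp_self : x ∈ S)
    simp only [mem_Iic] at hi
    subst hix
    obtain ⟨z, hz, hzA, hzB⟩ := hxH (if i = 0 then s₁ else f (i - 1)) (if i = n then s₂ else f (i + 1))
    by_cases hzS : z ∈ S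
    · obtain ⟨j, hj, rfl⟩ := hSD hzS
      simp only [mem_Iic] at hj
      rw [hf.adj hi hj] at hz
      rcases hz with rfl | rfl
      · rw [if_neg (by omega)] at hzB; exact hzB rfl
      · rw [if_neg (by omega)] at hzA; exact hzA rfl
    · rcases hN ⟨hzS, f i, mem_comp_self, hz.symm⟩ with rfl | rfl
      · have := (hf0 i hi).1 hz.symm
        rw [if_pos this] at hzA; exact hzA rfl
      · have := (hfn i hi).1 hz.symm
        rw [if_pos this] at hzB; exact hzB rfl
  rcases small_or hc.br (comp_anti hu' hns) with h | h
  · exact key a ha' ha h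
  · exact key u hu' hu h

structure Tri (G : SimpleGraph V) (𝓑 : Set (Set V)) (S : Set V) (v p q : V) (f : ℕ → V) (m : ℕ) : Prop where
  sm : Small 𝓑 S
  cn : Conn G S
  N : ∀ x, x ∈ nbhdOfSet G S ↔ (x = v ∨ x = p ∨ x = q)
  pq : G.Adj p q
  vp : v ≠ p
  vq : v ≠ q
  hf : IP G f m
  fS : ∀ i ≤ m, f i ∈ S
  pf : ∀ i ≤ m, G.Adj p (f i) ↔ i = 0
  qf : ∀ i ≤ m, G.Adj q (f i) ↔ i = m
  m1 : 1 ≤ m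

variable {S : Set V} {v p q a u : V} {f : ℕ → V} {m : ℕ}

theorem Tri.symm (h : Tri G 𝓑 S v p q f m) : Tri G 𝓑 S v q p (fun i => f (m - i)) m where
  sm := h.sm
  cn := h.cn
  N x := by rw [h.N]; tauto
  pq := h.pq.symm
  vp := h.vq
  vq := h.vp
  hf := h.hf.rev
  fS i _ := h.fS _ (by omega)
  pf i hi := by rw [h.qf _ (by omega)]; omega
  qf i hi := by rw [h.pf _ (by omega)]; omega
  m1 := h.m1

theorem Tri.nS (h : Tri G 𝓑 S v p q f m) : v ∉ S ∧ p ∉ S ∧ q ∉ S :=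
  ⟨((h.N v).2 (by simp)).1, ((h.N p).2 (by simp)).1, ((h.N q).2 (by simp)).1⟩

theorem Tri.out (h : Tri G 𝓑 S v p q f m) {x z : V} (hx : x ∈ S) (hxz : G.Adj x z) :
    z ∈ S ∨ z = v ∨ z = p ∨ z = q := by
  by_cases hz : z ∈ S
  · exact .inl hz
  · exact .inr ((h.N z).1 ⟨hz, x, hx, hxz.symm⟩)

theorem Tri.D (hc : Crit G k 𝓑) (h : Tri G 𝓑 S v p q f m) {D : Set V} (hDS : D ⊆ S) (hD : Conn G D)
    (hv : ∃ d ∈ D, G.Adj v d) (hp : ∃ d ∈ D, G.Adj d p) (hq : ∃ d ∈ D, G.Adj d q) : S ⊆ D := by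
  obtain ⟨d, hd, hvd⟩ := hv
  refine crit_D hc (K := {p, q}) h.sm ((h.N v).2 (by simp)) (fun x hx => (h.N x).1 hx)
    (isClique_pair' h.pq) hDS (hD.insert hd hvd) ?_
  rintro κ (rfl | rfl) _
  · obtain ⟨d, hd, h⟩ := hp; exact ⟨d, .inr hd, h⟩
  · obtain ⟨d, hd, h⟩ := hq; exact ⟨d, .inr hd, h⟩

theorem Tri.hole (h : Tri G 𝓑 S v p q f m) :
    HoleSet G (insert p (f '' Iic m ∪ (fun _ => q) '' Iic 0)) := by
  have hn := h.nS
  rw [← app_img]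
  refine holeSet_cone (h.hf.app (IP.const q) fun i j hi hj => ⟨fun e => hn.2.2 (e ▸ h.fS i hi), by
    rw [G.adj_comm, h.qf i hi]; omega⟩) (by have := h.m1; omega)
    ((app_forall (P := fun z => p ≠ z)).2 ⟨fun i hi e => hn.2.1 (e ▸ h.fS i hi), fun _ _ => h.pq.ne⟩) ?_
  intro i hi
  by_cases hm : i ≤ m
  · rw [app_l hm, h.pf i hm]; omega
  · obtain rfl : i = m + 1 + 0 := by omega
    rw [app_r]; exact ⟨fun _ => by omega, fun _ => h.pq⟩

theorem Tri.one (hT : TF G) (h : Tri G 𝓑 S v p q f m) {x : V} (hx : x ≠ p) (hx' : x ≠ q)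
    (hxf : ∀ i ≤ m, x ≠ f i) {i : ℕ} (hi : i ≤ m) (hxi : G.Adj x (f i)) :
    ¬ G.Adj x p ∧ ¬ G.Adj x q ∧ ∀ j ≤ m, G.Adj x (f j) → j = i := by
  have hn := h.nS
  have hxH : x ∉ insert p (f '' Iic m ∪ (fun _ => q) '' Iic 0) := by
    rintro (e | ⟨j, hj, e⟩ | ⟨j, hj, e⟩)
    exacts [hx e, hxf j hj e.symm, hx' e.symm]
  have := hT.hole _ h.hole x hxH (f i) (.inr (.inl ⟨i, hi, rfl⟩))
  refine ⟨fun e => ?_, fun e => ?_, fun j hj e => ?_⟩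
  · exact hn.2.1 (this p (.inl rfl) hxi e ▸ h.fS i hi)
  · exact hn.2.2 (this q (.inr (.inr ⟨0, by simp, rfl⟩)) hxi e ▸ h.fS i hi)
  · exact (h.hf.inj hi hj (this (f j) (.inr (.inl ⟨j, hj, rfl⟩)) hxi e)).symm

theorem Tri.caseB (hc : Crit G k 𝓑) (hT : TF G) (h : Tri G 𝓑 S v p q f m) (ha : Heavy G a) (hu : Heavy G u)
    (haS : a ∈ S) (huS : u ∉ S) (huv : u ≠ v) (hup : u ≠ p) (huq : u ≠ q) (hav : G.Adj a v)
    (hvf : ∀ i ≤ m, ¬ G.Adj v (f i)) {z : ℕ → V} {l s : ℕ} (hz : IP G z l) (z0 : z 0 = a)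
    (zS : ∀ i ≤ l, z i ∈ S) (zf : ∀ i ≤ l, ∀ j ≤ m, z i ≠ f j) (hs : s ≤ m)
    (zfa : ∀ i ≤ l, ∀ j ≤ m, G.Adj (z i) (f j) ↔ (i = l ∧ j = s)) (hap : G.Adj a p) : False := by
  have hn := h.nS
  have hm := h.m1
  have hs0 : s = 0 := by
    have hcn : Conn G (z '' Iic l ∪ (fun i => f (s + i)) '' Iic (m - s)) :=
      hz.conn.union (h.hf.sub (i := s) (m := m - s) (by omega)).conn ⟨z l, ⟨l, by simp, rfl⟩, f s,
        ⟨0, by simp, rfl⟩, .inr ((zfa l le_rfl s hs).2 ⟨rfl, rfl⟩)⟩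
    have := h.D hc (by
      rintro _ (⟨i, hi, rfl⟩ | ⟨i, hi, rfl⟩)
      · exact zS i hi
      · simp only [mem_Iic] at hi; exact h.fS _ (by omega)) hcn
      ⟨a, .inl ⟨0, by simp, z0⟩, hav.symm⟩ ⟨a, .inl ⟨0, by simp, z0⟩, hap⟩
      ⟨f m, .inr ⟨m - s, by simp, by simp only [show s + (m - s) = m by omega]⟩, ((h.qf m le_rfl).2 rfl).symm⟩
    rcases this (h.fS 0 (by omega)) with ⟨i, hi, e⟩ | ⟨i, hi, e⟩
    · exact absurd e (zf i hi 0 (by omega))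
    · simp only [mem_Iic] at hi
      have := h.hf.inj (by omega) (by omega) e; omega
  subst hs0
  have hqz : ∀ i ≤ l, ¬ G.Adj q (z i) := by
    intro i hi hq
    have hip : IP G z i := fun a b h1 h2 => hz a b h1 (by omega)
    obtain ⟨j, hj, e⟩ := h.D hc (by rintro _ ⟨j, hj, rfl⟩; simp only [mem_Iic] at hj; exact zS j (by omega)) hip.conn
      ⟨a, ⟨0, by simp, z0⟩, hav.symm⟩ ⟨a, ⟨0, by simp, z0⟩, hap⟩ ⟨z i, ⟨i, by simp, rfl⟩, hq.symm⟩ (h.fS 0 (by omega))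
    simp only [mem_Iic] at hj
    exact zf j (by omega) 0 (by omega) e
  have hvR : v ∈ (insert p S)ᶜ := by simp [h.vp, hn.1]
  have hqR : q ∈ (insert p S)ᶜ := by simp [h.pq.ne', hn.2.2]
  have hvq : q ∈ comp G (insert p S)ᶜ v := by
    by_contra hcon
    set Q := comp G (insert p S)ᶜ q with hQ
    have hvQ : v ∉ Q := fun h' => hcon (Reach.symm hqR h')
    have hQs : Q ⊆ (insert p S)ᶜ := comp_sub hqR
    have hQ1 : ∀ w ∈ Q, w = q := by
      intro w hw
      by_contra hwq
      have := crit_no_clique_cutset hc (isClique_pair' h.pq) Q ⟨w, by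
        have := hQs hw; simp only [mem_compl_iff, Set.mem_insert_iff, not_or, mem_singleton_iff] at *
        exact ⟨this.1, hwq⟩, hw⟩ (fun x hx hxQ y hy hxy => ?_) (a := a) (by
          rintro (e | e)
          · exact hap.ne e
          · exact hn.2.2 (e ▸ haS))
      · exact hQs this (.inr haS)
      · simp only [mem_compl_iff, Set.mem_insert_iff, not_or, mem_singleton_iff] at hx hy
        refine comp_step hxQ ?_ hxy
        rintro (e | e)
        · exact hy.1 e
        · rcases h.out e hxy.symm with h1 | h1 | h1 | h1
          · exact hQs hxQ (.inr h1)
          · exact hvQ (h1 ▸ hxQ)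
          · exact hx.1 h1
          · exact hx.2 h1
    refine H2 hc ha hu (s₁ := v) (s₂ := p) (T := insert q S) (.inr haS) ?_ hav.ne hap.ne huv hup ?_
    · rintro (e | e)
      exacts [huq e, huS e]
    · rintro x (rfl | hx) y hyv hyp hxy
      · by_cases hyS : y ∈ S
        · exact .inr hyS
        · exact .inl (hQ1 y (comp_step mem_comp_self (by simp [hyp, hyS]) hxy))
      · rcases h.out hx hxy with h1 | h1 | h1 | h1
        exacts [.inr h1, absurd h1 hyv, absurd h1 hyp, .inl h1]
  obtain ⟨g, e, hg, hgR, hg0, hge⟩ := exists_ip_sets (A := {v}) (B := {q}) (comp_conn (G := G) hvR).2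
    ⟨v, rfl, mem_comp_self⟩ ⟨q, rfl, hvq⟩
  have g0 : g 0 = v := (hg0 0 (by omega)).2 rfl
  have ge : g e = q := (hge e le_rfl).2 rfl
  have he : e ≠ 0 := by rintro rfl; exact h.vq (g0.symm.trans ge)
  have hgS : ∀ i ≤ e, g i ≠ p ∧ g i ∉ S := fun i hi => by
    have := comp_sub hvR (hgR i hi)
    simp only [mem_compl_iff, Set.mem_insert_iff, not_or] at this; exact this
  obtain ⟨j, hj, hvj, hlast⟩ := last_idx (k := l) (P := fun i => G.Adj v (z i)) ⟨0, by omega, by rw [z0]; exact hav.symm⟩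
  have gS : ∀ i, 0 < i → i ≤ e → ∀ x ∈ S, G.Adj x (g i) → i = e ∧ G.Adj q x := by
    intro i hi0 hi x hx hxa
    rcases h.out hx hxa with h1 | h1 | h1 | h1
    · exact absurd h1 (hgS i hi).2
    · have := (hg0 i hi).1 h1; omega
    · exact absurd h1 (hgS i hi).1
    · exact ⟨(hge i hi).1 h1, h1 ▸ hxa.symm⟩
  have ip1 : IP G (app (fun i => z (j + i)) (l - j) f) (l - j + 1 + m) :=
    (hz.sub (i := j) (m := l - j) (by omega)).app h.hf fun i i' hi hi' => ⟨zf _ (by omega) _ hi', by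
      rw [zfa _ (by omega) _ hi']; omega⟩
  have ip2 : IP G (fun i => g (e - i)) (e - 1) := fun a b h1 h2 => hg.rev a b h1 (by omega)
  have ip1S : ∀ i ≤ l - j + 1 + m, app (fun i => z (j + i)) (l - j) f i ∈ S :=
    (app_forall (P := fun x => x ∈ S)).2 ⟨fun i hi => zS _ (by omega), h.fS⟩
  have ip3 := ip1.app ip2 fun i i' hi hi' => ⟨fun e' => (hgS (e - i') (by omega)).2 (e' ▸ ip1S i hi), by
    constructor
    · intro hadj
      obtain ⟨h1, h2⟩ := gS _ (by omega) (by omega) _ (ip1S i hi) hadj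
      by_cases hil : i ≤ l - j
      · rw [app_l hil] at h2; exact absurd h2 (hqz _ (by omega))
      · obtain ⟨i, rfl⟩ : ∃ i', i = l - j + 1 + i' := ⟨i - (l - j + 1), by omega⟩
        rw [app_r, h.qf _ (by omega)] at h2; omega
    · rintro ⟨rfl, rfl⟩
      rw [app_r, Nat.sub_zero, ge]
      exact ((h.qf m le_rfl).2 rfl).symm⟩
  have hH := holeSet_cone (x := v) ip3 (by omega)
    ((app_forall (P := fun x => v ≠ x)).2 ⟨fun i hi e' => hn.1 (e' ▸ ip1S i hi), fun i hi e' => by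
      have := (hg0 (e - i) (by omega)).1 e'.symm; omega⟩) (fun i hi => by
      by_cases h1 : i ≤ l - j + 1 + m
      · rw [app_l h1]
        by_cases h2 : i ≤ l - j
        · rw [app_l h2]
          refine ⟨fun h3 => ?_, fun h3 => ?_⟩
          · by_contra hne
            exact hlast _ (by omega) (by omega) h3
          · obtain rfl : i = 0 := by omega
            exact hvj
        · obtain ⟨i, rfl⟩ : ∃ i', i = l - j + 1 + i' := ⟨i - (l - j + 1), by omega⟩
          rw [app_r]
          exact ⟨fun h3 => absurd h3 (hvf i (by omega)), fun _ => by omega⟩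
      · obtain ⟨i, rfl⟩ : ∃ i', i = l - j + 1 + m + 1 + i' := ⟨i - (l - j + 1 + m + 1), by omega⟩
        rw [app_r, ← g0, hg.adj (by omega) (by omega)]; omega)
  rw [app_img, app_img] at hH
  refine (fun e' : f 0 = q => hn.2.2 (e' ▸ h.fS 0 (by omega))) (hT.hole _ hH p ?_ (f 0)
    (.inr (.inl (.inr ⟨0, by simp, rfl⟩))) q (.inr (.inr ⟨0, by simp, ge⟩)) ((h.pf 0 (by omega)).2 rfl) h.pq)
  rintro (e' | (⟨i, hi, e'⟩ | ⟨i, hi, e'⟩) | ⟨i, hi, e'⟩)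
  · exact h.vp e'.symm
  · simp only [mem_Iic] at hi; exact hn.2.1 (e' ▸ zS _ (by omega))
  · exact hn.2.1 (e' ▸ h.fS _ hi)
  · exact (hgS _ (by omega)).1 e'

end seagull
end Paper
namespace Paper

section spider
variable {V : Type} {G : SimpleGraph V} {k : ℕ} {𝓑 : Set (Set V)}

structure Sp (G : SimpleGraph V) (x v p q u : V) (f : ℕ → V) (m ix : ℕ) : Prop where
  hf : IP G f m
  m1 : 1 ≤ m
  pq : G.Adj p q
  pf : ∀ i ≤ m, G.Adj p (f i) ↔ i = 0
  qf : ∀ i ≤ m, G.Adj q (f i) ↔ i = m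
  vf : ∀ i ≤ m, G.Adj v (f i) ↔ i = ix
  xm : ix ≤ m
  xe : f ix = x
  nb : ∀ i ≤ m, ∀ z, G.Adj (f i) z → z = v ∨ z = p ∨ z = q ∨ ∃ j ≤ m, z = f j
  Y : ∀ i ≤ m, v ≠ f i ∧ p ≠ f i ∧ q ≠ f i ∧ u ≠ f i
  vp : v ≠ p
  vq : v ≠ q
  up : u ≠ p
  uq : u ≠ q
  uv : u ≠ v
  hp : Heavy G p
  hq : Heavy G q
  hu : Heavy G u
  hx : Heavy G x

theorem Sp.symm {x v p q u : V} {f : ℕ → V} {m ix : ℕ} (h : Sp G x v p q u f m ix) :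
    Sp G x v q p u (fun i => f (m - i)) m (m - ix) where
  hf := h.hf.rev
  m1 := h.m1
  pq := h.pq.symm
  pf i hi := by rw [h.qf _ (by omega)]; omega
  qf i hi := by rw [h.pf _ (by omega)]; omega
  vf i hi := by have := h.xm; rw [h.vf _ (by omega)]; omega
  xm := by omega
  xe := by simp only [Nat.sub_sub_self h.xm, h.xe]
  nb i hi z hz := by
    rcases h.nb _ (by omega) z hz with h1 | h1 | h1 | ⟨j, hj, h1⟩
    exacts [.inl h1, .inr (.inr (.inl h1)), .inr (.inl h1),
      .inr (.inr (.inr ⟨m - j, by omega, by simp only [Nat.sub_sub_self hj, h1]⟩))]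
  Y i hi := by have := h.Y (m - i) (by omega); tauto
  vp := h.vq
  vq := h.vp
  up := h.uq
  uq := h.up
  uv := h.uv
  hp := h.hq
  hq := h.hp
  hu := h.hu
  hx := h.hx

def Spider (G : SimpleGraph V) (x v : V) : Prop := ∃ p q u f m ix, Sp G x v p q u f m ix

theorem Tri.heavy (hc : Crit G k 𝓑) {S : Set V} {v p q a u : V} {f : ℕ → V} {m : ℕ}
    (h : Tri G 𝓑 S v p q f m) (ha : Heavy G a) (hu : Heavy G u)
    (haS : a ∈ S) (huS : u ∉ S) (huv : u ≠ v) (hup : u ≠ p) (huq : u ≠ q) : Heavy G p := by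
  have hn := h.nS
  have hm := h.m1
  have ne : ∀ {x y}, x ∈ S → y ∉ S → x ≠ y := fun h1 h2 e => h2 (e ▸ h1)
  by_contra hcon
  simp only [Heavy] at hcon
  push Not at hcon
  obtain ⟨A, B, hAB⟩ := hcon
  have hAB' : ∀ z, G.Adj p z → z = A ∨ z = B := fun z hz => by
    by_cases e : z = A
    exacts [.inl e, .inr (hAB z hz e)]
  have e1 := hAB' q h.pq
  have e2 := hAB' (f 0) ((h.pf 0 (by omega)).2 rfl)
  have e3 := ne (h.fS 0 (by omega)) hn.2.2
  refine H2 hc ha hu (s₁ := v) (s₂ := q) (T := insert p S) (.inr haS) ?_ (ne haS hn.1) (ne haS hn.2.2) huv huq ?_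
  · rintro (e | e)
    exacts [hup e, huS e]
  · rintro x (rfl | hx) y hyv hyq hxy
    · have : y = f 0 := by grind
      rw [this]; exact .inr (h.fS 0 (by omega))
    · rcases h.out hx hxy with h1 | h1 | h1 | h1
      exacts [.inr h1, absurd h1 hyv, .inl h1, absurd h1 hyq]

theorem spider_of_small (hc : Crit G k 𝓑) (hT : TF G) {a v u : V} (ha : Heavy G a) (hu : Heavy G u)
    (hav : G.Adj a v) {K : Set V} (hK : G.IsClique K) (hvK : v ∉ K) (haK : a ∉ K) (huK : u ∉ K) (huv : u ≠ v)
    (hS : Small 𝓑 (comp G (insert v K)ᶜ a)) (huS : u ∉ comp G (insert v K)ᶜ a) : Spider G a v := by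
  have haR : a ∈ (insert v K)ᶜ := by
    rintro (e | e)
    exacts [hav.ne e, haK e]
  obtain ⟨S, hSd⟩ : ∃ S, S = comp G (insert v K)ᶜ a := ⟨_, rfl⟩
  have hSc : Conn G S := hSd ▸ comp_conn haR
  have haS : a ∈ S := hSd ▸ mem_comp_self
  have hN : nbhdOfSet G S ⊆ insert v K := hSd ▸ nb_comp
  have hSR : S ⊆ (insert v K)ᶜ := hSd ▸ comp_sub haR
  rw [← hSd] at hS huS
  have hvN : v ∈ nbhdOfSet G S := ⟨fun h => hSR h (.inl rfl), a, haS, hav.symm⟩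
  obtain ⟨p, q, hpK, hqK, hpN, hqN, hpq⟩ : ∃ p q, p ∈ K ∧ q ∈ K ∧ p ∈ nbhdOfSet G S ∧ q ∈ nbhdOfSet G S ∧ p ≠ q := by
    by_contra hcon
    push Not at hcon
    have key : ∀ p', p' ≠ a → p' ≠ u → (∀ q ∈ K, q ∈ nbhdOfSet G S → q = p') → False := by
      intro p' h1 h2 h3
      refine H2 hc ha hu (s₁ := v) (s₂ := p') (T := S) haS huS hav.ne h1.symm huv h2.symm fun x hx y hyv hyp hxy => ?_
      by_contra hyS
      have hyN : y ∈ nbhdOfSet G S := ⟨hyS, x, hx, hxy.symm⟩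
      exact hyp (h3 y ((hN hyN).resolve_left hyv) hyN)
    by_cases hp : ∃ p ∈ K, p ∈ nbhdOfSet G S
    · obtain ⟨p, hp, hpN⟩ := hp
      exact key p (fun e => haK (e ▸ hp)) (fun e => huK (e ▸ hp)) fun q hq hqN => (hcon p q hp hq hpN hqN).symm
    · push Not at hp
      exact key v hav.ne' huv.symm fun q hq hqN => absurd hqN (hp q hq)
  have hpq := hK hpK hqK hpq
  have hNN : ∀ x, x ∈ nbhdOfSet G S ↔ (x = v ∨ x = p ∨ x = q) := by
    refine fun x => ⟨fun hx => ?_, by rintro (rfl | rfl | rfl) <;> assumption⟩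
    rcases hN hx with h | h
    · exact .inl h
    · by_contra hcon
      push Not at hcon
      exact hT.tri x p q (hK h hpK hcon.2.1) hpq (hK h hqK hcon.2.2)
  have hup : u ≠ p := fun e => huK (e ▸ hpK)
  have huq : u ≠ q := fun e => huK (e ▸ hqK)
  obtain ⟨f, m, hf, hfS, hf0, hfm⟩ := exists_ip_sets (A := {w | G.Adj p w}) (B := {w | G.Adj q w})
      hSc.2 (by obtain ⟨-, d, h1, h2⟩ := hpN; exact ⟨d, h2, h1⟩)
      (by obtain ⟨-, d, h1, h2⟩ := hqN; exact ⟨d, h2, h1⟩)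
  have hm : 1 ≤ m := by
    by_contra hm
    obtain rfl : m = 0 := by omega
    exact hT.tri p q (f 0) hpq ((hfm 0 le_rfl).2 rfl) ((hf0 0 le_rfl).2 rfl)
  have h : Tri G 𝓑 S v p q f m := ⟨hS, hSc, hNN, hpq, fun e => hvK (e ▸ hpK), fun e => hvK (e ▸ hqK), hf, hfS,
    hf0, hfm, hm⟩
  have hn := h.nS
  have ne : ∀ {x y}, x ∉ S → y ∈ S → x ≠ y := fun h1 h2 e => h1 (e ▸ h2)
  have p0 := (h.pf 0 (by omega)).2 rfl
  have qm := (h.qf m (by omega)).2 rfl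
  by_cases hvf : ∃ i ≤ m, G.Adj v (f i)
  · obtain ⟨i, hi, hvi⟩ := hvf
    have hD := h.D hc (by rintro _ ⟨j, hj, rfl⟩; exact hfS j hj) hf.conn ⟨f i, ⟨i, hi, rfl⟩, hvi⟩
      ⟨f 0, ⟨0, by simp, rfl⟩, p0.symm⟩ ⟨f m, ⟨m, by simp, rfl⟩, qm.symm⟩
    have hSf : ∀ x ∈ S, ∃ i ≤ m, x = f i := fun x hx => by
      obtain ⟨i, hi, e⟩ := hD hx; exact ⟨i, hi, e.symm⟩
    obtain ⟨ix, hix, e⟩ := hSf a haS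
    refine ⟨p, q, u, f, m, ix, hf, hm, hpq, hf0, hfm, fun i hi => ⟨fun h' => ?_, ?_⟩, hix, e.symm, fun i hi z hz => ?_,
      fun i hi => ⟨ne hn.1 (hfS i hi), ne hn.2.1 (hfS i hi), ne hn.2.2 (hfS i hi), ne huS (hfS i hi)⟩, h.vp, h.vq,
      hup, huq, huv, h.heavy hc ha hu haS huS huv hup huq,
      h.symm.heavy hc ha hu haS huS huv huq hup, hu, ha⟩
    · exact (h.one hT h.vp h.vq (fun j hj => ne hn.1 (hfS j hj)) hix (e ▸ hav.symm)).2.2 i hi h'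
    · rintro rfl; rw [← e]; exact hav.symm
    · rcases h.out (hfS i hi) hz with h1 | h1
      · exact .inr (.inr (.inr (hSf z h1)))
      · tauto
  · exfalso
    push Not at hvf
    obtain ⟨z, l, hz, hzS, hz0, hzl⟩ := exists_ip_sets (A := {a}) (B := {w | ∃ j ≤ m, G.Adj w (f j)})
      hSc.2 ⟨a, rfl, haS⟩ ⟨f 1, ⟨0, by omega, (hf.adj (by omega) (by omega)).2 (by omega)⟩, hfS 1 hm⟩
    have z0 : z 0 = a := (hz0 0 (by omega)).2 rfl
    have zf : ∀ i ≤ l, ∀ j ≤ m, z i ≠ f j := by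
      intro i hi j hj e
      have hi' : i = l := by
        rw [← hzl i hi, e]
        by_cases hj0 : j = 0
        · exact ⟨1, by omega, (hf.adj (by omega) (by omega)).2 (by omega)⟩
        · exact ⟨j - 1, by omega, (hf.adj (by omega) (by omega)).2 (by omega)⟩
      by_cases hl : l = 0
      · obtain rfl : i = 0 := by omega
        exact hvf j hj (by rw [← e, z0]; exact hav.symm)
      · have := (hzl (l - 1) (by omega)).1 ⟨j, hj, by
          rw [← e, hi']; exact (hz.adj (by omega) (by omega)).2 (by omega)⟩
        omega
    obtain ⟨s, hs, hls⟩ := (hzl l le_rfl).2 rfl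
    obtain ⟨one1, one2, one3⟩ := h.one hT (ne hn.2.1 (hzS l le_rfl)).symm (ne hn.2.2 (hzS l le_rfl)).symm
      (zf l le_rfl) hs hls
    have zfa : ∀ i ≤ l, ∀ j ≤ m, G.Adj (z i) (f j) ↔ (i = l ∧ j = s) := by
      refine fun i hi j hj => ⟨fun h' => ?_, ?_⟩
      · have hil := (hzl i hi).1 ⟨j, hj, h'⟩
        subst hil
        exact ⟨rfl, one3 j hj h'⟩
      · rintro ⟨rfl, rfl⟩; exact hls
    have hD := h.D hc (D := z '' Iic l ∪ f '' Iic m) (by rintro _ (⟨j, hj, rfl⟩ | ⟨j, hj, rfl⟩); exacts [hzS j hj, hfS j hj])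
      (hz.conn.union hf.conn ⟨z l, ⟨l, by simp, rfl⟩, f s, ⟨s, hs, rfl⟩, .inr hls⟩)
      ⟨a, .inl ⟨0, by simp, z0⟩, hav.symm⟩
      ⟨f 0, .inr ⟨0, by simp, rfl⟩, p0.symm⟩ ⟨f m, .inr ⟨m, by simp, rfl⟩, qm.symm⟩
    obtain ⟨w, haw, hwv, hwB⟩ := ha v (if l = 0 then f s else z 1)
    rcases h.out haS haw with h1 | h1 | h1 | h1
    · rcases hD h1 with ⟨i, hi, rfl⟩ | ⟨i, hi, rfl⟩
      · simp only [mem_Iic] at hi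
        rw [← z0, hz.adj (by omega) hi] at haw
        obtain rfl : i = 1 := by omega
        rw [if_neg (by omega)] at hwB; exact hwB rfl
      · rw [← z0, zfa 0 (by omega) i hi] at haw
        rw [if_pos haw.1.symm, haw.2] at hwB; exact hwB rfl
    · exact hwv h1
    · exact h.caseB hc hT ha hu haS huS huv hup huq hav hvf hz z0 hzS zf hs zfa (h1 ▸ haw)
    · exact h.symm.caseB hc hT ha hu haS huS huv huq hup hav (fun i hi => hvf _ (by omega)) (s := m - s) hz z0 hzS
        (fun i hi j hj => zf i hi _ (by omega)) (by omega) (fun i hi j hj => by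
          rw [zfa i hi _ (by omega)]; omega) (h1 ▸ haw)

theorem seagull [Finite V] (hc : Crit G k 𝓑) (hT : TF G) {a v u : V} (ha : Heavy G a) (hu : Heavy G u)
    (hau : a ≠ u) (hav : G.Adj a v) (hvu : G.Adj v u) : Spider G a v ∨ Spider G u v := by
  obtain ⟨K, hK, hvK, haK, huK, hn⟩ := seagull_cut hT hau hav hvu
  have huR : u ∈ (insert v K)ᶜ := by
    rintro (e | e)
    exacts [hvu.ne' e, huK e]
  rcases small_or hc.br (comp_anti huR hn) with h | h
  · exact .inl (spider_of_small hc hT ha hu hav hK hvK haK huK hvu.ne' h hn)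
  · refine .inr (spider_of_small hc hT hu ha hvu.symm hK hvK huK haK hav.ne h fun h' => hn (Reach.symm huR h'))

end spider
end Paper
namespace Paper

section matching
variable {V : Type} {G : SimpleGraph V} {k : ℕ} {𝓑 : Set (Set V)}
variable {x v p q u : V} {f : ℕ → V} {m ix : ℕ}

theorem Sp.nb2 (h : Sp G x v p q u f m ix) {i : ℕ} (hi : i ≤ m) {z : V} (hz : G.Adj (f i) z)
    (hzA : z ≠ if i = 0 then p else f (i - 1)) (hzB : z ≠ if i = m then q else f (i + 1)) : z = v ∧ i = ix := by
  rcases h.nb i hi z hz with rfl | rfl | rfl | ⟨j, hj, rfl⟩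
  · exact ⟨rfl, (h.vf i hi).1 hz.symm⟩
  · rw [if_pos ((h.pf i hi).1 hz.symm)] at hzA; exact absurd rfl hzA
  · rw [if_pos ((h.qf i hi).1 hz.symm)] at hzB; exact absurd rfl hzB
  · rw [h.hf.adj hi hj] at hz
    rcases hz with rfl | rfl
    · rw [if_neg (by omega)] at hzB; exact absurd rfl hzB
    · rw [if_neg (by omega)] at hzA; exact absurd rfl hzA

theorem Sp.light (h : Sp G x v p q u f m ix) {i : ℕ} (hi : i ≤ m) (hH : Heavy G (f i)) : i = ix := by
  obtain ⟨z, hz, hzA, hzB⟩ := hH _ _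
  exact (h.nb2 hi hz hzA hzB).2

theorem Sp.ne_x (h : Sp G x v p q u f m ix) {z : V} (hz : Heavy G z) (hzx : z ≠ x) {i : ℕ} (hi : i ≤ m) :
    z ≠ f i := by
  rintro rfl
  exact hzx (by rw [h.light hi hz, h.xe])

theorem Sp.xne (h : Sp G x v p q u f m ix) : v ≠ x ∧ p ≠ x ∧ q ≠ x ∧ u ≠ x := by
  have := h.Y ix h.xm
  rwa [h.xe] at this

theorem Sp.U2a (hc : Crit G k 𝓑) {p' q' u' : V} {f' : ℕ → V} {m' ix' : ℕ} (h : Sp G x v p q u f m ix)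
    (h' : Sp G q p p' q' u' f' m' ix') (hxp : x = p') : False := by
  have hvx : G.Adj x v := by rw [← h.xe]; exact ((h.vf ix h.xm).2 rfl).symm
  have hq'v : q' = v := by
    have h1 : G.Adj (f ix) q' := by rw [h.xe, hxp]; exact h'.pq
    rcases h.nb ix h.xm q' h1 with e | e | e | ⟨j, hj, e⟩
    · exact e
    · exact absurd e h'.vq.symm
    · exact absurd e h'.xne.2.2.1
    · exact absurd e (h.ne_x h'.hq (fun e' => h'.pq.ne (by rw [← hxp, e'])) hj)
  have hqY' : ∃ j ≤ m', q = f' j := ⟨ix', h'.xm, h'.xe.symm⟩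
  refine H2 hc h.hx h.hu (s₁ := v) (s₂ := p) (T := f '' Iic m ∪ f' '' Iic m') (.inl ⟨ix, h.xm, h.xe⟩) ?_
    h.xne.1.symm h.xne.2.1.symm h.uv h.up ?_
  · rintro (⟨i, hi, e⟩ | ⟨i, hi, e⟩)
    · exact (h.Y i hi).2.2.2 e.symm
    · exact h'.ne_x h.hu h.uq hi e.symm
  · rintro _ (⟨i, hi, rfl⟩ | ⟨i, hi, rfl⟩) y hyv hyp hadj
    · rcases h.nb i hi y hadj with e | e | e | ⟨j, hj, e⟩
      · exact absurd e hyv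
      · exact absurd e hyp
      · obtain ⟨j, hj, e'⟩ := hqY'
        exact .inr ⟨j, hj, by rw [e, e']⟩
      · exact .inl ⟨j, hj, e.symm⟩
    · rcases h'.nb i hi y hadj with e | e | e | ⟨j, hj, e⟩
      · exact absurd e hyp
      · exact .inl ⟨ix, h.xm, by rw [e, h.xe, hxp]⟩
      · exact absurd (e.trans hq'v) hyv
      · exact .inr ⟨j, hj, e.symm⟩

theorem Sp.U2 (hc : Crit G k 𝓑) (h : Sp G x v p q u f m ix) : ¬ Spider G q p := by
  rintro ⟨p', q', u', f', m', ix', h'⟩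
  by_cases h1 : x = p'
  · exact h.U2a hc h' h1
  by_cases h2 : x = q'
  · exact h.U2a hc h'.symm h2
  have hY : f '' Iic m ⊆ f' '' Iic m' := by
    have key : ∀ i ≤ m, ∀ j ≤ m', G.Adj (f' j) (f i) → f i ∈ f' '' Iic m' := by
      intro i hi j hj hadj
      rcases h'.nb j hj _ hadj with e | e | e | ⟨j, hj, e⟩
      · exact absurd e.symm (h.Y i hi).2.1
      · exact absurd e.symm (h.ne_x h'.hp (Ne.symm h1) hi)
      · exact absurd e.symm (h.ne_x h'.hq (Ne.symm h2) hi)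
      · exact ⟨j, hj, e.symm⟩
    refine h.hf.conn.2 _ ⟨f m, ⟨m, by simp, rfl⟩, key m le_rfl ix' h'.xm ?_⟩ ?_
    · rw [h'.xe]; exact (h.qf m le_rfl).2 rfl
    · rintro _ ⟨i, hi, rfl⟩ ⟨j, hj, e⟩ _ ⟨i', hi', rfl⟩ hadj
      exact key i' hi' j hj (e ▸ hadj)
  obtain ⟨j, hj, e⟩ := hY ⟨ix, h.xm, rfl⟩
  exact h'.ne_x h.hx h.xne.2.2.1.symm hj (by rw [e, h.xe])

def M (G : SimpleGraph V) (g h : V) : Prop :=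
  G.Adj g h ∧ Heavy G g ∧ Heavy G h ∧ ¬ Spider G g h ∧ ¬ Spider G h g

theorem M.symm {g h : V} (hm : M G g h) : M G h g := ⟨hm.1.symm, hm.2.2.1, hm.2.1, hm.2.2.2.2, hm.2.2.2.1⟩

theorem Sp.M (hc : Crit G k 𝓑) (h : Sp G x v p q u f m ix) : M G p q :=
  ⟨h.pq, h.hp, h.hq, h.symm.U2 hc, h.U2 hc⟩

theorem M.uniq [Finite V] (hc : Crit G k 𝓑) (hT : TF G) {g h h' : V} (h1 : M G g h) (h2 : M G g h') : h = h' := by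
  by_contra hne
  rcases seagull hc hT h1.2.2.1 h2.2.2.1 hne h1.1.symm h2.1 with h | h
  · exact h1.2.2.2.2 h
  · exact h2.2.2.2.2 h

structure Mod {W : Type} (G : SimpleGraph V) (H : SimpleGraph W) (B : W → Set V) : Prop where
  conn : ∀ w, Conn G (B w)
  disj : ∀ w w', w ≠ w' → ∀ x ∈ B w, x ∉ B w'
  adj : ∀ w w', H.Adj w w' → ∃ x ∈ B w, ∃ y ∈ B w', G.Adj x y

def mSet (G : SimpleGraph V) (hM : ∀ g h h' : V, Paper.M G g h → Paper.M G g h' → h = h') : Setoid V where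
  r a b := a = b ∨ Paper.M G a b
  iseqv := ⟨fun _ => .inl rfl, fun h => h.imp Eq.symm M.symm, by
    rintro x y z (rfl | h) (rfl | h')
    · exact .inl rfl
    · exact .inr h'
    · exact .inr h
    · exact .inl (hM y x z h.symm h')⟩

theorem mod_of_grid [Finite V] {W : Type} {H : SimpleGraph W} (N : ℕ)
    (hgrid : ∀ (Q : Type) [Finite Q] (G' : SimpleGraph Q), (∃ 𝓑, Br G' N 𝓑) → ∃ B, Mod G' H B)
    (hbr : Br G (2 * N) 𝓑) (hM : ∀ g h h' : V, Paper.M G g h → Paper.M G g h' → h = h') :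
    ∃ B, Mod G H B ∧ ∀ w, ∀ g ∈ B w, ∀ h, Paper.M G g h → h ∈ B w := by
  classical
  have := Fintype.ofFinite V
  let st := mSet G hM
  let ρ : V → Quotient st := Quotient.mk st
  have hρ : ∀ a b, ρ a = ρ b ↔ (a = b ∨ Paper.M G a b) := fun a b => Quotient.eq (r := st)
  let G' : SimpleGraph (Quotient st) := ⟨fun a b => a ≠ b ∧ ∃ x y, ρ x = a ∧ ρ y = b ∧ G.Adj x y,
    ⟨fun a b ⟨h, x, y, h1, h2, h3⟩ => ⟨h.symm, y, x, h2, h1, h3.symm⟩⟩, ⟨fun a h => h.1 rfl⟩⟩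
  suffices hBr : Br G' N {b' | ∃ b ∈ 𝓑, b' = ρ '' b} by
    obtain ⟨B, hB⟩ := hgrid (Quotient st) G' ⟨_, hBr⟩
    refine ⟨fun w => ρ ⁻¹' B w, ⟨fun w => ?_, fun w w' hne x hx hx' => hB.disj w w' hne _ hx hx', fun w w' h => ?_⟩,
      fun w g hg h hgh => ?_⟩
    · obtain ⟨⟨c, hc⟩, h2⟩ := hB.conn w
      obtain ⟨c, rfl⟩ := Quotient.exists_rep c
      refine ⟨⟨c, hc⟩, fun T ⟨a, ha, haT⟩ hT => ?_⟩
      have hfib : ∀ x y, x ∈ ρ ⁻¹' B w → ρ x = ρ y → x ∈ T → y ∈ T := by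
        intro x y hx hxy hxT
        rcases (hρ x y).1 hxy with rfl | h
        · exact hxT
        · exact hT x hx hxT y (by rw [mem_preimage, ← hxy]; exact hx) h.1
      have := h2 {c | ∃ x ∈ T, ρ x = c} ⟨ρ a, ha, a, haT, rfl⟩ (by
        rintro _ hc ⟨x, hx, rfl⟩ c' hc' ⟨-, y, z, e1, e2, hyz⟩
        have hyB : y ∈ ρ ⁻¹' B w := by rw [mem_preimage, e1]; exact hc
        exact ⟨z, hT y hyB (hfib x y hc e1.symm hx) z (by rw [mem_preimage, e2]; exact hc') hyz, e2⟩)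
      intro b hb
      obtain ⟨x, hx, e⟩ := this hb
      exact hfib x b (by rw [mem_preimage, e]; exact hb) e hx
    · obtain ⟨_, h1, _, h2, -, x, y, rfl, rfl, h3⟩ := hB.adj w w' h
      exact ⟨x, h1, y, h2, h3⟩
    · have : ρ g = ρ h := (hρ g h).2 (.inr hgh)
      rw [mem_preimage, ← this]; exact hg
  refine ⟨?_, ?_, ?_⟩
  · rintro _ ⟨b, hb, rfl⟩
    obtain ⟨h1, h2⟩ := hbr.conn b hb
    refine ⟨h1.image _, fun T ⟨a, ha, haT⟩ hT => ?_⟩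
    obtain ⟨a, ha, rfl⟩ := ha
    rintro _ ⟨c, hc, rfl⟩
    refine h2 (ρ ⁻¹' T) ⟨a, ha, haT⟩ (fun x hx hxT y hy hxy => ?_) hc
    by_cases e : ρ x = ρ y
    · rw [mem_preimage, ← e]; exact hxT
    · exact hT _ ⟨x, hx, rfl⟩ hxT _ ⟨y, hy, rfl⟩ ⟨e, x, y, rfl, rfl, hxy⟩
  · rintro _ ⟨b, hb, rfl⟩ _ ⟨b', hb', rfl⟩
    obtain ⟨x, hx, y, hy, h⟩ := hbr.touch b hb b' hb'
    refine ⟨ρ x, ⟨x, hx, rfl⟩, ρ y, ⟨y, hy, rfl⟩, ?_⟩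
    by_cases e : ρ x = ρ y
    · exact .inl e
    · exact .inr ⟨e, x, y, rfl, rfl, h.resolve_left fun e' => e (by rw [e'])⟩
  · intro X hX
    obtain ⟨b, hb, h⟩ := hbr.ord (Finset.univ.filter fun v => ρ v ∈ X) (by
      refine lt_of_le_of_lt (Finset.card_le_mul_card_image_of_maps_to (f := ρ) (t := X) (n := 2)
        (fun a ha => (Finset.mem_filter.1 ha).2) fun c hc => ?_) (by omega)
      by_contra hcon
      push Not at hcon
      obtain ⟨a, b, d, ha, hb, hd, hab, had, hbd⟩ := Finset.two_lt_card_iff.1 hcon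
      simp only [Finset.mem_filter] at ha hb hd
      have e1 := ((hρ a b).1 (ha.2.trans hb.2.symm)).resolve_left hab
      have e2 := ((hρ a d).1 (ha.2.trans hd.2.symm)).resolve_left had
      exact hbd (hM a b d e1 e2))
    refine ⟨_, ⟨b, hb, rfl⟩, ?_⟩
    rintro _ hxX ⟨y, hy, rfl⟩
    exact h y (by simp [hxX]) hy

end matching
end Paper
namespace Paper

section subdiv

theorem subdiv_iso {α β : Type} {S : SimpleGraph α} {H : SimpleGraph β} (h : IsSubdivision S H) :
    ∀ {α' : Type} {S' : SimpleGraph α'}, Nonempty (S' ≃g S) → IsSubdivision S' H := by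
  induction h with
  | base h => exact fun ⟨e⟩ => .base (h.map fun e' => e.trans e')
  | step u v huv _ ih => exact fun e => .step u v huv (ih e)

theorem subdivideEdge_congr {α β : Type} {S : SimpleGraph α} {H : SimpleGraph β} (e : S ≃g H) (u v : α) :
    Nonempty (subdivideEdge S u v ≃g subdivideEdge H (e u) (e v)) := by
  refine ⟨⟨Equiv.optionCongr e.toEquiv, ?_⟩⟩
  intro a b
  rcases a with _ | a <;> rcases b with _ | b <;>
    simp [subdivideEdge, SimpleGraph.fromRel_adj]
  intro _
  have h1 : H.Adj (e a) (e b) ↔ S.Adj a b := e.map_adj_iff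
  have h2 : H.Adj (e b) (e a) ↔ S.Adj b a := e.map_adj_iff
  rw [h1, h2]

theorem subdiv_sub {α β : Type} {S : SimpleGraph α} {H : SimpleGraph β} (h : IsSubdivision S H) :
    ∀ {u v : α}, S.Adj u v → IsSubdivision (subdivideEdge S u v) H := by
  induction h with
  | base h =>
    obtain ⟨e⟩ := h
    exact fun {u v} huv => .step (e u) (e v) (e.map_adj_iff.2 huv) (.base (subdivideEdge_congr e u v))
  | step u v huv _ ih => exact fun h => .step u v huv (ih h)

def D2 {V : Type} (G : SimpleGraph V) (F : Set V) : Prop :=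
  ∀ (e : V) (X : Set V), X ⊆ F → ¬ X ⊆ {e} → ∃ d ∈ X, d ≠ e ∧
    ∀ z ∈ X, ∀ z' ∈ X, G.Adj d z → G.Adj d z' → z = z'

structure SubM {S W : Type} (G : SimpleGraph S) (H : SimpleGraph W) (π : S → W) : Prop where
  conn : ∀ w, Conn G (π ⁻¹' {w})
  out : ∀ x y, G.Adj x y → π x ≠ π y → H.Adj (π x) (π y)
  ex : ∀ w w', H.Adj w w' → ∃ x y, π x = w ∧ π y = w' ∧ G.Adj x y
  uq : ∀ x y x' y', G.Adj x y → G.Adj x' y' → π x = π x' → π y = π y' → π x ≠ π y → x = x' ∧ y = y'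
  d2 : ∀ w, D2 G (π ⁻¹' {w})
  deg : ∀ x x', x ≠ x' → π x = π x' → ∀ A, ∃ z, G.Adj x z ∧ z ≠ A

theorem SubM.leaf {S W : Type} {G : SimpleGraph S} {H : SimpleGraph W} {π : S → W} (h : SubM G H π)
    (h3 : ∀ w a b c d, H.Adj w a → H.Adj w b → H.Adj w c → H.Adj w d → a = b ∨ a = c ∨ a = d ∨ b = c ∨ b = d ∨ c = d)
    {x x' : S} (hx : x ≠ x') (hπ : π x = π x') : ∃ d a b, π d = π x ∧ d ≠ a ∧ π a = π d ∧ G.Adj d a ∧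
      π b ≠ π d ∧ G.Adj d b ∧ ∀ z, G.Adj d z → z = a ∨ z = b := by
  have key : ∀ d, π d = π x → (∀ z ∈ π ⁻¹' {π x}, ∀ z' ∈ π ⁻¹' {π x}, G.Adj d z → G.Adj d z' → z = z') →
      ∃ a b, π a = π d ∧ G.Adj d a ∧ π b ≠ π d ∧ G.Adj d b := by
    intro d hd hu
    have hne : ∃ y, y ≠ d ∧ π y = π d := by
      by_cases e : d = x
      · exact ⟨x', by rw [e]; exact hx.symm, by rw [e]; exact hπ.symm⟩
      · exact ⟨x, Ne.symm e, hd.symm⟩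
    obtain ⟨y, hy, hyd⟩ := hne
    obtain ⟨a, ha, hda⟩ : ∃ a, π a = π d ∧ G.Adj d a := by
      by_contra hcon
      push Not at hcon
      exact hy ((h.conn (π d)).2 {d} ⟨d, rfl, rfl⟩ (by
        rintro _ _ rfl b hb hab; exact absurd hab (hcon b hb)) hyd)
    obtain ⟨b, hb, hba⟩ := h.deg d y hy.symm hyd.symm a
    refine ⟨a, b, ha, hda, fun e => hba ?_, hb⟩
    exact hu b (e.trans hd) a (ha.trans hd) hb hda
  obtain ⟨d₁, m1, -, u1⟩ := h.d2 (π x) x _ Subset.rfl fun hs => hx (hs (show π x' = π x from hπ.symm)).symm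
  obtain ⟨d₂, m2, n2, u2⟩ := h.d2 (π x) d₁ _ Subset.rfl fun hs => hx
    ((hs (show π x = π x from rfl)).trans (hs (show π x' = π x from hπ.symm)).symm)
  obtain ⟨a₁, b₁, p1, q1, r1, s1⟩ := key d₁ m1 u1
  obtain ⟨a₂, b₂, p2, q2, r2, s2⟩ := key d₂ m2 u2
  have fin : ∀ d a b, π d = π x → (∀ z ∈ π ⁻¹' {π x}, ∀ z' ∈ π ⁻¹' {π x}, G.Adj d z → G.Adj d z' → z = z') →
      π a = π d → G.Adj d a → (∀ z, G.Adj d z → π z ≠ π d → z = b) → ∀ z, G.Adj d z → z = a ∨ z = b := by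
    intro d a b hd hu ha hda hb z hz
    by_cases e : π z = π d
    · exact .inl (hu z (e.trans hd) a (ha.trans hd) hz hda)
    · exact .inr (hb z hz e)
  by_cases o1 : ∀ z, G.Adj d₁ z → π z ≠ π d₁ → z = b₁
  · exact ⟨d₁, a₁, b₁, m1, q1.ne, p1, q1, r1, s1, fin d₁ a₁ b₁ m1 u1 p1 q1 o1⟩
  by_cases o2 : ∀ z, G.Adj d₂ z → π z ≠ π d₂ → z = b₂
  · exact ⟨d₂, a₂, b₂, m2, q2.ne, p2, q2, r2, s2, fin d₂ a₂ b₂ m2 u2 p2 q2 o2⟩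
  exfalso
  push Not at o1 o2
  obtain ⟨c₁, t1, v1, w1⟩ := o1
  obtain ⟨c₂, t2, v2, w2⟩ := o2
  have m1' : π d₁ = π x := m1
  have m2' : π d₂ = π x := m2
  have cross : ∀ y y', G.Adj d₁ y → G.Adj d₂ y' → π y ≠ π d₁ → π y ≠ π y' := fun y y' h1 h2 h3 h4 =>
    n2 (h.uq d₁ y d₂ y' h1 h2 (m1'.trans m2'.symm) h4 h3.symm).1.symm
  have same : ∀ d y y', G.Adj d y → G.Adj d y' → π y ≠ π d → y ≠ y' → π y ≠ π y' := fun d y y' h1 h2 h3 h5 h4 =>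
    h5 (h.uq d y d y' h1 h2 rfl h4 h3.symm).2
  have hh := h3 (π x) (π b₁) (π c₁) (π b₂) (π c₂) (m1' ▸ h.out _ _ s1 r1.symm) (m1' ▸ h.out _ _ t1 v1.symm)
    (m2' ▸ h.out _ _ s2 r2.symm) (m2' ▸ h.out _ _ t2 v2.symm)
  rcases hh with e | e | e | e | e | e
  · exact same _ _ _ s1 t1 r1 (Ne.symm w1) e
  · exact cross _ _ s1 s2 r1 e
  · exact cross _ _ s1 t2 r1 e
  · exact cross _ _ t1 s2 v1 e
  · exact cross _ _ t1 t2 v1 e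
  · exact same _ _ _ s2 t2 r2 (Ne.symm w2) e

theorem subM_subdiv {W : Type} {H : SimpleGraph W}
    (h3 : ∀ w a b c d, H.Adj w a → H.Adj w b → H.Adj w c → H.Adj w d → a = b ∨ a = c ∨ a = d ∨ b = c ∨ b = d ∨ c = d)
    (n : ℕ) : ∀ (S : Type) [Finite S] (G : SimpleGraph S) (π : S → W), SubM G H π → Nat.card S = n →
      IsSubdivision G H := by
  classical
  induction n with
  | zero =>
    intro S _ G π h hn
    refine .base ⟨⟨⟨π, fun w => (h.conn w).1.some, ?_, ?_⟩, ?_⟩⟩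
    all_goals intro x
    · exact ((Finite.card_eq_zero_iff.1 hn).elim x)
    · exact ((Finite.card_eq_zero_iff.1 hn).elim (h.conn x).1.some)
    · exact ((Finite.card_eq_zero_iff.1 hn).elim x)
  | succ n ih =>
    intro S _ G π h hn
    by_cases hinj : Function.Injective π
    · refine .base ⟨⟨Equiv.ofBijective π ⟨hinj, fun w => (h.conn w).1⟩, ?_⟩⟩
      intro a b
      change H.Adj (π a) (π b) ↔ _
      refine ⟨fun hab => ?_, fun hab => h.out a b hab fun e => hab.ne (hinj e)⟩
      obtain ⟨x, y, e1, e2, hxy⟩ := h.ex _ _ hab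
      rwa [hinj e1, hinj e2] at hxy
    simp only [Function.Injective, not_forall] at hinj
    obtain ⟨x, x', hπ, hx⟩ := hinj
    obtain ⟨d, a, b, -, hda, ha, hadj, hb, hbdj, hnb⟩ := h.leaf h3 hx hπ
    have hbd : b ≠ d := hbdj.ne.symm
    have hab : a ≠ b := fun e => hb (by rw [← e, ha])
    have hnab : ¬ G.Adj a b := fun e => by
      have := (h.uq a b d b e hbdj ha rfl (by rw [ha]; exact hb.symm)).1
      exact hda this.symm
    let G' : SimpleGraph {x : S // x ≠ d} := ⟨fun x y => G.Adj x y ∨ (x.1 = a ∧ y.1 = b) ∨ (x.1 = b ∧ y.1 = a),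
      ⟨fun x y hxy => by rcases hxy with h | h | h <;> [exact .inl h.symm; exact .inr (.inr ⟨h.2, h.1⟩); exact .inr (.inl ⟨h.2, h.1⟩)]⟩,
      ⟨fun x hxx => by
        rcases hxx with h | h | h
        · exact G.loopless.irrefl _ h
        · exact hab (h.1.symm.trans h.2)
        · exact hab (h.2.symm.trans h.1)⟩⟩
    have hG'f : ∀ x y : {x : S // x ≠ d}, π x = π y → (G'.Adj x y ↔ G.Adj x y) := by
      intro x y e
      refine ⟨?_, .inl⟩
      rintro (h | h | h)
      · exact h
      · rw [h.1, h.2, ha] at e; exact absurd e.symm hb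
      · rw [h.1, h.2, ha] at e; exact absurd e hb
    have hM : SubM G' H (fun x => π x) := by
      refine ⟨?_, ?_, ?_, ?_, ?_, ?_⟩
      · intro w
        have hne : ∃ y, π y = w ∧ y ≠ d := by
          obtain ⟨y, hy⟩ := (h.conn w).1
          by_cases e : y = d
          · exact ⟨a, by rw [ha, ← e]; exact hy, hda.symm⟩
          · exact ⟨y, hy, e⟩
        obtain ⟨y, hy, hyd⟩ := hne
        refine ⟨⟨⟨y, hyd⟩, hy⟩, ?_⟩
        rintro T ⟨c, hc, hcT⟩ hT z hz
        have := (h.conn w).2 {s | (∃ hs : s ≠ d, (⟨s, hs⟩ : {x : S // x ≠ d}) ∈ T) ∨ (s = d ∧ ⟨a, hda.symm⟩ ∈ T)}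
          ⟨c, hc, .inl ⟨c.2, hcT⟩⟩ (by
          rintro s hs hsT s' hs' hss
          have hs1 : π s = w := hs
          have hs2 : π s' = w := hs'
          by_cases e' : s' = d
          · subst e'
            rcases hnb s hss.symm with e | e
            · subst e
              rcases hsT with ⟨_, h⟩ | ⟨e, h⟩
              · exact .inr ⟨rfl, h⟩
              · exact absurd e.symm hda
            · exact absurd (by rw [← e, hs1, hs2]) hb
          rcases hsT with ⟨h1, h2⟩ | ⟨rfl, h2⟩
          · exact .inl ⟨e', hT _ hs h2 ⟨s', e'⟩ hs' ((hG'f _ _ (hs1.trans hs2.symm)).2 hss)⟩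
          · rcases hnb s' hss with e | e
            · subst e; exact .inl ⟨e', h2⟩
            · exact absurd (by rw [← e, hs1, hs2]) hb) hz
        rcases this with ⟨_, h⟩ | ⟨h, _⟩
        · exact h
        · exact absurd h z.2
      · rintro x y (h1 | h1 | h1) hne
        · exact h.out _ _ h1 hne
        · rw [h1.1, h1.2, ha]; exact h.out _ _ hbdj hb.symm
        · rw [h1.1, h1.2, ha]; exact (h.out _ _ hbdj hb.symm).symm
      · intro w w' hw
        obtain ⟨x, y, e1, e2, hxy⟩ := h.ex w w' hw
        have hww := hw.ne
        by_cases ex : x = d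
        · subst ex
          rcases hnb y hxy with e | e
          · subst e; exact absurd (e1.symm.trans (ha.symm.trans e2)) hww
          · subst e; exact ⟨⟨a, hda.symm⟩, ⟨y, hbd⟩, by rw [← e1]; exact ha, e2, .inr (.inl ⟨rfl, rfl⟩)⟩
        by_cases ey : y = d
        · subst ey
          rcases hnb x hxy.symm with e | e
          · subst e; exact absurd (e1.symm.trans (ha.trans e2)) hww
          · subst e; exact ⟨⟨x, hbd⟩, ⟨a, hda.symm⟩, e1, by rw [← e2]; exact ha, .inr (.inr ⟨rfl, rfl⟩)⟩
        exact ⟨⟨x, ex⟩, ⟨y, ey⟩, e1, e2, .inl hxy⟩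
      · have lift : ∀ x y : {x : S // x ≠ d}, G'.Adj x y → π x ≠ π y → ∃ x₀ y₀, G.Adj x₀ y₀ ∧ π x₀ = π x ∧ π y₀ = π y ∧
            ((x₀ = x ∧ y₀ = y) ∨ (x₀ = d ∧ y₀ = b ∧ x.1 = a ∧ y.1 = b) ∨ (x₀ = b ∧ y₀ = d ∧ x.1 = b ∧ y.1 = a)) := by
          rintro x y (h1 | h1 | h1) _
          · exact ⟨x, y, h1, rfl, rfl, .inl ⟨rfl, rfl⟩⟩
          · exact ⟨d, b, hbdj, by rw [h1.1, ha], by rw [h1.2], .inr (.inl ⟨rfl, rfl, h1⟩)⟩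
          · exact ⟨b, d, hbdj.symm, by rw [h1.1], by rw [h1.2, ha], .inr (.inr ⟨rfl, rfl, h1⟩)⟩
        intro x y x' y' h1 h2 e1 e2 hne
        obtain ⟨p, q, g1, g2, g3, g4⟩ := lift x y h1 hne
        obtain ⟨p', q', g1', g2', g3', g4'⟩ := lift x' y' h2 (by rw [← e1, ← e2]; exact hne)
        obtain ⟨u1, u2⟩ := h.uq p q p' q' g1 g1' (by rw [g2, g2', e1]) (by rw [g3, g3', e2]) (by rw [g2, g3]; exact hne)
        have hx1 := x.2
        have hx2 := x'.2
        have hy1 := y.2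
        have hy2 := y'.2
        rw [Subtype.ext_iff, Subtype.ext_iff]
        grind
      · intro w e X hX hXe
        obtain ⟨d', ⟨d'', h1, rfl⟩, h2, h3⟩ := h.d2 w e (Subtype.val '' X) (by rintro _ ⟨z, hz, rfl⟩; exact hX hz)
          (fun hs => hXe fun z hz => Subtype.ext (hs ⟨z, hz, rfl⟩))
        refine ⟨d'', h1, fun e' => h2 (by rw [e']), fun z hz z' hz' a1 a2 => Subtype.ext ?_⟩
        have f1 : π d'' = w := hX h1
        exact h3 z ⟨z, hz, rfl⟩ z' ⟨z', hz', rfl⟩ ((hG'f _ _ (f1.trans (hX hz).symm)).1 a1)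
          ((hG'f _ _ (f1.trans (hX hz').symm)).1 a2)
      · intro x x' hne hp A
        by_cases ea : x.1 = a
        · by_cases eA : A.1 = b
          · obtain ⟨z, hz1, hz2⟩ := h.deg x x' (fun e => hne (Subtype.ext e)) hp d
            refine ⟨⟨z, hz2⟩, .inl hz1, fun e => ?_⟩
            rw [Subtype.ext_iff] at e
            simp only at e
            rw [e, eA, ea] at hz1; exact hnab hz1
          · exact ⟨⟨b, hbd⟩, .inr (.inl ⟨ea, rfl⟩), fun e => eA (by rw [← e])⟩
        by_cases eb : x.1 = b
        · by_cases eA : A.1 = a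
          · obtain ⟨z, hz1, hz2⟩ := h.deg x x' (fun e => hne (Subtype.ext e)) hp d
            refine ⟨⟨z, hz2⟩, .inl hz1, fun e => ?_⟩
            rw [Subtype.ext_iff] at e
            simp only at e
            rw [e, eA, eb] at hz1; exact hnab hz1.symm
          · exact ⟨⟨a, hda.symm⟩, .inr (.inr ⟨eb, rfl⟩), fun e => eA (by rw [← e])⟩
        obtain ⟨z, hz1, hz2⟩ := h.deg x x' (fun e => hne (Subtype.ext e)) hp A
        have : z ≠ d := by
          rintro rfl
          rcases hnb x hz1.symm with e | e
          · exact ea e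
          · exact eb e
        exact ⟨⟨z, this⟩, .inl hz1, fun e => hz2 (by rw [← e])⟩
    have hcard : Nat.card {x : S // x ≠ d} = n := by
      have := Fintype.ofFinite S
      rw [Nat.card_eq_fintype_card] at *
      rw [Fintype.card_subtype_compl, Fintype.card_subtype_eq]; omega
    have hs := subdiv_sub (ih {x : S // x ≠ d} G' _ hM hcard) (u := ⟨a, hda.symm⟩) (v := ⟨b, hbd⟩) (.inr (.inl ⟨rfl, rfl⟩))
    refine subdiv_iso hs ⟨RelIso.symm ⟨⟨fun o => o.elim d (fun x => x.1), fun s => if hs : s = d then none else some ⟨s, hs⟩, ?_, ?_⟩, ?_⟩⟩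
    · rintro (_ | x)
      · simp
      · simp [x.2]
    · intro s
      by_cases e : s = d <;> simp [e]
    · rintro (_ | x) (_ | y)
      · simp
      · simp only [Equiv.coe_fn_mk, Option.elim, subdivideEdge, SimpleGraph.fromRel_adj]
        have hy := y.2
        constructor
        · intro h1
          refine ⟨by simp, .inl (.inr ⟨by simp, ?_⟩)⟩
          rcases hnb y h1 with e | e
          · exact .inl (by simp [Subtype.ext_iff, e])
          · exact .inr (by simp [Subtype.ext_iff, e])
        · rintro ⟨-, (⟨_, _, h1, _⟩ | ⟨-, h1⟩) | (⟨_, _, _, h1, _⟩ | ⟨h1, _⟩)⟩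
          · simp at h1
          · simp only [Option.some.injEq, Subtype.ext_iff] at h1
            rcases h1 with e | e <;> rw [e] <;> assumption
          · simp at h1
          · simp at h1
      · simp only [Equiv.coe_fn_mk, Option.elim, subdivideEdge, SimpleGraph.fromRel_adj]
        constructor
        · intro h1
          refine ⟨by simp, .inr (.inr ⟨by simp, ?_⟩)⟩
          rcases hnb x h1.symm with e | e
          · exact .inl (by simp [Subtype.ext_iff, e])
          · exact .inr (by simp [Subtype.ext_iff, e])
        · rintro ⟨-, (⟨_, _, _, h1, _⟩ | ⟨h1, _⟩) | (⟨_, _, h1, _⟩ | ⟨-, h1⟩)⟩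
          · simp at h1
          · simp at h1
          · simp at h1
          · simp only [Option.some.injEq, Subtype.ext_iff] at h1
            rcases h1 with e | e <;> rw [e] <;> [exact hadj.symm; exact hbdj.symm]
      · simp only [Equiv.coe_fn_mk, Option.elim, subdivideEdge, SimpleGraph.fromRel_adj]
        constructor
        · intro h1
          refine ⟨fun e => h1.ne (by simpa [Subtype.ext_iff] using e), .inl (.inl ⟨x, y, rfl, rfl, .inl h1, ?_, ?_⟩)⟩
          · rintro ⟨rfl, rfl⟩; exact hnab h1
          · rintro ⟨rfl, rfl⟩; exact hnab h1.symm
        · have : ∀ x y : {x : S // x ≠ d}, G'.Adj x y → ¬ (x = ⟨a, hda.symm⟩ ∧ y = ⟨b, hbd⟩) →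
              ¬ (x = ⟨b, hbd⟩ ∧ y = ⟨a, hda.symm⟩) → G.Adj x y := by
            rintro x y (h1 | h1 | h1) n1 n2
            · exact h1
            · exact absurd ⟨Subtype.ext h1.1, Subtype.ext h1.2⟩ n1
            · exact absurd ⟨Subtype.ext h1.1, Subtype.ext h1.2⟩ n2
          rintro ⟨-, (⟨x', y', e1, e2, h1, n1, n2⟩ | ⟨h1, _⟩) | (⟨x', y', e1, e2, h1, n1, n2⟩ | ⟨h1, _⟩)⟩
          · rw [Option.some_inj] at e1 e2; subst e1 e2; exact this _ _ h1 n1 n2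
          · simp at h1
          · rw [Option.some_inj] at e1 e2; subst e1 e2; exact (this _ _ h1 n1 n2).symm
          · simp at h1

end subdiv
end Paper
namespace Paper

section fiber
variable {V : Type} {G : SimpleGraph V}

theorem D2.insert {F : Set V} {a : V} (h : D2 G F)
    (ha : ∀ z ∈ F, ∀ z' ∈ F, G.Adj a z → G.Adj a z' → z = z') : D2 G (insert a F) := by
  intro e X hX hXe
  have hXa : X \ {a} ⊆ F := fun z hz => (hX hz.1).resolve_left hz.2
  by_cases haX : a ∈ X
  · by_cases hae : a = e
    · subst hae
      have hlift : ∀ d ∈ X \ {a}, ¬ G.Adj d a → (∀ z ∈ X \ {a}, ∀ z' ∈ X \ {a}, G.Adj d z → G.Adj d z' → z = z') →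
          ∀ z ∈ X, ∀ z' ∈ X, G.Adj d z → G.Adj d z' → z = z' := fun d hd hn hu z hz z' hz' h1 h2 =>
        hu z ⟨hz, fun e => hn (e ▸ h1)⟩ z' ⟨hz', fun e => hn (e ▸ h2)⟩ h1 h2
      by_cases hc : ∃ c ∈ F, G.Adj a c
      · obtain ⟨c, hcF, hac⟩ := hc
        by_cases hXc : X \ {a} ⊆ {c}
        · have : c ∈ X := by
            by_contra hcX
            exact hXe fun z hz => by_contra fun hza => hcX (by have := hXc ⟨hz, hza⟩; rw [mem_singleton_iff] at this; exact this ▸ hz)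
          refine ⟨c, this, hac.ne.symm, ?_⟩
          have hh : ∀ z ∈ X, G.Adj c z → z = a := fun z hz h1 => by
            by_contra hza
            have := hXc ⟨hz, hza⟩
            rw [mem_singleton_iff] at this
            exact h1.ne this.symm
          exact fun z hz z' hz' h1 h2 => (hh z hz h1).trans (hh z' hz' h2).symm
        · obtain ⟨d, h1, h2, h3⟩ := h c _ hXa hXc
          refine ⟨d, h1.1, h1.2, hlift d h1 (fun h' => h2 ?_) h3⟩
          exact ha d (hXa h1) c hcF h'.symm hac
      · push Not at hc
        obtain ⟨d, h1, h2, h3⟩ := h a (X \ {a}) hXa (fun hs => hXe fun z hz => by_contra fun hza => hza (hs ⟨hz, hza⟩))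
        exact ⟨d, h1.1, h1.2, hlift d h1 (fun h' => hc d (hXa h1) h'.symm) h3⟩
    · refine ⟨a, haX, hae, fun z hz z' hz' h1 h2 => ?_⟩
      exact ha z ((hX hz).resolve_left h1.ne.symm) z' ((hX hz').resolve_left h2.ne.symm) h1 h2
  · exact h e X (fun z hz => hXa ⟨hz, fun e => haX (e ▸ hz)⟩) hXe

theorem IP.d2 {f : ℕ → V} {n : ℕ} (h : IP G f n) : D2 G (f '' Iic n) := by
  have : ∀ m ≤ n, D2 G (f '' Iic m) := by
    intro m
    induction m with
    | zero =>
      intro _ e X hX hXe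
      have hX' : ∀ z ∈ X, z = f 0 := fun z hz => by obtain ⟨i, hi, rfl⟩ := hX hz; rw [show i = 0 by simpa using hi]
      have : ∃ z ∈ X, z ≠ e := by by_contra hc; push Not at hc; exact hXe hc
      obtain ⟨z, hz, hze⟩ := this
      exact ⟨z, hz, hze, fun a ha b hb _ _ => by rw [hX' a ha, hX' b hb]⟩
    | succ m ih =>
      intro hm
      have e : f '' Iic (m+1) = Insert.insert (f (m+1)) (f '' Iic m) := by
        rw [← image_insert_eq]; congr 1; ext i; simp; omega
      rw [e]
      refine (ih (by omega)).insert ?_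
      rintro _ ⟨i, hi, rfl⟩ _ ⟨j, hj, rfl⟩ h1 h2
      simp only [mem_Iic] at hi hj
      rw [h.adj (by omega) (by omega)] at h1 h2
      congr 1; omega
  exact this n le_rfl

theorem conn_del {F K : Set V} {d : V} (hF : Conn G F) (hK : Conn G K) (hKF : K ⊆ F \ {d})
    (h : ∀ z ∈ F, G.Adj d z → z ∈ K) : Conn G (F \ {d}) := by
  refine ⟨hK.1.mono hKF, pconn_of_reach ?_⟩
  obtain ⟨k, hk⟩ := hK.1
  have key : F ⊆ {x | x = d ∨ (x ∈ F \ {d} ∧ Reach G (F \ {d}) k x)} := by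
    refine hF.2 _ ⟨k, (hKF hk).1, .inr ⟨hKF hk, .refl⟩⟩ ?_
    rintro a ha haT b hb hab
    by_cases e : b = d
    · exact .inl e
    refine .inr ⟨⟨hb, e⟩, ?_⟩
    rcases haT with rfl | haT
    · exact (hK.2.reach hk (h b hb hab)).mono (fun _ _ h => h) hKF
    · exact haT.2.tail ⟨hab, hb, e⟩
  intro a ha b hb
  exact (Reach.symm (hKF hk) ((key ha.1).resolve_left ha.2).2).trans ((key hb.1).resolve_left hb.2).2

theorem conn_del1 {F : Set V} {d A : V} (hF : Conn G F) (hne : ∃ x ∈ F, x ≠ d)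
    (h : ∀ z ∈ F, G.Adj d z → z = A) (hd : d ∈ F) : Conn G (F \ {d}) := by
  obtain ⟨x, hx, hxd⟩ := hne
  obtain ⟨y, hy, hyd, _, rfl, h'⟩ := hF.exists_nb (S := {d}) ⟨d, hd, rfl⟩ fun hs => hxd (hs hx)
  refine conn_del hF (Conn.single y) (by rintro _ rfl; exact ⟨hy, hyd⟩) fun z hz hz' => ?_
  rw [mem_singleton_iff, h z hz hz', h y hy h'.symm]

theorem tree_fiber [Finite V] (hT : ∀ a b c, G.Adj a b → G.Adj b c → G.Adj a c → False) {B : Set V} (hB : Conn G B)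
    {τ₁ τ₂ τ₃ : V} (h1 : τ₁ ∈ B) (h2 : τ₂ ∈ B) (h3 : τ₃ ∈ B) :
    ∃ F ⊆ B, Conn G F ∧ τ₁ ∈ F ∧ τ₂ ∈ F ∧ τ₃ ∈ F ∧ D2 G F ∧
      ∀ d ∈ F, d ≠ τ₁ → d ≠ τ₂ → d ≠ τ₃ → ∀ A, ∃ z ∈ F, G.Adj d z ∧ z ≠ A := by
  obtain ⟨F, hF⟩ := (toFinite {F : Set V | F ⊆ B ∧ Conn G F ∧ τ₁ ∈ F ∧ τ₂ ∈ F ∧ τ₃ ∈ F}).exists_minimal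
    ⟨B, Subset.rfl, hB, h1, h2, h3⟩
  obtain ⟨⟨f1, f2, f3, f4, f5⟩, hmin⟩ := hF
  have hmin' : ∀ F', F' ⊆ F → Conn G F' → τ₁ ∈ F' → τ₂ ∈ F' → τ₃ ∈ F' → F ⊆ F' := fun F' a b c d e =>
    hmin ⟨a.trans f1, b, c, d, e⟩ a
  refine ⟨F, f1, f2, f3, f4, f5, ?_, ?_⟩
  swap
  · intro d hd n1 n2 n3 A
    by_contra hc
    push Not at hc
    have := hmin' _ sdiff_subset (conn_del1 f2 ⟨τ₁, f3, n1.symm⟩ hc hd) ⟨f3, n1.symm⟩ ⟨f4, n2.symm⟩ ⟨f5, n3.symm⟩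
    exact (this hd).2 rfl
  obtain ⟨f, n, p1, p2, p3, p4⟩ := exists_ip_sets (A := {τ₁}) (B := {τ₂}) f2.2 ⟨τ₁, rfl, f3⟩ ⟨τ₂, rfl, f4⟩
  have e0 : f 0 = τ₁ := (p3 0 (by omega)).2 rfl
  have en : f n = τ₂ := (p4 n (by omega)).2 rfl
  have hPF : f '' Iic n ⊆ F := by rintro _ ⟨i, hi, rfl⟩; exact p2 i hi
  set P := f '' Iic n with hP
  have m0 : τ₁ ∈ P := ⟨0, by simp, e0⟩
  have mn : τ₂ ∈ P := ⟨n, by simp, en⟩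
  by_cases hτ : τ₃ ∈ P
  · rw [(hmin' P hPF p1.conn m0 mn hτ).antisymm hPF]
    exact p1.d2
  obtain ⟨g, k, q1, q2, q3, q4⟩ := exists_ip_sets (A := {τ₃}) (B := {z | z ∈ P ∨ ∃ y ∈ P, G.Adj z y}) f2.2
    ⟨τ₃, rfl, f5⟩ ⟨τ₁, .inl m0, f3⟩
  have g0 : g 0 = τ₃ := (q3 0 (by omega)).2 rfl
  have hgP : ∀ i ≤ k, g i ∉ P := by
    intro i hi hi'
    obtain rfl := (q4 i hi).1 (.inl hi')
    rcases Nat.eq_zero_or_pos i with rfl | h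
    · exact hτ (g0 ▸ hi')
    · have := (q4 (i-1) (by omega)).1 (.inr ⟨_, hi', (q1.adj (by omega) (by omega)).2 (by omega)⟩)
      omega
  have hgn : ∀ i < k, ∀ y ∈ P, ¬ G.Adj (g i) y := fun i hi y hy h => by
    have := (q4 i hi.le).1 (.inr ⟨y, hy, h⟩); omega
  have hgF : g '' Iic k ⊆ F := by rintro _ ⟨i, hi, rfl⟩; exact q2 i hi
  have hone : ∀ z ∈ P, ∀ z' ∈ P, G.Adj (g k) z → G.Adj (g k) z' → z = z' := by
    have : ∀ i j, i < j → j ≤ n → G.Adj (g k) (f i) → G.Adj (g k) (f j) → False := by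
      intro i j hij hj a1 a2
      by_cases e : j = i + 1
      · exact hT _ _ _ a1 ((p1.adj (by omega) hj).2 (.inl e)) a2
      have c1 : Conn G (f '' Iic i) :=
        IP.conn (n := i) fun a b hab hb => p1 a b hab (by omega)
      have c2 := (p1.sub (i := j) (m := n - j) (by omega)).conn
      have c3 := (q1.conn.union c1 ⟨g k, ⟨k, by simp, rfl⟩, f i, ⟨i, by simp, rfl⟩, .inr a1⟩).union c2
        ⟨g k, .inl ⟨k, by simp, rfl⟩, f j, ⟨0, by simp, rfl⟩, .inr a2⟩
      have hs := hmin' _ ?_ c3 (.inl (.inr ⟨0, by simp, e0⟩)) (.inr ⟨n - j, by simp, by simp only [← en]; congr 1; omega⟩)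
        (.inl (.inl ⟨0, by simp, g0⟩)) (p2 (i+1) (by omega))
      · rcases hs with (⟨l, hl, e'⟩ | ⟨l, hl, e'⟩) | ⟨l, hl, e'⟩ <;> simp only [mem_Iic] at hl
        · exact hgP l hl ⟨i+1, by simp; omega, e'.symm⟩
        · have := p1.inj (by omega) (by omega) e'; omega
        · have := p1.inj (by omega) (by omega) e'; omega
      · rintro _ ((⟨l, hl, rfl⟩ | ⟨l, hl, rfl⟩) | ⟨l, hl, rfl⟩) <;> simp only [mem_Iic] at hl
        · exact q2 l hl
        · exact p2 l (by omega)
        · exact p2 _ (by omega)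
    rintro _ ⟨i, hi, rfl⟩ _ ⟨j, hj, rfl⟩ a1 a2
    rcases lt_trichotomy i j with h | h | h
    · exact (this i j h hj a1 a2).elim
    · rw [h]
    · exact (this j i h hi a2 a1).elim
  have hD : ∀ j ≤ k, D2 G (P ∪ g '' Icc (k - j) k) := by
    intro j
    induction j with
    | zero =>
      intro _
      have : P ∪ g '' Icc (k - 0) k = Insert.insert (g k) P := by simp
      rw [this]
      exact p1.d2.insert hone
    | succ j ih =>
      intro hj
      have : P ∪ g '' Icc (k - (j+1)) k = Insert.insert (g (k - (j+1))) (P ∪ g '' Icc (k - j) k) := by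
        rw [← union_insert, ← image_insert_eq]; congr 2; ext i; simp; omega
      rw [this]
      refine (ih (by omega)).insert ?_
      have hh : ∀ z ∈ P ∪ g '' Icc (k - j) k, G.Adj (g (k - (j+1))) z → z = g (k - j) := by
        rintro z (hz | ⟨i, hi, rfl⟩) h
        · exact absurd h (hgn _ (by omega) z hz)
        · simp only [mem_Icc] at hi
          rw [q1.adj (by omega) (by omega)] at h
          congr 1; omega
      exact fun z hz z' hz' a b => (hh z hz a).trans (hh z' hz' b).symm
  have hfin := hmin' (P ∪ g '' Iic k) (union_subset hPF hgF)
    (p1.conn.union q1.conn (by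
      obtain h | ⟨y, hy, h⟩ := (q4 k le_rfl).2 rfl
      · exact absurd h (hgP k le_rfl)
      · exact ⟨y, hy, g k, ⟨k, by simp, rfl⟩, .inr h.symm⟩)) (.inl m0) (.inl mn) (.inr ⟨0, by simp, g0⟩)
  have hk := hD k le_rfl
  have e : Icc (k - k) k = Iic k := by ext i; simp
  rw [e] at hk
  rwa [hfin.antisymm (union_subset hPF hgF)]

end fiber
end Paper
namespace Paper

section endgame
variable {V W : Type} {G : SimpleGraph V} {H : SimpleGraph W} {k : ℕ} {𝓑 : Set (Set V)} {B : W → Set V}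
variable {x v p q u : V} {f : ℕ → V} {m ix : ℕ}

theorem Sp.few (h : Sp G x v p q u f m ix) {F : Set V} (hF : Conn G F) (hFY : F ⊆ f '' Iic m) (hx : x ∉ F) :
    ∃ c d, ∀ z, z ∉ F → (∃ y ∈ F, G.Adj y z) → z = c ∨ z = d := by
  classical
  let Q1 : V → Prop := fun z => ∃ i ≤ m, f i ∈ F ∧ (∀ j ≤ m, f j ∈ F → j ≤ i) ∧ z = if i = m then q else f (i + 1)
  let Q2 : V → Prop := fun z => ∃ i ≤ m, f i ∈ F ∧ (∀ j ≤ m, f j ∈ F → i ≤ j) ∧ z = if i = 0 then p else f (i - 1)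
  have hQ : ∀ z, z ∉ F → (∃ y ∈ F, G.Adj y z) → Q1 z ∨ Q2 z := by
    rintro z hz ⟨y, hy, hyz⟩
    obtain ⟨i, hi, rfl⟩ := hFY hy
    simp only [mem_Iic] at hi
    have hix : i ≠ ix := by rintro rfl; exact hx (h.xe ▸ hy)
    by_cases e1 : z = if i = m then q else f (i + 1)
    · refine .inl ⟨i, hi, hy, fun j hj hjF => ?_, e1⟩
      have : F ⊆ {y | ∃ j ≤ i, y = f j} := hF.2 _ ⟨f i, hy, i, le_rfl, rfl⟩ (by
        rintro _ ha ⟨l, hl, rfl⟩ b hb hab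
        obtain ⟨l', hl', rfl⟩ := hFY hb
        simp only [mem_Iic] at hl'
        rw [h.hf.adj (by omega) hl'] at hab
        refine ⟨l', ?_, rfl⟩
        by_contra hcon
        have : l' = i + 1 := by omega
        rw [if_neg (by omega)] at e1
        exact hz (by rw [e1, ← this]; exact hb))
      obtain ⟨l, hl, e⟩ := this hjF
      rw [h.hf.inj hj (by omega) e]; exact hl
    by_cases e2 : z = if i = 0 then p else f (i - 1)
    · refine .inr ⟨i, hi, hy, fun j hj hjF => ?_, e2⟩
      have : F ⊆ {y | ∃ j ≤ m, i ≤ j ∧ y = f j} := hF.2 _ ⟨f i, hy, i, hi, le_rfl, rfl⟩ (by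
        rintro _ ha ⟨l, hl, hil, rfl⟩ b hb hab
        obtain ⟨l', hl', rfl⟩ := hFY hb
        simp only [mem_Iic] at hl'
        rw [h.hf.adj (by omega) hl'] at hab
        refine ⟨l', hl', ?_, rfl⟩
        by_contra hcon
        have : l' = i - 1 := by omega
        rw [if_neg (by omega)] at e2
        exact hz (by rw [e2, ← this]; exact hb))
      obtain ⟨l, hl, hil, e⟩ := this hjF
      rw [h.hf.inj hj (by omega) e]; exact hil
    exact absurd (h.nb2 hi hyz e2 e1).2 hix
  have u1 : ∃ c, ∀ z, Q1 z → z = c := by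
    by_cases hc : ∃ c, Q1 c
    · obtain ⟨c, i, hi, hiF, him, rfl⟩ := hc
      refine ⟨if i = m then q else f (i + 1), ?_⟩
      rintro _ ⟨j, hj, hjF, hjm, rfl⟩
      rw [le_antisymm (him j hj hjF) (hjm i hi hiF)]
    · exact ⟨x, fun z hz => absurd ⟨z, hz⟩ hc⟩
  have u2 : ∃ c, ∀ z, Q2 z → z = c := by
    by_cases hc : ∃ c, Q2 c
    · obtain ⟨c, i, hi, hiF, him, rfl⟩ := hc
      refine ⟨if i = 0 then p else f (i - 1), ?_⟩
      rintro _ ⟨j, hj, hjF, hjm, rfl⟩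
      rw [le_antisymm (hjm i hi hiF) (him j hj hjF)]
    · exact ⟨x, fun z hz => absurd ⟨z, hz⟩ hc⟩
  obtain ⟨c, hc⟩ := u1
  obtain ⟨d, hd⟩ := u2
  exact ⟨c, d, fun z h1 h2 => (hQ z h1 h2).imp (hc z) (hd z)⟩

structure GM (G : SimpleGraph V) (H : SimpleGraph W) (B : W → Set V) : Prop extends Mod G H B where
  sat : ∀ w w' g h, g ∈ B w → h ∈ B w' → M G g h → w = w'
  min : ∀ B', Mod G H B' → (∀ w, B' w ⊆ B w) → ∀ w, B w ⊆ B' w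
  h2 : ∀ w A, ∃ w', H.Adj w w' ∧ w' ≠ A

theorem GM.del (hB : GM G H B) {w : W} {d : V} (hd : d ∈ B w) (hc : Conn G (B w \ {d}))
    (h : ∀ w', H.Adj w w' → ∃ x ∈ B w, x ≠ d ∧ ∃ y ∈ B w', G.Adj x y) : False := by
  have hnd : ∀ w', w' ≠ w → d ∉ B w' := fun w' hne => hB.disj w w' hne.symm d hd
  have := hB.min (fun w => B w \ {d}) ⟨fun w' => ?_, fun a b hab z hz hz' => hB.disj a b hab z hz.1 hz'.1, fun a b hab => ?_⟩
    (fun w => sdiff_subset) w hd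
  · exact this.2 rfl
  · by_cases e : w' = w
    · subst e; exact hc
    · rw [sdiff_singleton_eq_self (hnd w' e)]; exact hB.conn w'
  · by_cases e : a = w
    · subst e
      obtain ⟨z, hz, hzd, y, hy, hzy⟩ := h b hab
      exact ⟨z, ⟨hz, hzd⟩, y, ⟨hy, fun e => hnd b hab.ne.symm (e ▸ hy)⟩, hzy⟩
    by_cases e' : b = w
    · subst e'
      obtain ⟨z, hz, hzd, y, hy, hzy⟩ := h a hab.symm
      exact ⟨y, ⟨hy, fun e => hnd a hab.ne (e ▸ hy)⟩, z, ⟨hz, hzd⟩, hzy.symm⟩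
    obtain ⟨z, hz, y, hy, hzy⟩ := hB.adj a b hab
    exact ⟨z, ⟨hz, fun e'' => hnd a e (e'' ▸ hz)⟩, y, ⟨hy, fun e'' => hnd b e' (e'' ▸ hy)⟩, hzy⟩

theorem GM.two (hB : GM G H B) {w : W} {d : V} (hd : d ∈ B w) (A : V) : ∃ z, (∃ w', z ∈ B w') ∧ G.Adj d z ∧ z ≠ A := by
  by_contra hc
  push Not at hc
  have hne : ∃ z ∈ B w, z ≠ d := by
    by_contra hcon
    push Not at hcon
    obtain ⟨w₁, e1, -⟩ := hB.h2 w w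
    obtain ⟨w₂, e2, n2⟩ := hB.h2 w w₁
    obtain ⟨a, ha, b, hb, hab⟩ := hB.adj _ _ e1
    obtain ⟨a', ha', b', hb', hab'⟩ := hB.adj _ _ e2
    rw [hcon a ha] at hab
    rw [hcon a' ha'] at hab'
    have := (hc b ⟨w₁, hb⟩ hab).trans (hc b' ⟨w₂, hb'⟩ hab').symm
    exact hB.disj w₁ w₂ n2.symm b hb (this ▸ hb')
  obtain ⟨z, hz, hzd⟩ := hne
  obtain ⟨y, hy, hyd, _, rfl, h'⟩ := (hB.conn w).exists_nb (S := {d}) ⟨d, hd, rfl⟩ fun hs => hzd (hs hz)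
  obtain rfl := hc y ⟨w, hy⟩ h'.symm
  refine hB.del hd (conn_del1 (hB.conn w) ⟨z, hz, hzd⟩ (fun a ha hda => hc a ⟨w, ha⟩ hda) hd) fun w' hw' => ?_
  obtain ⟨a, ha, b, hb, hab⟩ := hB.adj _ _ hw'
  refine ⟨a, ha, ?_, b, hb, hab⟩
  rintro rfl
  exact hB.disj w w' hw'.ne y hy (hc b ⟨w', hb⟩ hab ▸ hb)

def Deep (H : SimpleGraph W) (z : W) : Prop := Heavy H z ∧ ∀ w, H.Adj z w → Heavy H w

theorem GM.claimL (hc : Crit G k 𝓑) (hB : GM G H B) {z y : W} (hz : Deep H z) (hzy : z ≠ y) (hx : x ∈ B z) (hv : v ∈ B y)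
    (hU : ∀ A A', ∃ a, (∃ w', a ∈ B w') ∧ G.Adj x a ∧ a ≠ A ∧ a ≠ A') (h : Sp G x v p q u f m ix) : False := by
  have hsu : ∀ i ≤ m, (∃ w, f i ∈ B w) → (∃ w, (if i = 0 then p else f (i - 1)) ∈ B w) ∧
      ∃ w, (if i = m then q else f (i + 1)) ∈ B w := by
    rintro i hi ⟨w, hw⟩
    by_cases e : i = ix
    · subst e
      rw [← h.xe] at hU
      constructor
      · obtain ⟨a, ha, hadj, n1, n2⟩ := hU v (if i = m then q else f (i + 1))
        by_cases e' : a = (if i = 0 then p else f (i - 1))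
        · rwa [← e']
        · exact absurd (h.nb2 hi hadj e' n2).1 n1
      · obtain ⟨a, ha, hadj, n1, n2⟩ := hU v (if i = 0 then p else f (i - 1))
        by_cases e' : a = (if i = m then q else f (i + 1))
        · rwa [← e']
        · exact absurd (h.nb2 hi hadj n2 e').1 n1
    · constructor
      · obtain ⟨a, ha, hadj, n2⟩ := hB.two hw (if i = m then q else f (i + 1))
        by_cases e' : a = (if i = 0 then p else f (i - 1))
        · rwa [← e']
        · exact absurd (h.nb2 hi hadj e' n2).2 e
      · obtain ⟨a, ha, hadj, n2⟩ := hB.two hw (if i = 0 then p else f (i - 1))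
        by_cases e' : a = (if i = m then q else f (i + 1))
        · rwa [← e']
        · exact absurd (h.nb2 hi hadj n2 e').2 e
  have hYU : f '' Iic m ⊆ {a | ∃ w, a ∈ B w} := by
    refine h.hf.conn.2 _ ⟨x, ⟨ix, h.xm, h.xe⟩, z, hx⟩ ?_
    rintro _ ⟨i, hi, rfl⟩ hiU _ ⟨j, hj, rfl⟩ hadj
    simp only [mem_Iic] at hi hj
    obtain ⟨s1, s2⟩ := hsu i hi hiU
    rw [h.hf.adj hi hj] at hadj
    rcases hadj with rfl | rfl
    · rwa [if_neg (by omega)] at s2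
    · rwa [if_neg (by omega)] at s1
  obtain ⟨w₀, hp⟩ : ∃ w, p ∈ B w := by simpa using (hsu 0 (by omega) (hYU ⟨0, by simp, rfl⟩)).1
  obtain ⟨w₁, hq⟩ : ∃ w, q ∈ B w := by simpa using (hsu m (by omega) (hYU ⟨m, by simp, rfl⟩)).2
  obtain rfl := hB.sat _ _ _ _ hp hq (h.M hc)
  have hxY : x ∈ f '' Iic m := ⟨ix, h.xm, h.xe⟩
  have hsub : ∀ w, w ≠ w₀ → (∃ a ∈ B w, a ∈ f '' Iic m) → B w ⊆ f '' Iic m := by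
    intro w hw hex
    refine (hB.conn w).2 _ hex ?_
    rintro _ ha ⟨i, hi, rfl⟩ b hb hab
    rcases h.nb i hi b hab with rfl | rfl | rfl | ⟨j, hj, rfl⟩
    · exfalso
      have hwy : w = y := by_contra fun e => hB.disj w y e _ hb hv
      have := (h.vf i hi).1 hab.symm
      rw [this, h.xe] at ha
      exact hB.disj z y hzy x hx (hwy ▸ ha)
    · exact absurd hp (hB.disj w w₀ hw _ hb)
    · exact absurd hq (hB.disj w w₀ hw _ hb)
    · exact ⟨j, hj, rfl⟩
  have few : ∀ w, w ≠ w₀ → x ∉ B w → (∃ a ∈ B w, a ∈ f '' Iic m) → ∀ w₁ w₂ w₃, w₁ ≠ w → w₂ ≠ w → w₃ ≠ w →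
      (∃ a ∈ B w, ∃ b ∈ B w₁, G.Adj a b) → (∃ a ∈ B w, ∃ b ∈ B w₂, G.Adj a b) → (∃ a ∈ B w, ∃ b ∈ B w₃, G.Adj a b) →
      w₁ = w₂ ∨ w₁ = w₃ ∨ w₂ = w₃ := by
    rintro w hw hxw hex w₁ w₂ w₃ n1 n2 n3 ⟨a1, i1, b1, j1, k1⟩ ⟨a2, i2, b2, j2, k2⟩ ⟨a3, i3, b3, j3, k3⟩
    obtain ⟨c, d, hcd⟩ := h.few (hB.conn w) (hsub w hw hex) hxw
    have o1 := hcd b1 (hB.disj _ _ n1 _ j1) ⟨a1, i1, k1⟩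
    have o2 := hcd b2 (hB.disj _ _ n2 _ j2) ⟨a2, i2, k2⟩
    have o3 := hcd b3 (hB.disj _ _ n3 _ j3) ⟨a3, i3, k3⟩
    have eqv : ∀ s t, ∀ a ∈ B s, a ∈ B t → s = t := fun s t a h1 h2 => by_contra fun e => hB.disj s t e a h1 h2
    rcases o1 with rfl | rfl <;> rcases o2 with rfl | rfl <;> rcases o3 with rfl | rfl <;>
      first
      | exact .inl (eqv _ _ _ j1 j2)
      | exact .inr (.inl (eqv _ _ _ j1 j3))
      | exact .inr (.inr (eqv _ _ _ j2 j3))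
  have fewH : ∀ w, w ≠ w₀ → x ∉ B w → (∃ a ∈ B w, a ∈ f '' Iic m) → ¬ Heavy H w := by
    intro w hw hxw hex hh
    obtain ⟨w₁, a1, -, -⟩ := hh w w
    obtain ⟨w₂, a2, n2, -⟩ := hh w₁ w
    obtain ⟨w₃, a3, n3, n4⟩ := hh w₁ w₂
    rcases few w hw hxw hex w₁ w₂ w₃ a1.ne.symm a2.ne.symm a3.ne.symm (hB.adj _ _ a1) (hB.adj _ _ a2) (hB.adj _ _ a3) with e | e | e
    · exact n2 e.symm
    · exact n3 e.symm
    · exact n4 e.symm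
  have hYw : ∀ a ∈ f '' Iic m, ∃ w, a ∈ B w := hYU
  by_cases hzu : z = w₀
  · subst hzu
    by_cases hall : f '' Iic m ⊆ B z
    · have hdel : ∀ {p q : V} {f : ℕ → V} {ix : ℕ}, Sp G x v p q u f m ix → p ∈ B z → q ∈ B z → f '' Iic m ⊆ B z → ix ≠ 0 → False := by
        clear! p q f ix
        intro p q f ix h hp hq hall h0
        have hm := h.m1
        have hnb : ∀ a, G.Adj (f 0) a → a = p ∨ a = f 1 := by
          intro a ha
          by_contra hcon
          push Not at hcon
          exact h0 (h.nb2 (by omega) ha (by simpa using hcon.1) (by rw [if_neg (by omega)]; exact hcon.2)).2.symm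
        have hin : ∀ a, G.Adj (f 0) a → a ∈ B z := by
          intro a ha
          rcases hnb a ha with rfl | rfl
          · exact hp
          · exact hall ⟨1, hm, rfl⟩
        have cK := ((h.hf.sub (i := 1) (m := m - 1) (by omega)).conn.insert (a := q) (b := f m)
          ⟨m - 1, by simp, by simp only; congr 1; omega⟩ ((h.qf m le_rfl).2 rfl)).insert (a := p) (b := q) (.inl rfl) h.pq
        refine hB.del (hall ⟨0, by simp, rfl⟩) (conn_del (hB.conn z) cK ?_ ?_) ?_
        · rintro _ (rfl | rfl | ⟨i, hi, rfl⟩)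
          · exact ⟨hp, (h.Y 0 (by omega)).2.1⟩
          · exact ⟨hq, (h.Y 0 (by omega)).2.2.1⟩
          · simp only [mem_Iic] at hi
            exact ⟨hall ⟨1 + i, by simp; omega, rfl⟩, fun e => by have := h.hf.inj (by omega) (by omega) e; omega⟩
        · intro a _ ha
          rcases hnb a ha with rfl | rfl
          · exact .inl rfl
          · exact .inr (.inr ⟨0, by simp, rfl⟩)
        · intro w' hw'
          obtain ⟨a, ha, b, hb, hab⟩ := hB.adj _ _ hw'
          refine ⟨a, ha, ?_, b, hb, hab⟩
          rintro rfl
          exact hB.disj z w' hw'.ne b (hin b hab) hb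
      by_cases h0 : ix = 0
      · exact hdel h.symm hq hp (by rwa [img_rev]) (by have := h.m1; omega)
      · exact hdel h hp hq hall h0
    · obtain ⟨b, hbY, hbz, a, haz, hba⟩ : ∃ b ∈ f '' Iic m, b ∉ B z ∧ ∃ a ∈ B z, G.Adj b a :=
        h.hf.conn.exists_nb ⟨x, hxY, hx⟩ hall
      obtain ⟨w, hw⟩ := hYw b hbY
      have hwz : w ≠ z := by rintro rfl; exact hbz hw
      have hxw := hB.disj z w hwz.symm x hx
      obtain ⟨w₁, a1, n1⟩ := hB.h2 w z
      obtain ⟨w₂, a2, n2⟩ := hB.h2 w w₁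
      have hadj : H.Adj w z := by
        rcases few w hwz hxw ⟨b, hw, hbY⟩ w₁ w₂ z a1.ne.symm a2.ne.symm hwz.symm (hB.adj _ _ a1) (hB.adj _ _ a2) ⟨b, hw, a, haz, hba⟩ with e | e | e
        · exact absurd e.symm n2
        · exact absurd e n1
        · exact e ▸ a2
      exact fewH w hwz hxw ⟨b, hw, hbY⟩ (hz.2 w hadj.symm)
  · have hzY := hsub z hzu ⟨x, hx, hxY⟩
    obtain ⟨w, hw, n1, n2⟩ := hz.1 y w₀
    obtain ⟨a, ha, b, hb, hab⟩ := hB.adj _ _ hw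
    obtain ⟨i, hi, rfl⟩ := hzY ha
    rcases h.nb i hi b hab with rfl | rfl | rfl | ⟨j, hj, rfl⟩
    · exact hB.disj w y n1 _ hb hv
    · exact hB.disj w w₀ n2 _ hb hp
    · exact hB.disj w w₀ n2 _ hb hq
    · exact fewH w n2 (hB.disj z w hw.ne x hx) ⟨_, hb, j, hj, rfl⟩ (hz.2 w hw)

theorem GM.exact1 (hB : GM G H B) {z y : W} (hz : Heavy H z) (hzy : z ≠ y) {a b : V} (ha : a ∈ B z) (hb : b ∈ B y)
    (hab : G.Adj a b) (hU : ¬ ∀ A A', ∃ c, (∃ w', c ∈ B w') ∧ G.Adj a c ∧ c ≠ A ∧ c ≠ A')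
    (h : H.Adj z y → ∃ a' ∈ B z, ∃ b' ∈ B y, G.Adj a' b' ∧ (a' ≠ a ∨ b' ≠ b)) : False := by
  push Not at hU
  obtain ⟨A, A', hA⟩ := hU
  obtain ⟨c, hc⟩ : ∃ c, ∀ e, (∃ w, e ∈ B w) → G.Adj a e → e = b ∨ e = c := by
    by_cases e : b = A
    · exact ⟨A', fun d h1 h2 => by have := hA d h1 h2; by_cases d = A <;> simp_all⟩
    · have := hA b ⟨y, hb⟩ hab e
      exact ⟨A, fun d h1 h2 => by have := hA d h1 h2; by_cases d = A <;> simp_all⟩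
  have hone : ∀ e ∈ B z, G.Adj a e → e = c := fun e he hae =>
    (hc e ⟨z, he⟩ hae).resolve_left fun h => hB.disj z y hzy e he (h ▸ hb)
  have hne : ∃ e ∈ B z, e ≠ a := by
    by_contra hcon
    push Not at hcon
    obtain ⟨w₁, a1, -, -⟩ := hz y y
    obtain ⟨w₁, a1, n1, -⟩ := hz y y
    obtain ⟨w₂, a2, n2, n3⟩ := hz y w₁
    obtain ⟨s, hs, s', hs', hss⟩ := hB.adj _ _ a1
    obtain ⟨t, ht, t', ht', htt⟩ := hB.adj _ _ a2
    rw [hcon s hs] at hss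
    rw [hcon t ht] at htt
    have e1 := (hc s' ⟨_, hs'⟩ hss).resolve_left fun e => hB.disj w₁ y n1 s' hs' (e ▸ hb)
    have e2 := (hc t' ⟨_, ht'⟩ htt).resolve_left fun e => hB.disj w₂ y n2 t' ht' (e ▸ hb)
    exact hB.disj w₂ w₁ n3 t' ht' (e2.trans e1.symm ▸ hs')
  obtain ⟨e, he, hea⟩ := hne
  obtain ⟨d, hd, hda, _, rfl, h'⟩ := (hB.conn z).exists_nb (S := {a}) ⟨a, ha, rfl⟩ fun hs => hea (hs he)
  obtain rfl := hone d hd h'.symm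
  have hout : ∀ w e, w ≠ z → e ∈ B w → G.Adj _ e → e = b := fun w e hwz he hae =>
    (hc e ⟨w, he⟩ hae).resolve_right fun h => hB.disj w z hwz e he (h ▸ hd)
  refine hB.del ha (conn_del1 (hB.conn z) ⟨e, he, hea⟩ hone ha) fun w hw => ?_
  by_cases ewy : w = y
  · subst ewy
    obtain ⟨a', ha', b', hb', hab', hor⟩ := h hw
    refine ⟨a', ha', ?_, b', hb', hab'⟩
    rintro rfl
    exact hor.elim (fun e => e rfl) fun e => e (hout w b' hzy.symm hb' hab')
  · obtain ⟨s, hs, t, ht, hst⟩ := hB.adj _ _ hw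
    refine ⟨s, hs, ?_, t, ht, hst⟩
    rintro rfl
    exact hB.disj w y ewy t ht (hout w t hw.ne.symm ht hst ▸ hb)

theorem GM.exact (hc : Crit G k 𝓑) (hB : GM G H B) {z y : W} (hz : Deep H z) (hy : Deep H y) (hzy : z ≠ y)
    {a b : V} (ha : a ∈ B z) (hb : b ∈ B y) (hab : G.Adj a b) :
    H.Adj z y ∧ ∀ a' ∈ B z, ∀ b' ∈ B y, G.Adj a' b' → a' = a ∧ b' = b := by
  have key : (H.Adj z y → ∃ a' ∈ B z, ∃ b' ∈ B y, G.Adj a' b' ∧ (a' ≠ a ∨ b' ≠ b)) → False := by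
    intro hh
    by_cases h1 : ∀ A A', ∃ c, (∃ w', c ∈ B w') ∧ G.Adj a c ∧ c ≠ A ∧ c ≠ A'
    swap
    · exact hB.exact1 hz.1 hzy ha hb hab h1 hh
    by_cases h2 : ∀ A A', ∃ c, (∃ w', c ∈ B w') ∧ G.Adj b c ∧ c ≠ A ∧ c ≠ A'
    swap
    · refine hB.exact1 hy.1 hzy.symm hb ha hab.symm h2 fun h => ?_
      obtain ⟨a', ha', b', hb', e, hor⟩ := hh h.symm
      exact ⟨b', hb', a', ha', e.symm, hor.symm⟩
    have hv1 : Heavy G a := fun A A' => (h1 A A').imp fun c h => ⟨h.2.1, h.2.2⟩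
    have hv2 : Heavy G b := fun A A' => (h2 A A').imp fun c h => ⟨h.2.1, h.2.2⟩
    by_cases s1 : Spider G a b
    · obtain ⟨p, q, u, f, m, ix, s⟩ := s1
      exact hB.claimL hc hz hzy ha hb h1 s
    by_cases s2 : Spider G b a
    · obtain ⟨p, q, u, f, m, ix, s⟩ := s2
      exact hB.claimL hc hy hzy.symm hb ha h2 s
    exact hzy (hB.sat _ _ _ _ ha hb ⟨hab, hv1, hv2, s1, s2⟩)
  refine ⟨by_contra fun h => key fun h' => absurd h' h, fun a' ha' b' hb' h => ?_⟩
  by_contra hne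
  exact key fun _ => ⟨a', ha', b', hb', h, by tauto⟩

end endgame
end Paper
namespace Paper

section wall
variable {V W : Type} {G : SimpleGraph V} {H : SimpleGraph W} {k : ℕ} {𝓑 : Set (Set V)} {B : W → Set V}

theorem subdiv_of_exact [Finite V] (hT : ∀ a b c, G.Adj a b → G.Adj b c → G.Adj a c → False)
    (h3 : ∀ w a b c d, H.Adj w a → H.Adj w b → H.Adj w c → H.Adj w d → a = b ∨ a = c ∨ a = d ∨ b = c ∨ b = d ∨ c = d)
    (hB : Mod G H B) (hex : ∀ z y, z ≠ y → ∀ a ∈ B z, ∀ b ∈ B y, G.Adj a b →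
      H.Adj z y ∧ ∀ a' ∈ B z, ∀ b' ∈ B y, G.Adj a' b' → a' = a ∧ b' = b) :
    ∃ s : Set V, IsSubdivision (G.induce s) H := by
  classical
  let Tm : W → V → Prop := fun w a => a ∈ B w ∧ ∃ y, y ≠ w ∧ ∃ b ∈ B y, G.Adj a b
  have hF : ∀ w, ∃ F ⊆ B w, Conn G F ∧ (∀ a, Tm w a → a ∈ F) ∧ D2 G F ∧
      ∀ x ∈ F, ∀ x' ∈ F, x ≠ x' → ∀ A, ∃ z, z ≠ A ∧ G.Adj x z ∧ (z ∈ F ∨ ∃ y, y ≠ w ∧ z ∈ B y) := by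
    intro w
    obtain ⟨τ₁, τ₂, τ₃, m1, m2, m3, hall, hor⟩ : ∃ τ₁ τ₂ τ₃, τ₁ ∈ B w ∧ τ₂ ∈ B w ∧ τ₃ ∈ B w ∧
        (∀ a, Tm w a → a = τ₁ ∨ a = τ₂ ∨ a = τ₃) ∧ ((Tm w τ₁ ∧ Tm w τ₂ ∧ Tm w τ₃) ∨ (τ₁ = τ₂ ∧ τ₁ = τ₃)) := by
      by_cases c1 : ∃ τ, Tm w τ
      swap
      · obtain ⟨τ, hτ⟩ := (hB.conn w).1
        exact ⟨τ, τ, τ, hτ, hτ, hτ, fun a ha => absurd ⟨a, ha⟩ c1, .inr ⟨rfl, rfl⟩⟩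
      obtain ⟨τ₁, t1⟩ := c1
      by_cases c2 : ∃ τ, Tm w τ ∧ τ ≠ τ₁
      swap
      · push Not at c2
        exact ⟨τ₁, τ₁, τ₁, t1.1, t1.1, t1.1, fun a ha => .inl (c2 a ha), .inr ⟨rfl, rfl⟩⟩
      obtain ⟨τ₂, t2, n2⟩ := c2
      by_cases c3 : ∃ τ, Tm w τ ∧ τ ≠ τ₁ ∧ τ ≠ τ₂
      swap
      · push Not at c3
        exact ⟨τ₁, τ₂, τ₂, t1.1, t2.1, t2.1, fun a ha => by have := c3 a ha; tauto, .inl ⟨t1, t2, t2⟩⟩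
      obtain ⟨τ₃, t3, n3, n3'⟩ := c3
      refine ⟨τ₁, τ₂, τ₃, t1.1, t2.1, t3.1, fun a ha => ?_, .inl ⟨t1, t2, t3⟩⟩
      by_contra hcon
      push Not at hcon
      obtain ⟨i1, y1, j1, b1, k1, l1⟩ := t1
      obtain ⟨i2, y2, j2, b2, k2, l2⟩ := t2
      obtain ⟨i3, y3, j3, b3, k3, l3⟩ := t3
      obtain ⟨i4, y4, j4, b4, k4, l4⟩ := ha
      have e1 := hex w y1 j1.symm _ i1 _ k1 l1
      have e2 := hex w y2 j2.symm _ i2 _ k2 l2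
      have e3 := hex w y3 j3.symm _ i3 _ k3 l3
      have e4 := hex w y4 j4.symm _ i4 _ k4 l4
      rcases h3 w y1 y2 y3 y4 e1.1 e2.1 e3.1 e4.1 with e | e | e | e | e | e
      · exact n2 (e1.2 _ i2 b2 (e ▸ k2) l2).1
      · exact n3 (e1.2 _ i3 b3 (e ▸ k3) l3).1
      · exact hcon.1 (e1.2 _ i4 b4 (e ▸ k4) l4).1
      · exact n3' (e2.2 _ i3 b3 (e ▸ k3) l3).1
      · exact hcon.2.1 (e2.2 _ i4 b4 (e ▸ k4) l4).1
      · exact hcon.2.2 (e3.2 _ i4 b4 (e ▸ k4) l4).1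
    obtain ⟨F, g1, g2, g3, g4, g5, g6, g7⟩ := tree_fiber hT (hB.conn w) m1 m2 m3
    refine ⟨F, g1, g2, fun a ha => ?_, g6, fun x hx x' hx' hne A => ?_⟩
    · rcases hall a ha with rfl | rfl | rfl <;> assumption
    by_cases hx3 : x ≠ τ₁ ∧ x ≠ τ₂ ∧ x ≠ τ₃
    · obtain ⟨z, h1, h2, h3⟩ := g7 x hx hx3.1 hx3.2.1 hx3.2.2 A
      exact ⟨z, h3, h2, .inl h1⟩
    have hxt : Tm w x := by
      rcases hor with h | ⟨rfl, rfl⟩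
      · by_contra hcon
        exact hx3 ⟨fun e => hcon (e ▸ h.1), fun e => hcon (e ▸ h.2.1), fun e => hcon (e ▸ h.2.2)⟩
      · exfalso
        obtain rfl : x = τ₁ := by tauto
        obtain ⟨d, hd, hdx, hu⟩ := g6 x F Subset.rfl fun hs => hne (hs hx').symm
        obtain ⟨z, z1, z2, -⟩ := g7 d hd hdx hdx hdx d
        obtain ⟨z', z1', z2', n'⟩ := g7 d hd hdx hdx hdx z
        exact n' (hu z' z1' z z1 z2' z2)
    obtain ⟨-, y, hy, b, hb, hxb⟩ := hxt
    by_cases e : b = A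
    · obtain ⟨c, hc, hcx, _, rfl, hcx'⟩ := g2.exists_nb (S := {x}) ⟨x, hx, rfl⟩ fun hs => hne (hs hx').symm
      exact ⟨c, fun e' => hB.disj y w hy b hb (by rw [e, ← e']; exact g1 hc), hcx'.symm, .inl hc⟩
    · exact ⟨b, e, hxb, .inr ⟨y, hy, hb⟩⟩
  choose F f1 f2 f3 f4 f5 using hF
  let s : Set V := {a | ∃ w, a ∈ F w}
  choose π hπ using fun a : s => a.2
  have hpi : ∀ (a : s) w, a.1 ∈ B w → π a = w := fun a w h => by_contra fun e => hB.disj _ _ e _ (f1 _ (hπ a)) h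
  have hpre : ∀ (a : s) w, a ∈ π ⁻¹' {w} ↔ a.1 ∈ F w := fun a w =>
    ⟨fun h => by have h' : π a = w := h; rw [← h']; exact hπ a, fun h => hpi a w (f1 w h)⟩
  refine ⟨s, subM_subdiv h3 _ s (G.induce s) π ⟨fun w => ?_, fun x y hxy hne => ?_, fun w w' hw => ?_,
    fun x y x' y' h1 h2 e1 e2 hne => ?_, fun w e X hX hXe => ?_, fun x x' hne e A => ?_⟩ rfl⟩
  · obtain ⟨a, ha⟩ := (f2 w).1
    refine ⟨⟨⟨a, w, ha⟩, (hpre _ _).2 ha⟩, ?_⟩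
    rintro T ⟨c, hc, hcT⟩ hT b hb
    obtain ⟨b', hb', e⟩ := (f2 w).2 {v | ∃ c ∈ T, c.1 = v} ⟨c, (hpre _ _).1 hc, c, hcT, rfl⟩ (by
      rintro _ ha ⟨c, hc, rfl⟩ d hd hcd
      exact ⟨⟨d, w, hd⟩, hT c ((hpre _ _).2 ha) hc _ ((hpre _ _).2 hd) hcd, rfl⟩) ((hpre _ _).1 hb)
    rwa [← Subtype.ext e]
  · exact (hex _ _ hne _ (f1 _ (hπ x)) _ (f1 _ (hπ y)) hxy).1
  · obtain ⟨a, ha, b, hb, hab⟩ := hB.adj w w' hw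
    refine ⟨⟨a, w, f3 w a ⟨ha, w', hw.ne.symm, b, hb, hab⟩⟩, ⟨b, w', f3 w' b ⟨hb, w, hw.ne, a, ha, hab.symm⟩⟩, hpi _ _ ha, hpi _ _ hb, hab⟩
  · have := (hex _ _ hne _ (f1 _ (hπ x)) _ (f1 _ (hπ y)) h1).2 x' (by rw [e1]; exact f1 _ (hπ x')) y' (by rw [e2]; exact f1 _ (hπ y')) h2
    exact ⟨Subtype.ext this.1.symm, Subtype.ext this.2.symm⟩
  · obtain ⟨_, ⟨d, hd, rfl⟩, hde, hu⟩ := f4 w e (Subtype.val '' X) (by rintro _ ⟨a, ha, rfl⟩; exact (hpre _ _).1 (hX ha))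
      (fun hs => hXe fun a ha => Subtype.ext (hs ⟨a, ha, rfl⟩))
    exact ⟨d, hd, fun e' => hde (by rw [e']), fun z hz z' hz' h1 h2 => Subtype.ext (hu z ⟨z, hz, rfl⟩ z' ⟨z', hz', rfl⟩ h1 h2)⟩
  · obtain ⟨z, h1, h2, h3⟩ := f5 (π x) x (hπ x) x' (e ▸ hπ x') (fun e => hne (Subtype.ext e)) A
    have hz : ∃ w, z ∈ F w := by
      rcases h3 with h | ⟨y, hy, hzy⟩
      · exact ⟨_, h⟩
      · exact ⟨y, f3 y z ⟨hzy, π x, hy.symm, x, f1 _ (hπ x), h2.symm⟩⟩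
    exact ⟨⟨z, hz⟩, h2, fun e => h1 (by rw [← e])⟩

def BW (a b : ℕ) : SimpleGraph (Fin a × Fin b) :=
  SimpleGraph.fromRel (fun a b =>
    (a.1 = b.1 ∧ a.2.val + 1 = b.2.val) ∨
    (a.2 = b.2 ∧ a.1.val + 1 = b.1.val ∧ (a.1.val + a.2.val) % 2 = 0))

theorem bw_adj {a b : ℕ} {x y : Fin a × Fin b} : (BW a b).Adj x y ↔
    (x.1.val = y.1.val ∧ (x.2.val + 1 = y.2.val ∨ y.2.val + 1 = x.2.val)) ∨
    (x.2.val = y.2.val ∧ ((x.1.val + 1 = y.1.val ∧ (x.1.val + x.2.val) % 2 = 0) ∨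
      (y.1.val + 1 = x.1.val ∧ (y.1.val + y.2.val) % 2 = 0))) := by
  obtain ⟨⟨x1, hx1⟩, ⟨x2, hx2⟩⟩ := x
  obtain ⟨⟨y1, hy1⟩, ⟨y2, hy2⟩⟩ := y
  simp only [BW, SimpleGraph.fromRel_adj, ne_eq, Prod.mk.injEq, Fin.mk.injEq]
  omega

theorem bw_three {a b : ℕ} (w p q r s : Fin a × Fin b) (h1 : (BW a b).Adj w p) (h2 : (BW a b).Adj w q)
    (h3 : (BW a b).Adj w r) (h4 : (BW a b).Adj w s) : p = q ∨ p = r ∨ p = s ∨ q = r ∨ q = s ∨ r = s := by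
  let P : Fin a × Fin b → Fin 3 → Prop := fun p c => (c = 0 ∧ p.1.val = w.1.val ∧ p.2.val + 1 = w.2.val) ∨
      (c = 1 ∧ p.1.val = w.1.val ∧ p.2.val = w.2.val + 1) ∨
      (c = 2 ∧ p.1.val = (if (w.1.val + w.2.val) % 2 = 0 then w.1.val + 1 else w.1.val - 1) ∧ p.2.val = w.2.val)
  have key : ∀ p, (BW a b).Adj w p → ∃ c : Fin 3, P p c := by
    intro p hp
    rw [bw_adj] at hp
    simp only [P]
    rcases hp with ⟨h, h' | h'⟩ | ⟨h, ⟨h', h''⟩ | ⟨h', h''⟩⟩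
    · exact ⟨1, by simp; omega⟩
    · exact ⟨0, by simp; omega⟩
    · exact ⟨2, by simp [h'']; omega⟩
    · exact ⟨2, by rw [if_neg (by omega)]; simp; omega⟩
  have key2 : ∀ p q c, P p c → P q c → p = q := fun p q c h h' => by
    simp only [Prod.ext_iff, Fin.ext_iff]
    rcases h with ⟨rfl, h⟩ | ⟨rfl, h⟩ | ⟨rfl, h⟩ <;> simp [P] at h' <;> omega
  obtain ⟨c1, k1⟩ := key p h1
  obtain ⟨c2, k2⟩ := key q h2
  obtain ⟨c3, k3⟩ := key r h3
  obtain ⟨c4, k4⟩ := key s h4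
  have : c1 = c2 ∨ c1 = c3 ∨ c1 = c4 ∨ c2 = c3 ∨ c2 = c4 ∨ c3 = c4 := by omega
  rcases this with rfl | rfl | rfl | rfl | rfl | rfl
  · exact Or.inl (key2 _ _ _ k1 k2)
  · exact Or.inr (Or.inl (key2 _ _ _ k1 k3))
  · exact Or.inr (Or.inr (Or.inl (key2 _ _ _ k1 k4)))
  · exact Or.inr (Or.inr (Or.inr (Or.inl (key2 _ _ _ k2 k3))))
  · exact Or.inr (Or.inr (Or.inr (Or.inr (Or.inl (key2 _ _ _ k2 k4)))))
  · exact Or.inr (Or.inr (Or.inr (Or.inr (Or.inr (key2 _ _ _ k3 k4)))))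

theorem bw_heavy {a b : ℕ} (w : Fin a × Fin b) (h1 : 1 ≤ w.1.val) (h2 : w.1.val + 1 < a) (h3 : 1 ≤ w.2.val)
    (h4 : w.2.val + 1 < b) : Heavy (BW a b) w := by
  obtain ⟨⟨i, hi⟩, ⟨j, hj⟩⟩ := w
  simp only at *
  have key : ∃ c : Fin a × Fin b, c.2.val = j ∧ (BW a b).Adj (⟨i, hi⟩, ⟨j, hj⟩) c := by
    by_cases e : (i + j) % 2 = 0
    · exact ⟨(⟨i+1, h2⟩, ⟨j, hj⟩), rfl, by rw [bw_adj]; simp; omega⟩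
    · exact ⟨(⟨i-1, by omega⟩, ⟨j, hj⟩), rfl, by rw [bw_adj]; simp; omega⟩
  obtain ⟨c, hc, hadj⟩ := key
  intro A A'
  have l : (BW a b).Adj (⟨i, hi⟩, ⟨j, hj⟩) (⟨i, hi⟩, ⟨j-1, by omega⟩) := by rw [bw_adj]; simp; omega
  have r : (BW a b).Adj (⟨i, hi⟩, ⟨j, hj⟩) (⟨i, hi⟩, ⟨j+1, h4⟩) := by rw [bw_adj]; simp
  by_contra hcon
  push Not at hcon
  have e1 := hcon _ l
  have e2 := hcon _ r
  have e3 := hcon _ hadj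
  simp only [Prod.ext_iff, Fin.ext_iff, ne_eq] at e1 e2 e3
  omega

theorem bw_two {a b : ℕ} (ha : a % 2 = 0) (hb : b % 2 = 1) (hb3 : 3 ≤ b) (w A : Fin a × Fin b) :
    ∃ w', (BW a b).Adj w w' ∧ w' ≠ A := by
  obtain ⟨⟨i, hi⟩, ⟨j, hj⟩⟩ := w
  have key : ∃ c d : Fin a × Fin b, (c.1.val ≠ d.1.val ∨ c.2.val ≠ d.2.val) ∧ (BW a b).Adj (⟨i, hi⟩, ⟨j, hj⟩) c ∧
      (BW a b).Adj (⟨i, hi⟩, ⟨j, hj⟩) d := by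
    by_cases h0 : j = 0
    · by_cases e : i % 2 = 0
      · exact ⟨(⟨i, hi⟩, ⟨j+1, by omega⟩), (⟨i+1, by omega⟩, ⟨j, hj⟩), by simp, by rw [bw_adj]; simp, by rw [bw_adj]; simp; omega⟩
      · exact ⟨(⟨i, hi⟩, ⟨j+1, by omega⟩), (⟨i-1, by omega⟩, ⟨j, hj⟩), by simp, by rw [bw_adj]; simp, by rw [bw_adj]; simp; omega⟩
    by_cases h1 : j + 1 = b
    · by_cases e : i % 2 = 0
      · exact ⟨(⟨i, hi⟩, ⟨j-1, by omega⟩), (⟨i+1, by omega⟩, ⟨j, hj⟩), by simp, by rw [bw_adj]; simp; omega, by rw [bw_adj]; simp; omega⟩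
      · exact ⟨(⟨i, hi⟩, ⟨j-1, by omega⟩), (⟨i-1, by omega⟩, ⟨j, hj⟩), by simp; omega, by rw [bw_adj]; simp; omega, by rw [bw_adj]; simp; omega⟩
    exact ⟨(⟨i, hi⟩, ⟨j-1, by omega⟩), (⟨i, hi⟩, ⟨j+1, by omega⟩), by simp, by rw [bw_adj]; simp; omega, by rw [bw_adj]; simp⟩
  obtain ⟨c, d, hcd, h1, h2⟩ := key
  by_cases e : c = A
  · refine ⟨d, h2, ?_⟩
    rintro rfl
    simp [e] at hcd
  · exact ⟨c, h1, e⟩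

theorem wall_of_mod [Finite V] (hc : Crit G k 𝓑) (hT : TF G) (t : ℕ) {B : Fin (2*t+4) × Fin (2*t+5) → Set V}
    (hB : Mod G (BW (2*t+4) (2*t+5)) B) (hs : ∀ w, ∀ g ∈ B w, ∀ h, M G g h → h ∈ B w) : ContainsWallSubdiv G t := by
  obtain ⟨B', hB'⟩ := (toFinite {B' | Mod G (BW (2*t+4) (2*t+5)) B' ∧ ∀ w, B' w ⊆ B w}).exists_minimal ⟨B, hB, fun _ => Subset.rfl⟩
  have hGM : GM G (BW (2*t+4) (2*t+5)) B' :=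
    { hB'.1.1 with
      sat := fun w w' g h hg hh hm => by
        by_contra e
        exact hB.disj w w' e h (hs w g (hB'.1.2 w hg) h hm) (hB'.1.2 w' hh)
      min := fun B'' h h' w => hB'.2 (y := B'') ⟨h, fun w => (h' w).trans (hB'.1.2 w)⟩ h' w
      h2 := bw_two (by omega) (by omega) (by omega) }
  let ι : Fin t × Fin (2*t) → Fin (2*t+4) × Fin (2*t+5) := fun x =>
    (⟨x.1.val + 2, by have := x.1.2; omega⟩, ⟨x.2.val + 2, by have := x.2.2; omega⟩)
  have hι : ∀ x y, x ≠ y → ι x ≠ ι y := by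
    intro x y hne e
    simp only [ι, Prod.ext_iff, Fin.ext_iff] at e
    exact hne (by rw [Prod.ext_iff, Fin.ext_iff, Fin.ext_iff]; omega)
  have hadj : ∀ x y, (BW (2*t+4) (2*t+5)).Adj (ι x) (ι y) ↔ (Wall t).Adj x y := by
    intro x y
    rw [show Wall t = BW t (2*t) from rfl, bw_adj, bw_adj]
    simp only [ι]
    omega
  have hd : ∀ x, Deep (BW (2*t+4) (2*t+5)) (ι x) := by
    intro x
    have h1 := x.1.2
    have h2 := x.2.2
    refine ⟨bw_heavy _ ?_ ?_ ?_ ?_, fun w hw => ?_⟩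
    any_goals simp only [ι]; omega
    rw [bw_adj] at hw
    simp only [ι] at hw
    exact bw_heavy _ (by omega) (by omega) (by omega) (by omega)
  obtain ⟨s, hs⟩ := subdiv_of_exact (H := Wall t) (B := fun x => B' (ι x)) hT.tri bw_three
    ⟨fun w => hGM.conn _, fun w w' hne => hGM.disj _ _ (hι _ _ hne), fun w w' h => hGM.adj _ _ ((hadj _ _).2 h)⟩
    (fun z y hzy a ha b hb hab => by
      have := hGM.exact hc (hd z) (hd y) (hι _ _ hzy) ha hb hab
      rwa [hadj] at this)
  exact ⟨_, _, hs, s, ⟨RelIso.refl _⟩⟩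

end wall
end Paper
namespace Paper

section menger
variable {V : Type} {G : SimpleGraph V}

theorem exists_miss {ι : Type*} (I : Finset ι) (R : ι → Set V) (hR : ∀ i ∈ I, ∀ j ∈ I, i ≠ j → ∀ x ∈ R i, x ∉ R j)
    (Y : Finset V) (h : Y.card < I.card) : ∃ i ∈ I, ∀ y ∈ Y, y ∉ R i := by
  by_contra hc
  push Not at hc
  obtain ⟨i₀, hi₀⟩ := Finset.card_pos.1 (Nat.zero_lt_of_lt h)
  have : Nonempty V := ⟨(hc i₀ hi₀).choose⟩
  choose! g hg hg' using hc
  refine absurd (Finset.card_le_card_of_injOn g hg fun i hi j hj e => ?_) (by omega)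
  by_contra hne
  exact hR i hi j hj hne _ (hg' i hi) (e ▸ hg' j hj)

def NoSep (G : SimpleGraph V) (A B : Set V) (s : ℕ) : Prop :=
  ∀ X : Finset V, (∀ S, Conn G S → (A ∩ S).Nonempty → (B ∩ S).Nonempty → ∃ x ∈ X, x ∈ S) → s ≤ X.card

def Lk (G : SimpleGraph V) (A B : Set V) (s : ℕ) : Prop :=
  ∃ Q : Fin s → Set V, (∀ h, Conn G (Q h)) ∧ (∀ h h', h ≠ h' → ∀ x ∈ Q h, x ∉ Q h') ∧
    ∀ h, (A ∩ Q h).Nonempty ∧ (B ∩ Q h).Nonempty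

theorem Lk.noSep {A B : Set V} {s : ℕ} (h : Lk G A B s) : NoSep G A B s := by
  intro X hX
  by_contra hc
  obtain ⟨Q, h1, h2, h3⟩ := h
  obtain ⟨i, _, hi⟩ := exists_miss Finset.univ Q (fun i _ j _ => h2 i j) X (by simpa using hc)
  obtain ⟨x, hx, hx'⟩ := hX _ (h1 i) (h3 i).1 (h3 i).2
  exact hi x hx hx'

theorem trim {A L S Q : Set V} {x : V} (hA : A ⊆ L ∪ S) (hE : ∀ u ∈ L, u ≠ x → ∀ v, G.Adj u v → v ∈ L ∨ v ∈ S)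
    (hQ : Conn G Q) (h1 : (A ∩ Q).Nonempty) (h2 : (insert x S ∩ Q).Nonempty) :
    ∃ C ⊆ Q, Conn G C ∧ (A ∩ C).Nonempty ∧ ∃ z ∈ C, z ∈ insert x S ∧ ∀ v ∈ C, v ≠ z → v ∈ L ∧ v ∉ insert x S := by
  obtain ⟨f, n, hf, k1, k2, k3⟩ := exists_ip_sets hQ.2 h1 h2
  have key : ∀ i < n, f i ∈ L := by
    intro i
    induction i with
    | zero =>
      intro h
      exact (hA ((k2 0 (by omega)).2 rfl)).resolve_right fun hs => by have := (k3 0 (by omega)).1 (.inr hs); omega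
    | succ i ih =>
      intro h
      refine (hE _ (ih (by omega)) (fun e => ?_) _ ((hf i (i+1) (by omega) (by omega)).2.2 rfl)).resolve_right fun hs => ?_
      · have := (k3 i (by omega)).1 (.inl e); omega
      · have := (k3 (i+1) (by omega)).1 (.inr hs); omega
  refine ⟨f '' Iic n, by rintro _ ⟨i, hi, rfl⟩; exact k1 i hi, hf.conn, ⟨f 0, (k2 0 (by omega)).2 rfl, 0, by simp, rfl⟩, f n, ⟨n, by simp, rfl⟩, (k3 n le_rfl).2 rfl, ?_⟩
  rintro _ ⟨i, hi, rfl⟩ hne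
  have hi : i ≤ n := hi
  have : i ≠ n := fun e => hne (by rw [e])
  exact ⟨key i (by omega), fun h => this ((k3 i hi).1 h)⟩

theorem sep_aux {A B L S : Set V} {x y : V} (hA : A ⊆ L ∪ S) (hB : ∀ b ∈ B, b ∉ L)
    (hE : ∀ u ∈ L, ∀ v, v ∉ L → v ∉ S → G.Adj u v → u = x ∧ v = y) (hx : x ∈ L) (hy : y ∉ L) (hyS : y ∉ S) {s : ℕ}
    (h : NoSep G A B s) : NoSep (G.deleteEdges {s(x, y)}) A (insert x S) s := by
  intro X hX
  refine h X fun T hT hTA hTB => ?_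
  have hE' : ∀ u ∈ L, u ≠ x → ∀ v, G.Adj u v → v ∈ L ∨ v ∈ S := by
    intro u hu hux v huv
    by_contra hc
    push Not at hc
    exact hux (hE u hu v hc.1 hc.2 huv).1
  have hm : (insert x S ∩ T).Nonempty := by
    by_contra hc
    rw [Set.not_nonempty_iff_eq_empty, Set.eq_empty_iff_forall_notMem] at hc
    obtain ⟨a, ha, haT⟩ := hTA
    obtain ⟨b, hb, hbT⟩ := hTB
    refine hB b hb (hT.2 L ⟨a, haT, (hA ha).resolve_right fun hs => hc a ⟨.inr hs, haT⟩⟩ ?_ hbT)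
    intro u huT hu v hv huv
    exact (hE' u hu (fun e => hc u ⟨.inl e, huT⟩) v huv).resolve_right fun hs => hc v ⟨.inr hs, hv⟩
  obtain ⟨C, hCT, hC, hCA, z, hz, hzS, hCL⟩ := trim hA hE' hT hTA hm
  have hyC : y ∉ C := by
    intro hyC
    by_cases e : y = z
    · subst e
      rcases hzS with rfl | hs
      · exact hy hx
      · exact hyS hs
    · exact hy (hCL y hyC e).1
  obtain ⟨w, hw, hw'⟩ := hX C (hC.mono fun a ha b hb hab => by
    rw [SimpleGraph.deleteEdges_adj]
    refine ⟨hab, fun e => ?_⟩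
    rw [Set.mem_singleton_iff, Sym2.eq_iff] at e
    rcases e with ⟨rfl, rfl⟩ | ⟨rfl, rfl⟩
    · exact hyC hb
    · exact hyC ha) hCA ⟨z, hzS, hz⟩
  exact ⟨w, hw, hCT hw'⟩

theorem bij_end {s : ℕ} {C : Fin s → Set V} (hd : ∀ h h', h ≠ h' → ∀ x ∈ C h, x ∉ C h') {z : Fin s → V} (hz : ∀ h, z h ∈ C h)
    {T : Finset V} (hT : ∀ h, z h ∈ T) (hc : T.card ≤ s) : ∀ w ∈ T, ∃ h, z h = w := by
  classical
  have hi : Function.Injective z := fun a b e => by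
    by_contra hne
    exact hd a b hne _ (hz a) (e ▸ hz b)
  have : Finset.univ.image z = T := Finset.eq_of_subset_of_card_le (by intro w; simp; rintro a rfl; exact hT a)
    (by rw [Finset.card_image_of_injective _ hi]; simpa using hc)
  intro w hw
  rw [← this] at hw
  simpa using hw

open Classical in
theorem menger [Finite V] : ∀ (G : SimpleGraph V) (A B : Set V) (s : ℕ), NoSep G A B s → Lk G A B s := by
  intro G
  induction G using WellFoundedLT.induction with
  | ind G ih =>
  intro A B s hN
  by_cases hG : ∃ x y, G.Adj x y
  swap
  · have := Fintype.ofFinite V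
    have hs := hN (A ∩ B).toFinset (fun S hS ⟨a, ha, haS⟩ ⟨b, hb, hbS⟩ => by
      have : b = a := hS.2 {a} ⟨a, haS, rfl⟩ (by rintro _ _ _ w _ h; exact absurd ⟨_, _, h⟩ hG) hbS
      subst this
      exact ⟨b, by simp [ha, hb], hbS⟩)
    obtain ⟨e⟩ : Nonempty (Fin s ↪ (A ∩ B).toFinset) := by
      rw [Function.Embedding.nonempty_iff_card_le, Fintype.card_coe]; simpa using hs
    have he : ∀ h, (e h : V) ∈ A ∧ (e h : V) ∈ B := fun h => by simpa using (e h).2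
    refine ⟨fun h => {(e h : V)}, fun h => Conn.single _, ?_, fun h => ⟨⟨_, (he h).1, rfl⟩, ⟨_, (he h).2, rfl⟩⟩⟩
    rintro h h' hne _ rfl h2
    exact hne (e.injective (Subtype.ext h2))
  obtain ⟨x₀, y₀, hxy₀⟩ := hG
  have hlt : G.deleteEdges {s(x₀, y₀)} < G := by
    refine lt_of_le_of_ne (SimpleGraph.deleteEdges_le _) fun e => ?_
    have := hxy₀
    rw [← e, SimpleGraph.deleteEdges_adj] at this
    exact this.2 rfl
  have hmono : ∀ {S}, Conn (G.deleteEdges {s(x₀, y₀)}) S → Conn G S := fun h => h.mono fun a _ b _ hab => hlt.le hab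
  by_cases hN' : NoSep (G.deleteEdges {s(x₀, y₀)}) A B s
  · obtain ⟨Q, h1, h2⟩ := ih _ hlt A B s hN'
    exact ⟨Q, fun h => hmono (h1 h), h2⟩
  unfold NoSep at hN'
  push Not at hN'
  obtain ⟨S, hS, hSs⟩ := hN'
  set L : Set V := {v | ∃ a ∈ A, a ∉ S ∧ Reach (G.deleteEdges {s(x₀, y₀)}) {w | w ∉ S} a v} with hL
  have hLS : ∀ v ∈ L, v ∉ S := by
    rintro v ⟨a, ha, haS, h⟩
    exact comp_sub (S := {w | w ∉ S}) haS h
  have hA : A ⊆ L ∪ S := by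
    intro a ha
    by_cases h : a ∈ S
    · exact .inr h
    · exact .inl ⟨a, ha, h, mem_comp_self⟩
  have hB : ∀ b ∈ B, b ∉ L := by
    rintro b hb ⟨a, ha, haS, h⟩
    obtain ⟨w, hw, hw'⟩ := hS _ (comp_conn (S := {w | w ∉ S}) haS) ⟨a, ha, mem_comp_self⟩ ⟨b, hb, h⟩
    exact comp_sub (S := {w | w ∉ S}) haS hw' hw
  have hE : ∀ u ∈ L, ∀ v, v ∉ L → v ∉ S → G.Adj u v → s(u, v) = s(x₀, y₀) := by
    rintro u ⟨a, ha, haS, h⟩ v hv hvS huv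
    by_contra hne
    exact hv ⟨a, ha, haS, comp_step h hvS (by rw [SimpleGraph.deleteEdges_adj]; exact ⟨huv, hne⟩)⟩
  obtain ⟨T, hT, ⟨a, haA, haT⟩, ⟨b, hbB, hbT⟩, hTS⟩ : ∃ T, Conn G T ∧ (A ∩ T).Nonempty ∧ (B ∩ T).Nonempty ∧ ∀ v ∈ S, v ∉ T := by
    by_contra hc
    push Not at hc
    exact absurd (hN S hc) (by omega)
  obtain ⟨y, hyT, hyL, x, hxL, hyx⟩ := hT.exists_nb (S := L) ⟨a, haT, (hA haA).resolve_right fun h => hTS a h haT⟩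
    fun h => hB b hbB (h hbT)
  have hyS : y ∉ S := fun h => hTS y h hyT
  have hxS := hLS x hxL
  have exy := hE x hxL y hyL hyS hyx.symm
  rw [← exy] at hlt hmono
  have hE1 : ∀ u ∈ L, ∀ v, v ∉ L → v ∉ S → G.Adj u v → u = x ∧ v = y := by
    intro u hu v hv hvS huv
    have := hE u hu v hv hvS huv
    rw [← exy, Sym2.eq_iff] at this
    exact this.resolve_right fun h => hv (h.2 ▸ hxL)
  set M : Set V := {v | v ∉ L ∧ v ∉ S} with hM
  have hE2 : ∀ u ∈ M, ∀ v, v ∉ M → v ∉ (S : Set V) → G.Adj u v → u = y ∧ v = x := by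
    intro u hu v hv hvS huv
    have hvL : v ∈ L := by by_contra h; exact hv ⟨h, hvS⟩
    exact (hE1 v hvL u hu.1 hu.2 huv.symm).symm
  have hBM : B ⊆ M ∪ S := by
    intro b hb
    by_cases h : b ∈ S
    · exact .inr h
    · exact .inl ⟨hB b hb, h⟩
  have hAM : ∀ a ∈ A, a ∉ M := fun a ha h => (hA ha).elim h.1 h.2
  have hN2 : NoSep G B A s := fun X hX => hN X fun S h h1 h2 => hX S h h2 h1
  obtain ⟨Q, q1, q2, q3⟩ := ih _ hlt A _ s (sep_aux hA hB hE1 hxL hyL hyS hN)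
  have n2 := sep_aux hBM hAM hE2 ⟨hyL, hyS⟩ (fun h => h.1 hxL) hxS hN2
  rw [Sym2.eq_swap] at n2
  obtain ⟨Q', q1', q2', q3'⟩ := ih _ hlt B _ s n2
  have hE3 : ∀ u ∈ L, u ≠ x → ∀ v, (G.deleteEdges {s(x, y)}).Adj u v → v ∈ L ∨ v ∈ (S : Set V) := by
    intro u hu hux v huv
    by_contra hc
    push Not at hc
    exact hux (hE1 u hu v hc.1 hc.2 (hlt.le huv)).1
  have hE4 : ∀ u ∈ M, u ≠ y → ∀ v, (G.deleteEdges {s(x, y)}).Adj u v → v ∈ M ∨ v ∈ (S : Set V) := by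
    intro u hu hux v huv
    by_contra hc
    push Not at hc
    exact hux (hE2 u hu v hc.1 hc.2 (hlt.le huv)).1
  choose C c1 c2 c3 z c4 c5 c6 using fun h => trim hA hE3 (q1 h) (q3 h).1 (q3 h).2
  choose C' c1' c2' c3' z' c4' c5' c6' using fun h => trim hBM hE4 (q1' h) (q3' h).1 (q3' h).2
  have d1 : ∀ h h', h ≠ h' → ∀ x ∈ C h, x ∉ C h' := fun h h' hne v hv hv' => q2 h h' hne v (c1 h hv) (c1 h' hv')
  have d2 : ∀ h h', h ≠ h' → ∀ x ∈ C' h, x ∉ C' h' := fun h h' hne v hv hv' => q2' h h' hne v (c1' h hv) (c1' h' hv')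
  have b2 := bij_end (T := insert y S) d2 c4' (fun h => by simpa using c5' h) (by have := Finset.card_insert_le y S; omega)
  have hσ : ∀ h, ∃ k, z' k = if z h = x then y else z h := fun h => b2 _ (by
    split_ifs with e
    · simp
    · exact Finset.mem_insert_of_mem ((c5 h).resolve_left e))
  choose σ hσ using hσ
  have zx : ∀ h, z h ≠ x → z h ∈ S := fun h e => (c5 h).resolve_left e
  have hσi : ∀ h h', h ≠ h' → σ h ≠ σ h' := by
    intro h h' hne e
    have h1 := hσ h
    rw [e, hσ h'] at h1
    have hz : z h = z h' := by
      split_ifs at h1 with e1 e2 e2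
      · rw [e1, e2]
      · exact absurd (h1 ▸ zx h e2) hyS
      · exact absurd (h1 ▸ zx h' e1) hyS
      · exact h1.symm
    exact d1 h h' hne _ (c4 h) (hz ▸ c4 h')
  have dd : ∀ h h', h ≠ h' → ∀ v ∈ C h, v ∉ C' (σ h') := by
    intro h h' hne v hv hv'
    have hvS : v ∈ S := by
      by_contra hvS
      have k1 : v ∈ L := by
        by_cases e : v = z h
        · rw [e]
          by_cases e2 : z h = x
          · rw [e2]; exact hxL
          · exact absurd (e ▸ zx h e2) hvS
        · exact (c6 h v hv e).1
      by_cases e : v = z' (σ h')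
      · rw [hσ] at e
        split_ifs at e with e2
        · exact hyL (e ▸ k1)
        · exact hvS (e ▸ zx _ e2)
      · exact (c6' _ v hv' e).1.1 k1
    have e1 : v = z h := by
      by_contra e
      exact (c6 h v hv e).2 (.inr hvS)
    have e2 : v = z' (σ h') := by
      by_contra e
      exact (c6' _ v hv' e).2 (.inr hvS)
    rw [hσ] at e2
    split_ifs at e2 with e3
    · exact hyS (e2 ▸ hvS)
    · exact d1 h h' hne v hv (e2 ▸ c4 h')
  refine ⟨fun h => C h ∪ C' (σ h), fun h => (hmono (c2 h)).union (hmono (c2' _)) ⟨z h, c4 h, z' (σ h), c4' _, ?_⟩, ?_, fun h => ⟨(c3 h).mono (by intro v hv; exact ⟨hv.1, .inl hv.2⟩), (c3' (σ h)).mono (by intro v hv; exact ⟨hv.1, .inr hv.2⟩)⟩⟩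
  · rw [hσ]
    split_ifs with e
    · exact .inr (e ▸ hyx.symm)
    · exact .inl rfl
  · rintro h h' hne v (hv | hv) (hv' | hv')
    · exact d1 h h' hne v hv hv'
    · exact dd h h' hne v hv hv'
    · exact dd h' h hne.symm v hv' hv
    · exact d2 _ _ (hσi h h' hne) v hv hv'

end menger
end Paper
namespace Paper

section ordered
variable {V : Type} {G Γ : SimpleGraph V}

theorem cut_aux {A B : Set V} {s : ℕ} {f : Fin s → ℕ → V} {n : Fin s → ℕ} (hf : ∀ h, IP Γ (f h) (n h))
    (hA : ∀ h, f h 0 ∈ A) (hB : ∀ h, f h (n h) ∈ B)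
    (hd : ∀ h h' i i', i ≤ n h → i' ≤ n h' → f h i = f h' i' → h = h') (h₁ : Fin s) (p : ℕ) (hp : p + 1 ≤ n h₁)
    (X : Finset V) (hX : X.card < s) (hsep : ∀ S, Conn (Γ.deleteEdges {s(f h₁ p, f h₁ (p+1))}) S →
      (A ∩ S).Nonempty → (B ∩ S).Nonempty → ∃ x ∈ X, x ∈ S) :
    ∃ L : Set V, (∀ u ∈ L, ∀ v, v ∉ X → (Γ.deleteEdges {s(f h₁ p, f h₁ (p+1))}).Adj u v → v ∈ L) ∧ (∀ i ≤ p, f h₁ i ∈ L) ∧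
      (∀ i, p + 1 ≤ i → i ≤ n h₁ → f h₁ i ∉ L) ∧ ∀ h i j, j ≤ i → i ≤ n h → f h i ∈ L → f h j ∈ L := by
  classical
  set Γ' := Γ.deleteEdges {s(f h₁ p, f h₁ (p+1))} with hΓ'
  have hst : ∀ h i, i < n h → (h ≠ h₁ ∨ i ≠ p) → Γ'.Adj (f h i) (f h (i+1)) := by
    intro h i hi hne
    rw [hΓ', SimpleGraph.deleteEdges_adj]
    refine ⟨(hf h i (i+1) (by omega) (by omega)).2.2 rfl, fun e => ?_⟩
    rw [Set.mem_singleton_iff, Sym2.eq_iff] at e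
    rcases e with ⟨e1, e2⟩ | ⟨e1, e2⟩
    · obtain rfl := hd _ _ _ _ (by omega) (by omega) e1
      have := (hf h).inj (by omega) (by omega) e1
      simp_all
    · obtain rfl := hd _ _ _ _ (by omega) (by omega) e1
      have := (hf h).inj (by omega) (by omega) e1
      have := (hf h).inj (by omega) (by omega) e2
      omega
  have hmeet : ∀ h, h ≠ h₁ → ∃ x ∈ X, x ∈ f h '' Iic (n h) := fun h hne =>
    hsep _ (Ch.conn (S := univ) ⟨fun _ _ => trivial, fun i hi => hst h i hi (.inl hne)⟩) ⟨_, hA h, 0, by simp, rfl⟩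
      ⟨_, hB h, n h, by simp, rfl⟩
  have huniq : ∀ x ∈ X, ∃ h, h ≠ h₁ ∧ x ∈ f h '' Iic (n h) ∧ ∀ x' ∈ X, x' ∈ f h '' Iic (n h) → x' = x := by
    intro x hx
    obtain ⟨h, hh, hm⟩ := exists_miss (Finset.univ.erase h₁) (fun h => f h '' Iic (n h)) (by
      rintro i - j - hij _ ⟨a, ha, rfl⟩ ⟨b, hb, e⟩
      exact hij (hd _ _ _ _ hb ha e).symm) (X.erase x) (by
        rw [Finset.card_erase_of_mem hx, Finset.card_erase_of_mem (Finset.mem_univ _)]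
        have := Finset.card_pos.2 ⟨x, hx⟩
        simp; omega)
    have hu : ∀ x' ∈ X, x' ∈ f h '' Iic (n h) → x' = x := fun x' hx' hx'' => by
      by_contra hne
      exact hm x' (Finset.mem_erase.2 ⟨hne, hx'⟩) hx''
    have hh := Finset.ne_of_mem_erase hh
    obtain ⟨x', k1, k2⟩ := hmeet h hh
    exact ⟨h, hh, hu x' k1 k2 ▸ k2, hu⟩
  let L : Set V := {v | ∃ a ∈ A, a ∉ X ∧ Reach Γ' {w | w ∉ X} a v}
  have hLX : ∀ v ∈ L, v ∉ X := by
    rintro v ⟨a, ha, haS, h⟩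
    exact comp_sub (S := {w | w ∉ X}) haS h
  have hstep : ∀ u ∈ L, ∀ v, v ∉ X → Γ'.Adj u v → v ∈ L := by
    rintro u ⟨a, ha, haS, h⟩ v hv huv
    exact ⟨a, ha, haS, comp_step h hv huv⟩
  have hLB : ∀ b ∈ B, b ∉ L := by
    rintro b hb ⟨a, ha, haS, h⟩
    obtain ⟨w, hw, hw'⟩ := hsep _ (comp_conn (S := {w | w ∉ X}) haS) ⟨a, ha, mem_comp_self⟩ ⟨b, hb, h⟩
    exact comp_sub (S := {w | w ∉ X}) haS hw' hw
  have hrun : ∀ h a b, f h a ∈ L → a ≤ b → b ≤ n h → (∀ i, a < i → i ≤ b → f h i ∉ X) → (h ≠ h₁ ∨ p < a ∨ b ≤ p) → f h b ∈ L := by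
    intro h a b ha hab
    induction b, hab using Nat.le_induction with
    | base => intros; exact ha
    | succ b hb ih =>
      intro hbn hx hor
      exact hstep _ (ih (by omega) (fun i h1 h2 => hx i h1 (by omega)) (by omega)) _ (hx _ (by omega) le_rfl) (hst h b (by omega) (by omega))
  have h0 : ∀ h, f h 0 ∉ X → f h 0 ∈ L := fun h hx => ⟨_, hA h, hx, mem_comp_self⟩
  have hX1 : ∀ i ≤ n h₁, f h₁ i ∉ X := by
    intro i hi hx
    obtain ⟨h, hne, ⟨j, hj, e⟩, -⟩ := huniq _ hx
    exact hne (hd _ _ _ _ hj hi e)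
  have c1 : ∀ i ≤ p, f h₁ i ∈ L := fun i hi => hrun h₁ 0 i (h0 _ (hX1 _ (by omega))) (by omega) (by omega)
    (fun j _ hj => hX1 j (by omega)) (.inr (.inr hi))
  have c2 : ∀ i, p + 1 ≤ i → i ≤ n h₁ → f h₁ i ∉ L := fun i h1 h2 h3 => hLB _ (hB h₁)
    (hrun h₁ i (n h₁) h3 h2 le_rfl (fun j _ hj => hX1 j (by omega)) (.inr (.inl h1)))
  refine ⟨L, hstep, c1, c2, fun h i j hji hi hiL => ?_⟩
  by_cases e : h = h₁
  · subst e
    exact c1 j (by by_contra hc; exact c2 i (by omega) hi hiL)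
  obtain ⟨_, hx, ξ, hξ, rfl⟩ := hmeet h e
  have hξ : ξ ≤ n h := hξ
  have hu : ∀ k ≤ n h, f h k ∈ X → k = ξ := by
    intro k hk hkX
    obtain ⟨h', _, ⟨m, hm, em⟩, hu⟩ := huniq _ hx
    obtain rfl := hd _ _ _ _ hm hξ em
    exact (hf h').inj hk hξ (hu _ hkX ⟨k, hk, rfl⟩)
  rcases lt_trichotomy i ξ with hlt | rfl | hlt
  · exact hrun h 0 j (h0 _ fun hc => by have := hu 0 (by omega) hc; omega) (by omega) (by omega)
      (fun k _ hk hc => by have := hu k (by omega) hc; omega) (.inl e)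
  · exact absurd hx (hLX _ hiL)
  · exact absurd (hrun h i (n h) hiL hi le_rfl (fun k _ hk hc => by have := hu k (by omega) hc; omega) (.inl e)) (hLB _ (hB h))

structure Ordd (G : SimpleGraph V) (r q : ℕ) (R : ℕ → Set V) (f : Fin q → ℕ → V) (N : Fin q → ℕ) : Prop where
  conn : ∀ t < r, Conn G (R t)
  disj : ∀ t < r, ∀ t' < r, t ≠ t' → ∀ x ∈ R t, x ∉ R t'
  step : ∀ h, ∀ i < N h, G.Adj (f h i) (f h (i+1))
  inj : ∀ h h' i i', i ≤ N h → i' ≤ N h' → f h i = f h' i' → h = h' ∧ i = i'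
  hit : ∀ t < r, ∀ h, ∃ i ≤ N h, f h i ∈ R t
  ord : ∀ t t', t < t' → t' < r → ∀ h i i', i ≤ N h → i' ≤ N h → f h i ∈ R t → f h i' ∈ R t' → i < i'

def Ord (G : SimpleGraph V) (r q : ℕ) : Prop := ∃ R f N, Ordd G r q R f N

theorem Ord.mono {G' : SimpleGraph V} {r q : ℕ} (hG : G ≤ G') (h : Ord G r q) : Ord G' r q := by
  obtain ⟨R, f, N, h⟩ := h
  exact ⟨R, f, N, { h with
    conn := fun t ht => (h.conn t ht).mono fun _ _ _ _ h => hG h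
    step := fun h' i hi => hG (h.step h' i hi) }⟩

open Classical in
theorem lemO [Finite V] {A B : Set V} {s : ℕ} (r : ℕ) {q : ℕ} (hq : 0 < q) {ι : Type} [Fintype ι] (R : ι → Set V) (hR : ∀ l, Conn G (R l))
    (hRd : ∀ l l', l ≠ l' → ∀ x ∈ R l, x ∉ R l') (hN : NoSep G A B s) :
    Ord G r q ∨ ∃ Q : Fin s → Set V, (∀ h, Conn G (Q h)) ∧ (∀ h h', h ≠ h' → ∀ x ∈ Q h, x ∉ Q h') ∧
      (∀ h, (A ∩ Q h).Nonempty ∧ (B ∩ Q h).Nonempty) ∧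
      (Finset.univ.filter fun l => q ≤ (Finset.univ.filter fun h => ∃ x ∈ Q h, x ∈ R l).card).card ≤ 2^s * (2*s*r) := by
  obtain ⟨Γ, ⟨hΓG, hΓR, hΓN⟩, hmin⟩ := (toFinite {Γ : SimpleGraph V | Γ ≤ G ∧ (∀ l, ∀ x ∈ R l, ∀ y ∈ R l, G.Adj x y → Γ.Adj x y) ∧
    NoSep Γ A B s}).exists_minimal ⟨G, le_rfl, fun _ _ _ _ _ h => h, hN⟩
  obtain ⟨Q, q1, q2, q3⟩ := menger Γ A B s hΓN
  choose f n hf hfQ hfA hfB using fun h => exists_ip_sets (q1 h).2 (q3 h).1 (q3 h).2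
  have hd : ∀ h h' i i', i ≤ n h → i' ≤ n h' → f h i = f h' i' → h = h' := by
    intro h h' i i' hi hi' e
    by_contra hne
    exact q2 h h' hne _ (hfQ h i hi) (e ▸ hfQ h' i' hi')
  refine or_iff_not_imp_right.2 fun hcon => ?_
  push Not at hcon
  have hbad := hcon (fun h => f h '' Iic (n h)) (fun h => (hf h).conn.mono fun _ _ _ _ h => hΓG h)
    (by rintro h h' hne _ ⟨i, hi, rfl⟩ ⟨j, hj, e⟩; exact hne (hd _ _ _ _ hj hi e).symm)
    (fun h => ⟨⟨_, (hfA h 0 (by omega)).2 rfl, 0, by simp, rfl⟩, ⟨_, (hfB h (n h) le_rfl).2 rfl, n h, by simp, rfl⟩⟩)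
  obtain ⟨H, -, hH⟩ := Finset.exists_lt_card_fiber_of_mul_lt_card_of_maps_to (t := Finset.univ)
    (f := fun l => Finset.univ.filter fun h => ∃ x ∈ f h '' Iic (n h), x ∈ R l) (n := 2*s*r) (fun _ _ => Finset.mem_univ _)
    (by rw [Finset.card_univ, Fintype.card_finset, Fintype.card_fin]; exact hbad)
  set I := Finset.filter (fun l => (Finset.univ.filter fun h => ∃ x ∈ f h '' Iic (n h), x ∈ R l) = H)
    (Finset.univ.filter fun l => q ≤ (Finset.univ.filter fun h => ∃ x ∈ f h '' Iic (n h), x ∈ R l).card) with hI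
  have hIH : ∀ l ∈ I, ∀ h ∈ H, ∃ i ≤ n h, f h i ∈ R l := by
    intro l hl h hh
    rw [← (Finset.mem_filter.1 hl).2] at hh
    obtain ⟨_, ⟨i, hi, rfl⟩, hx⟩ := (Finset.mem_filter.1 hh).2
    exact ⟨i, hi, hx⟩
  have hqH : q ≤ H.card := by
    obtain ⟨l, hl⟩ := Finset.card_pos.1 (Nat.zero_lt_of_lt hH)
    have := (Finset.mem_filter.1 hl).2
    have h2 := (Finset.mem_filter.1 (Finset.mem_filter.1 hl).1).2
    rwa [this] at h2
  obtain ⟨h₁, hh₁⟩ := Finset.card_pos.1 (hq.trans_le hqH)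
  have hs : 0 < s := h₁.pos
  have hφ : ∀ l, ∃ p, l ∈ I → p ≤ n h₁ ∧ f h₁ p ∈ R l ∧ ∀ p' < p, f h₁ p' ∉ R l := by
    intro l
    by_cases hl : l ∈ I
    · have hex := hIH l hl h₁ hh₁
      refine ⟨Nat.find hex, fun _ => ⟨(Nat.find_spec hex).1, (Nat.find_spec hex).2, fun p' hp' hc => ?_⟩⟩
      exact Nat.find_min hex hp' ⟨by have := (Nat.find_spec hex).1; omega, hc⟩
    · exact ⟨0, fun h => absurd h hl⟩
  choose φ hφ using hφ
  have hφi : ∀ l ∈ I, ∀ l' ∈ I, φ l = φ l' → l = l' := by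
    intro l hl l' hl' e
    by_contra hne
    exact hRd l l' hne _ (hφ l hl).2.1 (e ▸ (hφ l' hl').2.1)
  have hcut : ∀ l, ∃ X : Finset V, X.card < s ∧ (l ∈ I → 0 < φ l → ∀ m ∈ I, ∀ m' ∈ I, (∀ x ∈ X, x ∉ R m) → (∀ x ∈ X, x ∉ R m') →
      φ m < φ l → φ l ≤ φ m' → ∀ h i i', i ≤ n h → i' ≤ n h → f h i ∈ R m → f h i' ∈ R m' → i < i') := by
    intro l
    by_cases hl : l ∈ I ∧ 0 < φ l
    swap
    · exact ⟨∅, by simpa using hs, fun h h' => absurd ⟨h, h'⟩ hl⟩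
    obtain ⟨hl, hpos⟩ := hl
    obtain ⟨p, hp⟩ : ∃ p, φ l = p + 1 := ⟨φ l - 1, by omega⟩
    obtain ⟨k1, k2, k3⟩ := hφ l hl
    rw [hp] at k1 k2 k3
    have hadj : Γ.Adj (f h₁ p) (f h₁ (p+1)) := (hf h₁ p (p+1) (by omega) k1).2.2 rfl
    have hrow : ∀ m, ∀ x ∈ R m, ∀ y ∈ R m, G.Adj x y → (Γ.deleteEdges {s(f h₁ p, f h₁ (p+1))}).Adj x y := by
      intro m x hx y hy hxy
      rw [SimpleGraph.deleteEdges_adj]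
      refine ⟨hΓR m x hx y hy hxy, fun e => ?_⟩
      rw [Set.mem_singleton_iff, Sym2.eq_iff] at e
      have : f h₁ p ∈ R m ∧ f h₁ (p+1) ∈ R m := by
        rcases e with ⟨rfl, rfl⟩ | ⟨rfl, rfl⟩
        · exact ⟨hx, hy⟩
        · exact ⟨hy, hx⟩
      by_cases e2 : m = l
      · exact k3 p (by omega) (e2 ▸ this.1)
      · exact hRd m l e2 _ this.2 k2
    have hns : ¬ NoSep (Γ.deleteEdges {s(f h₁ p, f h₁ (p+1))}) A B s := by
      intro hc
      have := hmin (y := Γ.deleteEdges {s(f h₁ p, f h₁ (p+1))}) ⟨(SimpleGraph.deleteEdges_le _).trans hΓG, hrow, hc⟩ (SimpleGraph.deleteEdges_le _) hadj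
      rw [SimpleGraph.deleteEdges_adj] at this
      exact this.2 rfl
    unfold NoSep at hns
    push Not at hns
    obtain ⟨X, hX, hXs⟩ := hns
    obtain ⟨L, l1, l2, l3, l4⟩ := cut_aux hf (fun h => (hfA h 0 (by omega)).2 rfl) (fun h => (hfB h (n h) le_rfl).2 rfl) hd h₁ p k1 X hXs hX
    have hside : ∀ m, (∀ x ∈ X, x ∉ R m) → ∀ x ∈ R m, x ∈ L → R m ⊆ L := fun m hm x hx hxL =>
      (hR m).2 L ⟨x, hx, hxL⟩ fun u hu huL v hv huv => l1 u huL v (fun hc => hm v hc hv) (hrow m u hu v hv huv)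
    refine ⟨X, hXs, fun _ _ m hm m' hm' hmX hmX' h1 h2 h i i' hi hi' hfi hfi' => ?_⟩
    by_contra hc
    have e1 := hside m hmX _ (hφ m hm).2.1 (l2 _ (by omega)) hfi
    have e2 := l4 h i i' (by omega) hi e1
    exact l3 _ (by omega) (hφ m' hm').1 (hside m' hmX' _ hfi' e2 (hφ m' hm').2.1)
  choose X hXs hX using hcut
  obtain ⟨ρ, hρI, hρ⟩ : ∃ ρ : ℕ → ι, (∀ k < 2*s*r, ρ k ∈ I) ∧ ∀ k k', k < k' → k' < 2*s*r → φ (ρ k) < φ (ρ k') := by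
    have hc : (I.image φ).card = I.card := Finset.card_image_of_injOn fun l hl l' hl' e => hφi l hl l' hl' e
    have hk : ∀ k : ℕ, ∃ l, (hk : k < I.card) → l ∈ I ∧ φ l = (I.image φ).orderEmbOfFin hc ⟨k, hk⟩ := by
      intro k
      by_cases hk : k < I.card
      · obtain ⟨l, hl, e⟩ := Finset.mem_image.1 ((I.image φ).orderEmbOfFin_mem hc ⟨k, hk⟩)
        exact ⟨l, fun _ => ⟨hl, e⟩⟩
      · obtain ⟨l, hl⟩ := Finset.card_pos.1 (Nat.zero_lt_of_lt hH)
        exact ⟨l, fun h => absurd h hk⟩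
    choose ρ hρ using hk
    refine ⟨ρ, fun k hk => (hρ k (by omega)).1, fun k k' h1 h2 => ?_⟩
    rw [(hρ k (by omega)).2, (hρ k' (by omega)).2]
    exact ((I.image φ).orderEmbOfFin hc).strictMono h1
  have hblk : ∀ t, ∃ k, t < r → 2*s*t ≤ k ∧ k < 2*s*(t+1) ∧ (∀ x ∈ X (ρ (2*s*t)), x ∉ R (ρ k)) ∧ ∀ x ∈ X (ρ (2*s*(t+1))), x ∉ R (ρ k) := by
    intro t
    by_cases ht : t < r
    swap
    · exact ⟨0, fun h => absurd h ht⟩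
    have hle : 2*s*(t+1) ≤ 2*s*r := Nat.mul_le_mul_left _ ht
    have hms : 2*s*(t+1) = 2*s*t + 2*s := by ring
    obtain ⟨k, hk, hk'⟩ := exists_miss (Finset.Ico (2*s*t) (2*s*(t+1))) (fun k => R (ρ k)) (by
      intro i hi j hj hij
      rw [Finset.mem_Ico] at hi hj
      refine hRd _ _ fun e => ?_
      rcases lt_or_gt_of_ne hij with h | h
      · have := hρ i j h (by omega); rw [e] at this; omega
      · have := hρ j i h (by omega); rw [e] at this; omega) (X (ρ (2*s*t)) ∪ X (ρ (2*s*(t+1)))) (by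
        have := Finset.card_union_le (X (ρ (2*s*t))) (X (ρ (2*s*(t+1))))
        have := hXs (ρ (2*s*t)); have := hXs (ρ (2*s*(t+1)))
        rw [Nat.card_Ico]; omega)
    rw [Finset.mem_Ico] at hk
    exact ⟨k, fun _ => ⟨hk.1, hk.2, fun x hx => hk' x (Finset.mem_union_left _ hx), fun x hx => hk' x (Finset.mem_union_right _ hx)⟩⟩
  choose κ hκ using hblk
  have hκI : ∀ t < r, ρ (κ t) ∈ I := fun t ht => hρI _ (((hκ t ht).2.1).trans_le (Nat.mul_le_mul_left _ ht))
  obtain ⟨e⟩ : Nonempty (Fin q ↪ H) := by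
    rw [Function.Embedding.nonempty_iff_card_le, Fintype.card_coe]; simpa using hqH
  have hord1 : ∀ t, t + 1 < r → ∀ h i i', i ≤ n h → i' ≤ n h → f h i ∈ R (ρ (κ t)) → f h i' ∈ R (ρ (κ (t+1))) → i < i' := by
    intro t ht
    obtain ⟨a1, a2, a3, a4⟩ := hκ t (by omega)
    obtain ⟨b1, b2, b3, b4⟩ := hκ (t+1) ht
    have hle : 2*s*(t+1+1) ≤ 2*s*r := Nat.mul_le_mul_left _ ht
    have hlt := hρ (κ t) (2*s*(t+1)) a2 (by omega)
    refine hX (ρ (2*s*(t+1))) (hρI _ (by omega)) (by omega) _ (hκI t (by omega)) _ (hκI _ ht) a4 b3 hlt ?_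
    rcases b1.eq_or_lt with e | e
    · rw [← e]
    · exact (hρ _ _ e (by omega)).le
  have hord : ∀ d t, t + d + 1 < r → ∀ h ∈ H, ∀ i i', i ≤ n h → i' ≤ n h → f h i ∈ R (ρ (κ t)) → f h i' ∈ R (ρ (κ (t+d+1))) → i < i' := by
    intro d
    induction d with
    | zero => exact fun t ht h _ => hord1 t ht h
    | succ d ih =>
      intro t ht h hh i i' hi hi' h1 h2
      obtain ⟨j, hj, hj'⟩ := hIH _ (hκI (t+d+1) (by omega)) h hh
      exact (ih t (by omega) h hh i j hi hj h1 hj').trans (hord1 (t+d+1) (by omega) h j i' hj hi' hj' h2)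
  have hord' : ∀ t t', t < t' → t' < r → ∀ h ∈ H, ∀ i i', i ≤ n h → i' ≤ n h → f h i ∈ R (ρ (κ t)) → f h i' ∈ R (ρ (κ t')) → i < i' := by
    intro t t' h h'
    obtain ⟨d, rfl⟩ := Nat.exists_eq_add_of_lt h
    exact hord d t h'
  refine ⟨fun t => R (ρ (κ t)), fun h => f (e h), fun h => n (e h), fun t _ => hR _, ?_, ?_, ?_, fun t ht h => hIH _ (hκI t ht) _ (e h).2,
    fun t t' h h' k => hord' t t' h h' _ (e k).2⟩
  · intro t ht t' ht' hne x hx hx'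
    by_cases e' : ρ (κ t) = ρ (κ t')
    · obtain ⟨i, hi, hi'⟩ := hIH _ (hκI t ht) h₁ hh₁
      rcases lt_or_gt_of_ne hne with h | h
      · exact lt_irrefl _ (hord' t t' h ht' h₁ hh₁ i i hi hi hi' (e' ▸ hi'))
      · exact lt_irrefl _ (hord' t' t h ht h₁ hh₁ i i hi hi (e' ▸ hi') hi')
    · exact hRd _ _ e' x hx hx'
  · exact fun h i hi => hΓG ((hf _ i (i+1) (by omega) (by omega)).2.2 rfl)
  · intro h h' i i' hi hi' e'
    have := e.injective (Subtype.ext (hd _ _ _ _ hi hi' e'))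
    subst this
    exact ⟨rfl, (hf _).inj hi hi' e'⟩

end ordered
end Paper
namespace Paper

section kmodel
variable {V : Type} {G : SimpleGraph V}

def rst (G : SimpleGraph V) (W : Set V) : SimpleGraph V where
  Adj u v := G.Adj u v ∧ u ∈ W ∧ v ∈ W
  symm := ⟨fun _ _ h => ⟨h.1.symm, h.2.2, h.2.1⟩⟩
  loopless := ⟨fun _ h => h.1.ne rfl⟩

theorem Conn.rst_sub {S W : Set V} (h : Conn (rst G W) S) (h' : (W ∩ S).Nonempty) : S ⊆ W :=
  h.2 W ⟨_, h'.some_mem.2, h'.some_mem.1⟩ fun _ _ _ _ _ h => h.2.2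

theorem Conn.rst {S W : Set V} (h : Conn G S) (h' : S ⊆ W) : Conn (rst G W) S :=
  h.mono fun _ ha _ hb hab => ⟨hab, h' ha, h' hb⟩

theorem Lk.of {κ : Type*} {A B : Set V} (K : Finset κ) (Q : κ → Set V) {s : ℕ} (hs : s ≤ K.card) (h1 : ∀ h ∈ K, Conn G (Q h))
    (h2 : ∀ h ∈ K, ∀ h' ∈ K, h ≠ h' → ∀ x ∈ Q h, x ∉ Q h') (h3 : ∀ h ∈ K, (A ∩ Q h).Nonempty ∧ (B ∩ Q h).Nonempty) : Lk G A B s := by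
  obtain ⟨e⟩ : Nonempty (Fin s ↪ K) := by
    rw [Function.Embedding.nonempty_iff_card_le, Fintype.card_coe]; simpa using hs
  exact ⟨fun h => Q (e h), fun h => h1 _ (e h).2, fun h h' hne => h2 _ (e h).2 _ (e h').2 fun c => hne (e.injective (Subtype.ext c)),
    fun h => h3 _ (e h).2⟩

open Classical in
theorem lemL (r : ℕ) {q : ℕ} (hq : 0 < q) : ∀ L : ℕ, ∃ S : ℕ, ∀ (V : Type) [Finite V] (G : SimpleGraph V) (ι : Type) (J : Finset ι)
    (A B : ι → Set V), J.card ≤ L → (∀ i ∈ J, Lk G (A i) (B i) S) → Ord G r q ∨ ∃ D : ι → Set V,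
      (∀ i ∈ J, Conn G (D i) ∧ (A i ∩ D i).Nonempty ∧ (B i ∩ D i).Nonempty) ∧ ∀ i ∈ J, ∀ j ∈ J, i ≠ j → ∀ x ∈ D i, x ∉ D j := by
  intro L
  induction L with
  | zero =>
    refine ⟨0, fun V _ G ι J A B hJ _ => .inr ⟨fun _ => ∅, ?_⟩⟩
    have : J = ∅ := by simpa using hJ
    subst this
    simp
  | succ L ih =>
    obtain ⟨S, hS⟩ := ih
    refine ⟨S + q + L * (2^(S+q) * (2*(S+q)*r)) + 1, fun V _ G ι J A B hJ hL => ?_⟩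
    by_cases hJe : J = ∅
    · exact .inr ⟨fun _ => ∅, by simp [hJe]⟩
    obtain ⟨i₀, hi₀⟩ := Finset.nonempty_iff_ne_empty.2 hJe
    obtain ⟨R, r1, r2, r3⟩ := hL i₀ hi₀
    refine or_iff_not_imp_left.2 fun hO => ?_
    have hQ : ∀ i, ∃ Q : Fin (S+q) → Set V, i ∈ J → (∀ h, Conn G (Q h)) ∧ (∀ h h', h ≠ h' → ∀ x ∈ Q h, x ∉ Q h') ∧
      (∀ h, (A i ∩ Q h).Nonempty ∧ (B i ∩ Q h).Nonempty) ∧ (Finset.univ.filter fun l => q ≤ (Finset.univ.filter fun h => ∃ x ∈ Q h, x ∈ R l).card).card ≤ 2^(S+q) * (2*(S+q)*r) := by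
      intro i
      by_cases hi : i ∈ J
      · obtain ⟨Q, hQ⟩ := (lemO r hq R r1 r2 (s := S + q) (A := A i) (B := B i) fun X hX => by have := (hL i hi).noSep X hX; omega).resolve_left hO
        exact ⟨Q, fun _ => hQ⟩
      · exact ⟨fun _ => ∅, fun h => absurd h hi⟩
    choose Q hQ using hQ
    obtain ⟨l, hl⟩ : ∃ l, ∀ i ∈ J.erase i₀, (Finset.univ.filter fun h => ∃ x ∈ Q i h, x ∈ R l).card < q := by
      by_contra hc
      push Not at hc
      have h1 : (Finset.univ : Finset (Fin _)) ⊆ (J.erase i₀).biUnion fun i => Finset.univ.filter fun l => q ≤ (Finset.univ.filter fun h => ∃ x ∈ Q i h, x ∈ R l).card := by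
        intro l _
        obtain ⟨i, hi, h⟩ := hc l
        exact Finset.mem_biUnion.2 ⟨i, hi, by simpa using h⟩
      have h2 := (Finset.card_le_card h1).trans (Finset.card_biUnion_le_card_mul _ _ _ fun i hi => (hQ i (Finset.mem_of_mem_erase hi)).2.2.2)
      have h3 : (J.erase i₀).card ≤ L := by rw [Finset.card_erase_of_mem hi₀]; omega
      have h4 := Nat.mul_le_mul_right (2^(S+q) * (2*(S+q)*r)) h3
      rw [Finset.card_univ, Fintype.card_fin] at h2
      omega
    obtain hO' | ⟨D, d1, d2⟩ := hS V (rst G (R l)ᶜ) ι (J.erase i₀) (fun i => A i ∩ (R l)ᶜ) (fun i => B i ∩ (R l)ᶜ)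
      (by rw [Finset.card_erase_of_mem hi₀]; omega) (by
        intro i hi
        obtain ⟨k1, k2, k3, k4⟩ := hQ i (Finset.mem_of_mem_erase hi)
        have hsub : ∀ h ∈ (Finset.univ.filter fun h => ∃ x ∈ Q i h, x ∈ R l)ᶜ, Q i h ⊆ (R l)ᶜ := by
          intro h hh x hx hx'
          simp only [Finset.mem_compl, Finset.mem_filter, Finset.mem_univ, true_and] at hh
          exact hh ⟨x, hx, hx'⟩
        refine Lk.of (Finset.univ.filter fun h => ∃ x ∈ Q i h, x ∈ R l)ᶜ (Q i) ?_ (fun h hh => (k1 h).rst (hsub h hh)) (fun h _ h' _ => k2 h h')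
          (fun h hh => ⟨(k3 h).1.mono fun x hx => ⟨⟨hx.1, hsub h hh hx.2⟩, hx.2⟩, (k3 h).2.mono fun x hx => ⟨⟨hx.1, hsub h hh hx.2⟩, hx.2⟩⟩)
        have := hl i hi
        rw [Finset.card_compl, Fintype.card_fin]
        omega)
    · exact absurd (Ord.mono (G' := G) (show rst G (R l)ᶜ ≤ G from fun _ _ h => h.1) hO') hO
    have dsub : ∀ i ∈ J.erase i₀, D i ⊆ (R l)ᶜ := fun i hi => (d1 i hi).1.rst_sub ((d1 i hi).2.1.mono fun x hx => ⟨hx.1.2, hx.2⟩)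
    refine ⟨fun i => if i = i₀ then R l else D i, fun i hi => ?_, fun i hi j hj hij x => ?_⟩
    · dsimp only
      split_ifs with e
      · exact e ▸ ⟨r1 l, r3 l⟩
      · obtain ⟨e1, e2, e3⟩ := d1 i (Finset.mem_erase.2 ⟨e, hi⟩)
        exact ⟨e1.mono fun _ _ _ _ h => h.1, e2.mono fun x hx => ⟨hx.1.1, hx.2⟩, e3.mono fun x hx => ⟨hx.1.1, hx.2⟩⟩
    · dsimp only
      split_ifs with e e' e'
      · exact absurd (e.trans e'.symm) hij
      · exact fun hx hx' => dsub j (Finset.mem_erase.2 ⟨e', hj⟩) hx' hx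
      · exact fun hx hx' => dsub i (Finset.mem_erase.2 ⟨e, hi⟩) hx hx'
      · exact d2 i (Finset.mem_erase.2 ⟨e, hi⟩) j (Finset.mem_erase.2 ⟨e', hj⟩) hij x

theorem conn_leaf [Finite V] {P : Set V} (hP : Conn G P) : ∃ v ∈ P, P = {v} ∨ Conn G (P \ {v}) := by
  obtain ⟨v, hv⟩ := hP.1
  by_cases hs : P = {v}
  · exact ⟨v, hv, .inl hs⟩
  obtain ⟨C, ⟨c1, c2, c3⟩, hmax⟩ := (toFinite {C : Set V | Conn G C ∧ C ⊆ P ∧ C ≠ P}).exists_maximal ⟨{v}, Conn.single v, by simpa using hv, fun e => hs e.symm⟩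
  obtain ⟨w, hw⟩ := c1.1
  obtain ⟨κ, hκ, hκC, d, hd, hκd⟩ := hP.exists_nb (S := C) ⟨w, c2 hw, hw⟩ fun h => c3 (c2.antisymm h)
  refine ⟨κ, hκ, .inr ?_⟩
  have : insert κ C = P := by
    by_contra hne
    exact hκC (hmax (y := insert κ C) ⟨c1.insert hd hκd, by rw [Set.insert_subset_iff]; exact ⟨hκ, c2⟩, hne⟩ (Set.subset_insert _ _) (Set.mem_insert _ _))
  rw [← this, Set.insert_sdiff_self_of_notMem hκC]
  exact c1

theorem segs [Finite V] {s : ℕ} (hs : 0 < s) : ∀ (n : ℕ) (𝓑 : Set (Set V)), Br G (n * s) 𝓑 → ∃ (P : ℕ → Set V) (𝓒 : ℕ → Set (Set V)),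
    (∀ i < n, Conn G (P i) ∧ P i ⊆ ⋃₀ 𝓑 ∧ 𝓒 i ⊆ 𝓑 ∧ (∀ c ∈ 𝓒 i, (P i ∩ c).Nonempty) ∧
      ∀ X : Finset V, X.card < s → ∃ c ∈ 𝓒 i, ∀ x ∈ X, x ∉ c) ∧ ∀ i < n, ∀ j < n, i ≠ j → ∀ x ∈ P i, x ∉ P j := by
  classical
  intro n
  induction n with
  | zero => exact fun 𝓑 _ => ⟨fun _ => ∅, fun _ => ∅, by simp⟩
  | succ n ih =>
    intro 𝓑 hB
    rw [Nat.succ_mul] at hB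
    obtain ⟨b₀, hb₀, -⟩ := hB.ord ∅ (by simp; omega)
    have hU : Conn G (⋃₀ 𝓑) := by
      have := (hB.conn b₀ hb₀).iUnion (F := fun i : 𝓑 => i.1) (fun i => hB.conn _ i.2) fun i => hB.touch _ hb₀ _ i.2
      rwa [← Set.sUnion_eq_iUnion, Set.union_eq_self_of_subset_left (Set.subset_sUnion_of_mem hb₀)] at this
    obtain ⟨P, ⟨p1, p2, p3⟩, hmin⟩ := (toFinite {P : Set V | Conn G P ∧ P ⊆ ⋃₀ 𝓑 ∧
      ∀ X : Finset V, X.card < s → ∃ b ∈ 𝓑, (P ∩ b).Nonempty ∧ ∀ x ∈ X, x ∉ b}).exists_minimal ⟨_, hU, Subset.rfl, fun X hX => by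
        obtain ⟨b, hb, hb'⟩ := hB.ord X (by omega)
        obtain ⟨x, hx⟩ := (hB.conn b hb).1
        exact ⟨b, hb, ⟨x, ⟨b, hb, hx⟩, hx⟩, hb'⟩⟩
    obtain ⟨v, hv, hvP⟩ := conn_leaf p1
    have hY : ∃ Y : Finset V, Y.card < s ∧ ∀ b ∈ 𝓑, (∀ x ∈ Y, x ∉ b) → v ∉ b → ∀ x ∈ P, x ∉ b := by
      rcases hvP with rfl | hc
      · exact ⟨∅, by simpa using hs, fun b _ _ h x hx => by obtain rfl := hx; exact h⟩
      · by_contra hcon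
        push Not at hcon
        exact (hmin (y := P \ {v}) ⟨hc, Set.sdiff_subset.trans p2, fun X hX => by
          obtain ⟨b, h1, h2, h3, x, h4, h5⟩ := hcon X hX
          exact ⟨b, h1, ⟨x, ⟨h4, fun e => h3 (e ▸ h5)⟩, h5⟩, h2⟩⟩ Set.sdiff_subset hv).2 rfl
    obtain ⟨Y, hYs, hY⟩ := hY
    obtain ⟨P', 𝓒, h1, h2⟩ := ih {b ∈ 𝓑 | ∀ x ∈ P, x ∉ b} ⟨fun b hb => hB.conn b hb.1, fun b hb b' hb' => hB.touch b hb.1 b' hb'.1, fun X hX => by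
      obtain ⟨b, hb, hb'⟩ := hB.ord (X ∪ insert v Y) (by
        have := Finset.card_union_le X (insert v Y)
        have := Finset.card_insert_le v Y
        omega)
      exact ⟨b, ⟨hb, hY b hb (fun x hx => hb' x (by simp [hx])) (hb' v (by simp))⟩, fun x hx => hb' x (by simp [hx])⟩⟩
    have hPP : ∀ i < n, ∀ x ∈ P' i, x ∉ P := by
      intro i hi x hx hxP
      obtain ⟨b, hb, hxb⟩ := (h1 i hi).2.1 hx
      exact hb.2 x hxP hxb
    refine ⟨fun i => if i < n then P' i else P, fun i => if i < n then 𝓒 i else {b ∈ 𝓑 | (P ∩ b).Nonempty}, fun i hi => ?_, fun i hi j hj hij => ?_⟩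
    · dsimp only
      split_ifs with h
      · obtain ⟨a1, a2, a3, a4⟩ := h1 i h
        exact ⟨a1, a2.trans (Set.sUnion_subset_sUnion fun b hb => hb.1), fun b hb => (a3 hb).1, a4⟩
      · refine ⟨p1, p2, fun b hb => hb.1, fun c hc => hc.2, fun X hX => ?_⟩
        obtain ⟨b, h1, h2, h3⟩ := p3 X hX
        exact ⟨b, ⟨h1, h2⟩, h3⟩
    · dsimp only
      split_ifs with h h' h'
      · exact h2 i h j h' hij
      · exact hPP i h
      · exact fun x hx hx' => hPP j h' x hx' hx
      · omega

open Classical in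
theorem select {W : Type} [Fintype W] {D n : ℕ} (hn : Fintype.card W ^ 3 * D < n) (Bad : Fin n → Fin n → Finset (Fin n))
    (hB : ∀ a b, (Bad a b).card ≤ D) : ∃ x : W → Fin n, ∀ i j l, l ≠ i → l ≠ j → x l ∉ Bad (x i) (x j) := by
  by_contra hc
  push Not at hc
  have key : ∀ T : W × W × W, (Finset.univ.filter fun x : W → Fin n => T.2.2 ≠ T.1 ∧ T.2.2 ≠ T.2.1 ∧ x T.2.2 ∈ Bad (x T.1) (x T.2.1)).card * n ≤ D * n ^ Fintype.card W := by
    rintro ⟨i, j, l⟩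
    set F := Finset.univ.filter fun x : W → Fin n => l ≠ i ∧ l ≠ j ∧ x l ∈ Bad (x i) (x j)
    have h1 := Finset.card_le_mul_card_image (f := fun p : (W → Fin n) × Fin n => Function.update p.1 l p.2) (F ×ˢ Finset.univ) D (by
      intro y _
      refine (Finset.card_le_card_of_injOn (t := Bad (y i) (y j)) (fun p => p.1 l) ?_ ?_).trans (hB _ _)
      · rintro ⟨x, v⟩ hp
        simp only [F, Finset.coe_filter, Finset.mem_product, Finset.mem_filter, Finset.mem_univ, true_and, and_true, Set.mem_ofPred_eq] at hp
        obtain ⟨⟨h1, h2, h3⟩, rfl⟩ := hp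
        simpa [Function.update_of_ne h1.symm, Function.update_of_ne h2.symm] using h3
      · rintro ⟨x, v⟩ hp ⟨x', v'⟩ hp' e
        simp only [Finset.coe_filter, Set.mem_ofPred_eq] at hp hp' e
        have h := hp.2.trans hp'.2.symm
        have h2 := congrFun h l
        simp only [Function.update_self] at h2
        refine Prod.ext (funext fun k => ?_) h2
        by_cases ek : k = l
        · rw [ek]; exact e
        · have := congrFun h k
          simpa [Function.update_of_ne ek] using this)
    have h2 := Finset.card_le_univ ((F ×ˢ Finset.univ).image fun p : (W → Fin n) × Fin n => Function.update p.1 l p.2)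
    rw [Finset.card_product, Finset.card_univ, Fintype.card_fin] at h1
    rw [Fintype.card_fun, Fintype.card_fin] at h2
    exact h1.trans (Nat.mul_le_mul_left _ h2)
  have h1 : (Finset.univ : Finset (W → Fin n)) ⊆ (Finset.univ : Finset (W × W × W)).biUnion fun T => (Finset.univ.filter fun x : W → Fin n => T.2.2 ≠ T.1 ∧ T.2.2 ≠ T.2.1 ∧ x T.2.2 ∈ Bad (x T.1) (x T.2.1)) := by
    intro x _
    obtain ⟨i, j, l, h⟩ := hc x
    exact Finset.mem_biUnion.2 ⟨(i, j, l), Finset.mem_univ _, by simpa using h⟩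
  have h2 := (Finset.card_le_card h1).trans Finset.card_biUnion_le
  have h3 := Nat.mul_le_mul_right n h2
  rw [Finset.sum_mul, Finset.card_univ, Fintype.card_fun, Fintype.card_fin] at h3
  have h4 := h3.trans (Finset.sum_le_card_nsmul _ _ _ fun T _ => key T)
  rw [Finset.card_univ, Fintype.card_prod, Fintype.card_prod, smul_eq_mul] at h4
  have hpos : 0 < n ^ Fintype.card W := by have : 0 < n := by omega
                                           positivity
  have : n ^ Fintype.card W * n ≤ n ^ Fintype.card W * (Fintype.card W ^ 3 * D) := by
    refine h4.trans_eq ?_; ring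
  have := Nat.le_of_mul_le_mul_left this hpos
  omega

end kmodel
end Paper
namespace Paper

section kmodel2
variable {V : Type} {G : SimpleGraph V}

theorem inner_path {P P' Q : Set V} (hQ : Conn G Q) (h1 : (P ∩ Q).Nonempty) (h2 : (P' ∩ Q).Nonempty)
    (hd : ∀ x ∈ P, x ∉ P') (hn : ∀ x ∈ P, ∀ y ∈ P', ¬ G.Adj x y) :
    ∃ D ⊆ Q, Conn G D ∧ (∀ x ∈ D, x ∉ P ∧ x ∉ P') ∧ (∃ x ∈ D, ∃ y ∈ P, G.Adj x y) ∧ ∃ x ∈ D, ∃ y ∈ P', G.Adj x y := by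
  obtain ⟨f, n, f1, f2, f3, f4⟩ := exists_ip_sets hQ.2 h1 h2
  have a0 := (f3 0 (by omega)).2 rfl
  have an := (f4 n le_rfl).2 rfl
  have n2 : 2 ≤ n := by
    by_contra hc
    obtain rfl | rfl : n = 0 ∨ n = 1 := by omega
    · exact hd _ a0 an
    · exact hn _ a0 _ an ((f1 0 1 (by omega) le_rfl).2.2 rfl)
  refine ⟨(fun k => f (1 + k)) '' Iic (n-2), ?_, (f1.sub (i := 1) (m := n-2) (by omega)).conn, ?_, ⟨f 1, ⟨0, by simp, rfl⟩, f 0, a0, ((f1 0 1 (by omega) (by omega)).2.2 rfl).symm⟩,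
    f (n-1), ⟨n-2, by simp, by dsimp only; congr 1; omega⟩, f n, an, (f1 (n-1) n (by omega) (by omega)).2.2 (by omega)⟩
  · rintro _ ⟨k, hk, rfl⟩
    rw [mem_Iic] at hk
    exact f2 _ (by omega)
  · rintro _ ⟨k, hk, rfl⟩
    rw [mem_Iic] at hk
    dsimp only
    rw [f3 _ (by omega), f4 _ (by omega)]
    omega

open Classical in
theorem kmodel (W : Type) [Fintype W] (r : ℕ) {q : ℕ} (hq : 0 < q) : ∃ N : ℕ, ∀ (V : Type) [Finite V] (G : SimpleGraph V),
    (∃ 𝓑, Br G N 𝓑) → Ord G r q ∨ ∃ B : W → Set V, Mod G ⊤ B := by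
  obtain ⟨S, hS⟩ := lemL r hq (Fintype.card (W × W))
  set s := S + Fintype.card W * q + 1 with hs
  set D := 2^s * (2*s*r)
  set n := Fintype.card W ^ 3 * (D+1) + 1
  refine ⟨n * s, fun V _ G ⟨𝓑, hb⟩ => or_iff_not_imp_left.2 fun hO => ?_⟩
  obtain ⟨P, 𝓒, hP, hPd⟩ := segs (by omega) n 𝓑 hb
  have hsep : ∀ a b : Fin n, NoSep G (P a) (P b) s := by
    intro a b X hX
    by_contra hc
    obtain ⟨-, -, a1, a2, a3⟩ := hP a a.2
    obtain ⟨-, -, b1, b2, b3⟩ := hP b b.2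
    obtain ⟨c, hc1, hc2⟩ := a3 X (by omega)
    obtain ⟨d, hd1, hd2⟩ := b3 X (by omega)
    obtain ⟨x, hx, hx'⟩ := hX (c ∪ d) ((hb.conn c (a1 hc1)).union (hb.conn d (b1 hd1)) (hb.touch c (a1 hc1) d (b1 hd1)))
      ((a2 c hc1).mono fun x hx => ⟨hx.1, .inl hx.2⟩) ((b2 d hd1).mono fun x hx => ⟨hx.1, .inr hx.2⟩)
    exact hx'.elim (hc2 x hx) (hd2 x hx)
  have hQ := fun a b : Fin n => (lemO r hq (fun l : Fin n => P l) (fun l => (hP l l.2).1)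
    (fun l l' hl => hPd l l.2 l' l'.2 fun e => hl (Fin.ext e)) (hsep a b)).resolve_left hO
  choose Q q1 q2 q3 q4 using hQ
  obtain ⟨x, hx⟩ := select (W := W) (D := D+1) (n := n) (Nat.lt_succ_self _) (fun a b => insert a (Finset.univ.filter fun l : Fin n => q ≤ (Finset.univ.filter fun h => ∃ y ∈ Q a b h, y ∈ P l).card))
    (fun a b => (Finset.card_insert_le _ _).trans (by have := q4 a b; omega))
  have hxd : ∀ i j, i ≠ j → ∀ y ∈ P (x i), y ∉ P (x j) := fun i j hij =>
    hPd _ (x i).2 _ (x j).2 fun e => hx j j i hij hij (by rw [Fin.ext e]; exact Finset.mem_insert_self _ _)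
  set Core : Set V := {v | ∀ i, v ∉ P (x i)} with hCore
  set A : W × W → Set V := fun p => {v | v ∈ Core ∧ ∃ u ∈ P (x p.1), G.Adj v u} with hA
  set J : Finset (W × W) := Finset.univ.filter fun p => p.1 ≠ p.2 ∧ ∀ u ∈ P (x p.1), ∀ v ∈ P (x p.2), ¬ G.Adj u v with hJ
  have hlk : ∀ p ∈ J, Lk (rst G Core) (A p) (A p.swap) S := by
    rintro ⟨i, j⟩ hp
    simp only [hJ, Finset.mem_filter, Finset.mem_univ, true_and] at hp
    obtain ⟨hij, hne⟩ := hp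
    set K : Finset (Fin s) := Finset.univ.filter fun h => ∀ l, l ≠ i → l ≠ j → ∀ y ∈ Q (x i) (x j) h, y ∉ P (x l) with hK
    have hKc : Kᶜ.card ≤ Fintype.card W * q := by
      have h1 : Kᶜ ⊆ (Finset.univ.filter fun l => l ≠ i ∧ l ≠ j).biUnion fun l => Finset.univ.filter fun h => ∃ y ∈ Q (x i) (x j) h, y ∈ P (x l) := by
        intro h hh
        simp only [hK, Finset.mem_compl, Finset.mem_filter, Finset.mem_univ, true_and] at hh
        push Not at hh
        obtain ⟨l, l1, l2, y, y1, y2⟩ := hh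
        exact Finset.mem_biUnion.2 ⟨l, by simp [l1, l2], by simpa using ⟨y, y1, y2⟩⟩
      refine (Finset.card_le_card h1).trans ((Finset.card_biUnion_le_card_mul _ _ q fun l hl => ?_).trans (Nat.mul_le_mul_right _ (Finset.card_le_univ _)))
      simp only [Finset.mem_filter, Finset.mem_univ, true_and] at hl
      have := hx i j l hl.1 hl.2
      simp only [Finset.mem_insert, Finset.mem_filter, Finset.mem_univ, true_and, not_or, not_le] at this
      exact this.2.le
    rw [Finset.card_compl, Fintype.card_fin] at hKc
    have hin := fun h => inner_path (q1 (x i) (x j) h) (q3 (x i) (x j) h).1 (q3 (x i) (x j) h).2 (hxd i j hij) hne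
    choose E e1 e2 e3 e4 e5 using hin
    have eC : ∀ h ∈ K, E h ⊆ Core := by
      intro h hh y hy l hl
      simp only [hK, Finset.mem_filter, Finset.mem_univ, true_and] at hh
      by_cases l1 : l = i
      · exact (e3 h y hy).1 (l1 ▸ hl)
      by_cases l2 : l = j
      · exact (e3 h y hy).2 (l2 ▸ hl)
      exact hh l l1 l2 y (e1 h hy) hl
    refine Lk.of K E (by omega) (fun h hh => (e2 h).rst (eC h hh)) (fun h _ h' _ hne y hy hy' => q2 _ _ h h' hne y (e1 h hy) (e1 h' hy')) fun h hh => ⟨?_, ?_⟩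
    · obtain ⟨y, y1, y2⟩ := e4 h
      exact ⟨y, ⟨eC h hh y1, y2⟩, y1⟩
    · obtain ⟨y, y1, y2⟩ := e5 h
      exact ⟨y, ⟨eC h hh y1, y2⟩, y1⟩
  obtain hO' | ⟨D, d1, d2⟩ := hS V (rst G Core) (W × W) J A (fun p => A p.swap) (Finset.card_le_univ _) hlk
  · exact absurd (Ord.mono (G' := G) (show rst G Core ≤ G from fun _ _ h => h.1) hO') hO
  have dC : ∀ p ∈ J, D p ⊆ Core := fun p hp => (d1 p hp).1.rst_sub ((d1 p hp).2.1.mono fun y hy => ⟨hy.1.1, hy.2⟩)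
  refine ⟨fun i => P (x i) ∪ ⋃ j : {j // (i, j) ∈ J}, D (i, j), fun i => ?_, fun i j hij y => ?_, fun i j hij => ?_⟩
  · refine (hP _ (x i).2).1.iUnion (fun j => (d1 _ j.2).1.mono fun _ _ _ _ h => h.1) fun j => ?_
    obtain ⟨y, ⟨-, u, hu, hyu⟩, hy⟩ := (d1 _ j.2).2.1
    exact ⟨u, hu, y, hy, .inr hyu.symm⟩
  · rintro (h | h) (h' | h')
    · exact hxd i j hij y h h'
    · obtain ⟨⟨k, hk⟩, hy⟩ := mem_iUnion.1 h'
      exact dC _ hk hy _ h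
    · obtain ⟨⟨k, hk⟩, hy⟩ := mem_iUnion.1 h
      exact dC _ hk hy _ h'
    · obtain ⟨⟨k, hk⟩, hy⟩ := mem_iUnion.1 h
      obtain ⟨⟨k', hk'⟩, hy'⟩ := mem_iUnion.1 h'
      exact d2 _ hk _ hk' (fun e => hij (congrArg Prod.fst e)) y hy hy'
  · by_cases hp : (i, j) ∈ J
    · obtain ⟨y, ⟨-, u, hu, hyu⟩, hy⟩ := (d1 _ hp).2.2
      exact ⟨y, .inr (mem_iUnion.2 ⟨⟨j, hp⟩, hy⟩), u, .inl hu, hyu⟩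
    · simp only [hJ, Finset.mem_filter, Finset.mem_univ, true_and] at hp
      push Not at hp
      obtain ⟨u, hu, v, hv, huv⟩ := hp hij.ne
      exact ⟨u, .inl hu, v, .inl hv, huv⟩

end kmodel2
end Paper
namespace Paper

section ordgrid
variable {V : Type} {G : SimpleGraph V}

open Classical in
noncomputable def ball {α : Type} [Fintype α] (L : α → α → Prop) (x : α) : ℕ → Finset α
  | 0 => {x}
  | k+1 => ball L x k ∪ (ball L x k).biUnion fun u => Finset.univ.filter (L u)

open Classical in
theorem dich {α : Type} [Fintype α] (L : α → α → Prop) (n : ℕ) (x : α) (hq : (n+1)^n < Fintype.card α)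
    (hL : ∀ T : Set α, T.Nonempty → (∃ b, b ∉ T) → ∃ a ∈ T, ∃ b, b ∉ T ∧ L a b) :
    (∃ z, ∃ e : Fin n → α, Function.Injective e ∧ ∀ i, L z (e i)) ∨
      ∃ c : ℕ → α, (∀ i ≤ n, ∀ j < i, c i ≠ c j) ∧ ∀ i < n, L (c i) (c (i+1)) := by
  refine or_iff_not_imp_left.2 fun hs => ?_
  have hdeg : ∀ u, (Finset.univ.filter (L u)).card ≤ n := by
    intro u
    by_contra hc
    obtain ⟨e⟩ : Nonempty (Fin n ↪ (Finset.univ.filter (L u))) := by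
      rw [Function.Embedding.nonempty_iff_card_le, Fintype.card_coe]; simp only [Fintype.card_fin]; omega
    exact hs ⟨u, fun i => e i, fun i j h => e.injective (Subtype.ext h), fun i => (Finset.mem_filter.1 (e i).2).2⟩
  have hcard : ∀ k, (ball L x k).card ≤ (n+1)^k := by
    intro k
    induction k with
    | zero => simp [ball]
    | succ k ih =>
      have h1 := Finset.card_biUnion_le_card_mul (ball L x k) (fun u => Finset.univ.filter (L u)) n fun u _ => hdeg u
      have h2 := Finset.card_union_le (ball L x k) ((ball L x k).biUnion fun u => Finset.univ.filter (L u))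
      rw [ball, pow_succ]
      nlinarith
  have hx : ∀ k, x ∈ ball L x k := by
    intro k
    induction k with
    | zero => simp [ball]
    | succ k ih => rw [ball]; exact Finset.mem_union_left _ ih
  have hm : ∀ k m, ball L x k ⊆ ball L x (k+m) := by
    intro k m
    induction m with
    | zero => exact subset_rfl
    | succ m ih => exact ih.trans (Finset.subset_union_left)
  have key : ∀ k v, v ∈ ball L x k → (∀ j < k, v ∉ ball L x j) → ∃ c : ℕ → α, c k = v ∧
      (∀ i ≤ k, c i ∈ ball L x i ∧ ∀ j < i, c i ∉ ball L x j) ∧ ∀ i < k, L (c i) (c (i+1)) := by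
    intro k
    induction k with
    | zero =>
      refine fun v hv _ => ⟨fun _ => v, rfl, fun i hi => ?_, by simp⟩
      obtain rfl : i = 0 := by omega
      exact ⟨hv, by simp⟩
    | succ k ih =>
      intro v hv hv'
      rw [ball, Finset.mem_union] at hv
      obtain ⟨u, hu, huv⟩ := Finset.mem_biUnion.1 (hv.resolve_left (hv' k (by omega)))
      have huv := (Finset.mem_filter.1 huv).2
      obtain ⟨c, c1, c2, c3⟩ := ih u hu fun j hj h => hv' (j+1) (by omega)
        (by rw [ball]; exact Finset.mem_union_right _ (Finset.mem_biUnion.2 ⟨u, h, by simpa using huv⟩))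
      refine ⟨fun i => if i = k+1 then v else c i, by simp, fun i hi => ?_, fun i hi => ?_⟩
      · by_cases e : i = k+1
        · subst e
          simp only [if_true]
          exact ⟨by rw [ball, Finset.mem_union]; exact hv, hv'⟩
        · simp only [e, if_false]; exact c2 i (by omega)
      · simp only [show i ≠ k+1 by omega, if_false]
        by_cases e : i = k
        · subst e; simpa [c1] using huv
        · rw [if_neg (by omega)]; exact c3 i (by omega)
  have hn : ∃ v, v ∈ ball L x n ∧ ∀ j < n, v ∉ ball L x j := by
    rcases Nat.eq_zero_or_pos n with rfl | hn
    · exact ⟨x, hx 0, by simp⟩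
    obtain ⟨a, ha, b, hb, hab⟩ := hL (ball L x (n-1)) ⟨x, hx _⟩ (by
      by_contra hc
      push Not at hc
      have h1 : (ball L x (n-1)) = Finset.univ := Finset.eq_univ_iff_forall.2 hc
      have h2 := hcard (n-1)
      rw [h1, Finset.card_univ] at h2
      have h3 := Nat.pow_le_pow_right (show 0 < n+1 by omega) (show n-1 ≤ n by omega)
      omega)
    refine ⟨b, ?_, fun j hj h => hb ?_⟩
    · obtain ⟨m, rfl⟩ : ∃ m, n = m+1 := ⟨n-1, by omega⟩
      rw [ball]
      exact Finset.mem_union_right _ (Finset.mem_biUnion.2 ⟨a, ha, by simpa using hab⟩)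
    · have := hm j (n-1-j) h
      rwa [show j + (n-1-j) = n-1 by omega] at this
  obtain ⟨v, v1, v2⟩ := hn
  obtain ⟨c, -, c2, c3⟩ := key n v v1 v2
  exact ⟨c, fun i hi j hj e => (c2 i hi).2 j hj (e ▸ (c2 j (by omega)).1), c3⟩

variable {r q : ℕ} {R : ℕ → Set V} {f : Fin q → ℕ → V} {N : Fin q → ℕ}

def Zr (f : Fin q → ℕ → V) (N : Fin q → ℕ) (S : Set V) : Set V :=
  S ∪ {x | ∃ h a p b, a ≤ p ∧ p ≤ b ∧ b ≤ N h ∧ f h a ∈ S ∧ f h b ∈ S ∧ x = f h p}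

def Lnk (G : SimpleGraph V) (f : Fin q → ℕ → V) (N : Fin q → ℕ) (S : Set V) (h h' : Fin q) : Prop :=
  h ≠ h' ∧ ∃ D ⊆ S, Conn G D ∧ (∃ p ≤ N h, f h p ∈ D) ∧ (∀ k, k ≠ h → ∀ p ≤ N k, f k p ∉ D) ∧
    ∃ p ≤ N h', f h' p ∈ S ∧ ∃ d ∈ D, G.Adj d (f h' p)

def Ok (G : SimpleGraph V) (f : Fin q → ℕ → V) (N : Fin q → ℕ) (S : Set V) {a : ℕ} (c : Fin a → Fin q) : Prop :=
  Function.Injective c ∧ ∀ i j : Fin a, i.val + 1 = j.val → ∃ E ⊆ Zr f N S, Conn G E ∧ (∀ k, k ≠ i → ∀ p ≤ N (c k), f (c k) p ∉ E) ∧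
    (∃ p ≤ N (c i), f (c i) p ∈ S ∧ ∃ d ∈ E, d = f (c i) p ∨ G.Adj d (f (c i) p)) ∧
    ∃ p ≤ N (c j), f (c j) p ∈ S ∧ ∃ d ∈ E, G.Adj d (f (c j) p)

namespace Ordd

theorem seg_conn (hO : Ordd G r q R f N) {h : Fin q} {a b : ℕ} (hab : a ≤ b) (hb : b ≤ N h) : Conn G (f h '' Icc a b) := by
  have := Ch.conn (G := G) (S := univ) (f := fun k => f h (a+k)) (n := b-a) ⟨fun _ _ => mem_univ _, fun i hi => hO.step h (a+i) (by omega)⟩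
  convert this using 1
  ext x
  simp only [Set.mem_image, mem_Icc, mem_Iic]
  constructor
  · rintro ⟨p, hp, rfl⟩; exact ⟨p-a, by omega, by congr 1; omega⟩
  · rintro ⟨p, hp, rfl⟩; exact ⟨a+p, by omega, rfl⟩

theorem zcol (hO : Ordd G r q R f N) {t h p} (hp : p ≤ N h) (hx : f h p ∈ Zr f N (R t)) :
    ∃ a b, a ≤ p ∧ p ≤ b ∧ b ≤ N h ∧ f h a ∈ R t ∧ f h b ∈ R t := by
  rcases hx with hx | ⟨h', a, p', b, h1, h2, h3, h4, h5, h6⟩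
  · exact ⟨p, p, le_rfl, le_rfl, hp, hx, hx⟩
  · obtain ⟨rfl, rfl⟩ := hO.inj _ _ _ _ hp (by omega) h6
    exact ⟨a, b, h1, h2, h3, h4, h5⟩

theorem zord (hO : Ordd G r q R f N) {t t' h p p'} (ht : t < t') (ht' : t' < r) (hp : p ≤ N h) (hp' : p' ≤ N h) (h1 : f h p ∈ Zr f N (R t))
    (h2 : f h p' ∈ Zr f N (R t')) : p < p' := by
  obtain ⟨a, b, x1, x2, x3, x4, x5⟩ := hO.zcol hp h1
  obtain ⟨a', b', y1, y2, y3, y4, y5⟩ := hO.zcol hp' h2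
  have := hO.ord t t' ht ht' h b a' x3 (by omega) x5 y4
  omega

theorem zdisj (hO : Ordd G r q R f N) {t t'} (ht : t < t') (ht' : t' < r) {x} (h1 : x ∈ Zr f N (R t)) (h2 : x ∈ Zr f N (R t')) : False := by
  by_cases hx : ∃ h, ∃ p ≤ N h, x = f h p
  · obtain ⟨h, p, hp, rfl⟩ := hx
    exact lt_irrefl _ (hO.zord ht ht' hp hp h1 h2)
  · rcases h1 with h1 | ⟨h', a, p', b, _, _, _, _, _, h6⟩
    · rcases h2 with h2 | ⟨h', a, p', b, _, _, _, _, _, h6⟩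
      · exact hO.disj t (by omega) t' ht' (by omega) x h1 h2
      · exact hx ⟨h', p', by omega, h6⟩
    · exact hx ⟨h', p', by omega, h6⟩

theorem lnk (hO : Ordd G r q R f N) {t} (ht : t < r) (T : Set (Fin q)) (hT : T.Nonempty) (hT' : ∃ b, b ∉ T) : ∃ a ∈ T, ∃ b, b ∉ T ∧ Lnk G f N (R t) a b := by
  obtain ⟨a₀, ha₀⟩ := hT
  obtain ⟨b₀, hb₀⟩ := hT'
  obtain ⟨p, hp, hpR⟩ := hO.hit t ht a₀
  obtain ⟨p', hp', hpR'⟩ := hO.hit t ht b₀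
  obtain ⟨g, n, g1, g2, g3, g4⟩ := exists_ip_sets (A := {x | ∃ h ∈ T, ∃ p ≤ N h, x = f h p}) (B := {x | ∃ h, h ∉ T ∧ ∃ p ≤ N h, x = f h p}) (hO.conn t ht).2
    ⟨_, ⟨a₀, ha₀, p, hp, rfl⟩, hpR⟩ ⟨_, ⟨b₀, hb₀, p', hp', rfl⟩, hpR'⟩
  obtain ⟨a, ha, p, hp, ep⟩ := (g3 0 (by omega)).2 rfl
  obtain ⟨b, hb, p', hp', ep'⟩ := (g4 n le_rfl).2 rfl
  have hab : a ≠ b := fun e => hb (e ▸ ha)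
  have hn : n ≠ 0 := by
    rintro rfl
    exact hab (hO.inj _ _ _ _ hp hp' (ep.symm.trans ep')).1
  refine ⟨a, ha, b, hb, hab, (fun k => g (0+k)) '' Iic (n-1), ?_, (g1.sub (i := 0) (m := n-1) (by omega)).conn, ⟨p, hp, 0, by simp, ep⟩, ?_,
    p', hp', ep' ▸ g2 n le_rfl, g (n-1), ⟨n-1, by simp, by simp⟩, ep' ▸ (g1 (n-1) n (by omega) le_rfl).2.2 (by omega)⟩
  · rintro _ ⟨k, hk, rfl⟩
    rw [mem_Iic] at hk
    exact g2 _ (by omega)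
  · rintro k hk p₁ hp₁ ⟨m, hm, e⟩
    rw [mem_Iic] at hm
    simp only [Nat.zero_add] at e
    by_cases hkT : k ∈ T
    · obtain rfl := (g3 m (by omega)).1 ⟨k, hkT, p₁, hp₁, e⟩
      exact hk (hO.inj _ _ _ _ hp₁ hp (e.symm.trans ep)).1
    · have := (g4 m (by omega)).1 ⟨k, hkT, p₁, hp₁, e⟩
      omega

theorem row (hO : Ordd G r q R f N) {t} (ht : t < r) {a : ℕ} (hq : (a+1)^a < q) : ∃ c : Fin a → Fin q, Ok G f N (R t) c := by
  rcases dich (Lnk G f N (R t)) a ⟨0, by omega⟩ (by simpa using hq) (hO.lnk ht) with ⟨z, e, he, hz⟩ | ⟨c, c1, c2⟩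
  · refine ⟨e, he, fun i j _ => ?_⟩
    obtain ⟨-, D, d1, d2, ⟨p, hp, hpD⟩, d4, p₁, hp₁, d5, d6⟩ := hz i
    obtain ⟨-, D', d1', d2', ⟨p', hp', hpD'⟩, d4', p₁', hp₁', d5', d6'⟩ := hz j
    refine ⟨D ∪ f z '' Icc (min p p') (max p p') ∪ D', ?_, (d2.union (hO.seg_conn (by omega) (by omega)) ⟨_, hpD, _, ⟨p, by simp, rfl⟩, .inl rfl⟩).union d2'
      ⟨f z p', .inr ⟨p', by simp, rfl⟩, _, hpD', .inl rfl⟩, ?_, ?_, ?_⟩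
    · rintro x ((hx | ⟨m, hm, rfl⟩) | hx)
      · exact .inl (d1 hx)
      · have hh : ∀ m, m = p ∨ m = p' → f z m ∈ R t := by
          rintro m (rfl | rfl)
          exacts [d1 hpD, d1' hpD']
        exact .inr ⟨z, _, m, _, hm.1, hm.2, by omega, hh _ (by omega), hh _ (by omega), rfl⟩
      · exact .inl (d1' hx)
    · rintro k - p₂ hp₂ ((hx | ⟨m, hm, em⟩) | hx)
      · exact d4 _ (hz k).1.symm p₂ hp₂ hx
      · have := hm.2
        exact (hz k).1 (hO.inj _ _ _ _ (by omega) hp₂ em).1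
      · exact d4' _ (hz k).1.symm p₂ hp₂ hx
    · obtain ⟨d, hd, h⟩ := d6
      exact ⟨p₁, hp₁, d5, d, .inl (.inl hd), .inr h⟩
    · obtain ⟨d, hd, h⟩ := d6'
      exact ⟨p₁', hp₁', d5', d, .inr hd, h⟩
  · have inj : Function.Injective fun i : Fin a => c i.val := by
      intro i j hij
      by_contra hne
      rcases lt_or_gt_of_ne (fun e => hne (Fin.ext e) : i.val ≠ j.val) with h | h
      · exact c1 j (by omega) i h hij.symm
      · exact c1 i (by omega) j h hij
    refine ⟨fun i => c i, inj, fun i j hij => ?_⟩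
    obtain ⟨-, D, d1, d2, ⟨p, hp, hpD⟩, d4, d5⟩ := c2 i i.2
    rw [hij] at d5
    exact ⟨D, fun x hx => .inl (d1 hx), d2, fun k hk => d4 _ (inj.ne hk), ⟨p, hp, d1 hpD, _, hpD, .inl rfl⟩, d5⟩

end Ordd

open Classical in
theorem grid_of_ord (a b : ℕ) : ∃ r q, 0 < q ∧ ∀ (V : Type) (G : SimpleGraph V), Ord G r q → ∃ B, Mod G (BW a b) B := by
  set q := (a+1)^a + 1 with hq
  refine ⟨Fintype.card (Fin a → Fin q) * (b*(a+1)+1), q, by omega, fun V G ⟨R, f, N, hO⟩ => ?_⟩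
  have hrow := fun t : Fin (Fintype.card (Fin a → Fin q) * (b*(a+1)+1)) => hO.row t.2 (a := a) (by omega)
  choose c' hc' using hrow
  obtain ⟨c, hc⟩ := Fintype.exists_le_card_fiber_of_mul_le_card c' (n := b*(a+1)+1) (by rw [Fintype.card_fin])
  obtain ⟨τ, τr, τm, τo⟩ : ∃ τ : ℕ → ℕ, (∀ i ≤ b*(a+1), τ i < Fintype.card (Fin a → Fin q) * (b*(a+1)+1)) ∧
      (∀ i j, i < j → j ≤ b*(a+1) → τ i < τ j) ∧ ∀ i ≤ b*(a+1), Ok G f N (R (τ i)) c := by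
    set e := Finset.orderEmbOfCardLe _ hc
    refine ⟨fun i => if h : i < b*(a+1)+1 then (e ⟨i, h⟩).val else 0, fun i hi => ?_, fun i j hij hj => ?_, fun i hi => ?_⟩
    · dsimp only; rw [dif_pos (by omega)]; exact (e _).2
    · dsimp only; rw [dif_pos (by omega), dif_pos (by omega)]; exact e.strictMono (show (⟨i, _⟩ : Fin _) < ⟨j, _⟩ from hij)
    · dsimp only; rw [dif_pos (by omega)]
      have : e ⟨i, by omega⟩ ∈ _ := Finset.orderEmbOfCardLe_mem _ hc _
      rw [← (Finset.mem_filter.1 this).2]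
      exact hc' _
  have cinj : Function.Injective c := (τo 0 (by omega)).1
  have hblk : ∀ (i : Fin a) (j : ℕ), j < b → j*(a+1) + i.val + 1 < (j+1)*(a+1) ∧ (j+1)*(a+1) ≤ b*(a+1) := by
    intro i j hj
    exact ⟨by have := i.2; rw [Nat.add_mul]; omega, Nat.mul_le_mul_right _ hj⟩
  have hE : ∀ (i : Fin a) (j : Fin b), ∃ E ⊆ Zr f N (R (τ (j*(a+1)+i+1))), (∀ k, k ≠ i → ∀ p ≤ N (c k), f (c k) p ∉ E) ∧
    (E = ∅ ∨ Conn G E ∧ ∃ p ≤ N (c i), f (c i) p ∈ R (τ (j*(a+1)+i+1)) ∧ ∃ d ∈ E, d = f (c i) p ∨ G.Adj d (f (c i) p)) ∧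
    ∀ i' : Fin a, i.val+1 = i'.val → ∃ p ≤ N (c i'), f (c i') p ∈ R (τ (j*(a+1)+i+1)) ∧ ∃ d ∈ E, G.Adj d (f (c i') p) := by
    intro i j
    by_cases hi : i.val + 1 < a
    · obtain ⟨E, e1, e2, e3, e4, e5⟩ := (τo (j*(a+1)+i+1) (by have := hblk i j j.2; omega)).2 i ⟨i.val+1, hi⟩ rfl
      exact ⟨E, e1, e3, .inr ⟨e2, e4⟩, fun i' h => by
        obtain rfl : (⟨i.val+1, hi⟩ : Fin a) = i' := Fin.ext h
        exact e5⟩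
    · exact ⟨∅, by simp, by simp, .inl rfl, fun i' h => by have := i'.2; omega⟩
  choose E e1 e2 e3 e4 using hE
  have hθ : ∀ (i : Fin a) (j : ℕ), ∃ p, j ≤ b → p ≤ N (c i) ∧ f (c i) p ∈ R (τ (j*(a+1))) := by
    intro i j
    by_cases hj : j ≤ b
    · obtain ⟨p, hp⟩ := hO.hit _ (τr (j*(a+1)) (Nat.mul_le_mul_right _ hj)) (c i)
      exact ⟨p, fun _ => hp⟩
    · exact ⟨0, fun h => absurd h hj⟩
  choose θ hθ using hθ
  have θlt : ∀ i j, j < b → θ i j < θ i (j+1) := fun i j hj =>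
    hO.ord _ _ (τm _ _ (by have := hblk i j hj; omega) (hblk i j hj).2) (τr _ (hblk i j hj).2) _ _ _ (hθ i j hj.le).1 (hθ i (j+1) hj).1 (hθ i j hj.le).2 (hθ i (j+1) hj).2
  have θmono : ∀ i m j, j + m ≤ b → θ i j ≤ θ i (j+m) := by
    intro i m j
    induction m with
    | zero => simp
    | succ m ih => intro h; have := θlt i (j+m) (by omega); have := ih (by omega); rw [← Nat.add_assoc]; omega
  have inseg : ∀ (i k : Fin a) (j : ℕ), j < b → ∀ p ≤ N (c i), f (c i) p ∈ Zr f N (R (τ (j*(a+1)+k.val+1))) → θ i j ≤ p ∧ p < θ i (j+1) := by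
    intro i k j hj p hp hx
    obtain ⟨h1, h2⟩ := hblk k j hj
    exact ⟨(hO.zord (τm (j*(a+1)) _ (by omega) (by omega)) (τr _ (by omega)) (hθ i j hj.le).1 hp (.inl (hθ i j hj.le).2) hx).le,
      hO.zord (τm _ _ h1 h2) (τr _ h2) hp (hθ i (j+1) hj).1 hx (.inl (hθ i (j+1) hj).2)⟩
  set C : Fin a → ℕ → Set V := fun i j => f (c i) '' Icc (θ i j) (θ i (j+1) - 1) with hC
  have memC : ∀ i j, j < b → ∀ p, θ i j ≤ p → p < θ i (j+1) → f (c i) p ∈ C i j := fun i j _ p h1 h2 => ⟨p, ⟨h1, by omega⟩, rfl⟩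
  have ofC : ∀ i j, j < b → ∀ x ∈ C i j, ∃ p, θ i j ≤ p ∧ p < θ i (j+1) ∧ p ≤ N (c i) ∧ x = f (c i) p := by
    rintro i j hj _ ⟨p, hp, rfl⟩
    have h1 := θlt i j hj
    have h2 := (hθ i (j+1) hj).1
    exact ⟨p, hp.1, by have := hp.2; omega, by have := hp.2; omega, rfl⟩
  have CE : ∀ i i' j (j' : Fin b), j < b → (i, j) ≠ (i', j'.val) → ∀ x ∈ C i j, x ∉ E i' j' := by
    intro i i' j j' hj hne x hx hx'
    obtain ⟨p, p1, p2, p3, rfl⟩ := ofC i j hj x hx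
    by_cases hi : i = i'
    · subst hi
      have hjj : j ≠ j' := fun e => hne (by rw [e])
      have := inseg i i j' j'.2 p p3 (e1 i j' hx')
      rcases lt_or_gt_of_ne hjj with h | h
      · have := θmono i (j'-(j+1)) (j+1) (by omega)
        rw [show j+1+(j'-(j+1)) = j' by omega] at this; omega
      · have := θmono i (j-(j'+1)) (j'+1) (by omega)
        rw [show j'.val+1+(j-(j'+1)) = j by omega] at this; omega
    · exact e2 i' j' i hi p p3 hx'
  refine ⟨fun w => C w.1 w.2 ∪ E w.1 w.2, fun ⟨i, j⟩ => ?_, fun ⟨i, j⟩ ⟨i', j'⟩ hne x => ?_, ?_⟩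
  · have h1 := hO.seg_conn (h := c i) (a := θ i j) (b := θ i (j+1) - 1) (by have := θlt i j j.2; omega) (by have := (hθ i (j+1) j.2).1; omega)
    rcases e3 i j with h | ⟨h, p, p1, p2, d, d1, d2⟩
    · dsimp only; rw [h, union_empty]; exact h1
    · obtain ⟨k1, k2⟩ := inseg i i j j.2 p p1 (.inl p2)
      exact h1.union h ⟨_, memC i j j.2 p k1 k2, d, d1, d2.imp Eq.symm fun h => h.symm⟩
  · have hne' : (i, j.val) ≠ (i', j'.val) := fun e => hne (by simp only [Prod.mk.injEq] at e ⊢; exact ⟨e.1, Fin.ext e.2⟩)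
    rintro (h | h) (h' | h')
    · obtain ⟨p, p1, p2, p3, e⟩ := ofC i j j.2 x h
      obtain ⟨p', p1', p2', p3', e'⟩ := ofC i' j' j'.2 x h'
      obtain ⟨h1, h2⟩ := hO.inj _ _ _ _ p3 p3' (e.symm.trans e')
      obtain rfl := cinj h1
      have hjj : j.val ≠ j'.val := fun e => hne' (by rw [e])
      rcases lt_or_gt_of_ne hjj with h | h
      · have := θmono i (j'-(j+1)) (j+1) (by omega)
        rw [show j.val+1+(j'-(j+1)) = j' by omega] at this; omega
      · have := θmono i (j-(j'+1)) (j'+1) (by omega)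
        rw [show j'.val+1+(j-(j'+1)) = j by omega] at this; omega
    · exact CE i i' j j' j.2 hne' x h h'
    · exact CE i' i j' j j'.2 hne'.symm x h' h
    · obtain ⟨h1, h2⟩ := hblk i j j.2
      obtain ⟨h1', h2'⟩ := hblk i' j' j'.2
      have hlt : ∀ m m' : ℕ, m < m' → (m+1)*(a+1) ≤ m'*(a+1) := fun m m' h => Nat.mul_le_mul_right _ h
      have : j.val*(a+1)+i+1 ≠ j'.val*(a+1)+i'+1 := by
        intro e
        rcases lt_trichotomy j.val j'.val with h | h | h
        · have := hlt _ _ h; omega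
        · rw [h] at e; exact hne' (by rw [h, show i = i' from Fin.ext (by omega)])
        · have := hlt _ _ h; omega
      rcases lt_or_gt_of_ne this with hl | hl
      · exact hO.zdisj (τm _ _ hl (by omega)) (τr _ (by omega)) (e1 i j h) (e1 i' j' h')
      · exact hO.zdisj (τm _ _ hl (by omega)) (τr _ (by omega)) (e1 i' j' h') (e1 i j h)
  · have hor : ∀ (i i' : Fin a) (j : Fin b), i.val + 1 = i'.val → ∃ x ∈ C i j ∪ E i j, ∃ y ∈ C i' j ∪ E i' j, G.Adj x y := by
      intro i i' j hi
      obtain ⟨p, p1, p2, d, d1, d2⟩ := e4 i j i' hi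
      obtain ⟨k1, k2⟩ := inseg i' i j j.2 p p1 (.inl p2)
      exact ⟨d, .inr d1, _, .inl (memC i' j j.2 p k1 k2), d2⟩
    have ver : ∀ (i : Fin a) (j j' : Fin b), j.val + 1 = j'.val → ∃ x ∈ C i j ∪ E i j, ∃ y ∈ C i j' ∪ E i j', G.Adj x y := by
      intro i j j' hj
      have h1 := θlt i j j.2
      have h2 := θlt i j' j'.2
      have h3 := (hθ i (j+1) j.2).1
      refine ⟨_, .inl (memC i j j.2 (θ i (j+1) - 1) (by omega) (by omega)), _, .inl (memC i j' j'.2 (θ i j') le_rfl h2), ?_⟩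
      have := hO.step (c i) (θ i (j+1) - 1) (by omega)
      rwa [show θ i (j+1) - 1 + 1 = θ i j' by rw [← hj]; omega] at this
    rintro ⟨i, j⟩ ⟨i', j'⟩ hadj
    rw [bw_adj] at hadj
    dsimp only at hadj ⊢
    rcases hadj with ⟨h, h' | h'⟩ | ⟨h, ⟨h', -⟩ | ⟨h', -⟩⟩
    · obtain rfl := Fin.ext h
      exact ver i j j' h'
    · obtain rfl := Fin.ext h
      obtain ⟨x, hx, y, hy, hxy⟩ := ver i j' j h'
      exact ⟨y, hy, x, hx, hxy.symm⟩
    · obtain rfl := Fin.ext h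
      exact hor i i' j h'
    · obtain rfl := Fin.ext h
      obtain ⟨x, hx, y, hy, hxy⟩ := hor i' i j h'
      exact ⟨y, hy, x, hx, hxy.symm⟩

end ordgrid
end Paper
namespace Paper

theorem Br.anti {V : Type} {G : SimpleGraph V} {k k' : ℕ} {𝓑 : Set (Set V)} (h : Br G k 𝓑) (hk : k' ≤ k) : Br G k' 𝓑 :=
  ⟨h.conn, h.touch, fun X hX => h.ord X (by omega)⟩

theorem grid_thm (a b : ℕ) : ∃ N : ℕ, ∀ (Q : Type) [Finite Q] (G : SimpleGraph Q), (∃ 𝓑, Br G N 𝓑) → ∃ B, Mod G (BW a b) B := by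
  obtain ⟨r, q, hq, h⟩ := grid_of_ord a b
  obtain ⟨N, hN⟩ := kmodel (Fin a × Fin b) r hq
  refine ⟨N, fun Q _ G hb => ?_⟩
  rcases hN Q G hb with h' | ⟨B, hB⟩
  · exact h Q G h'
  · exact ⟨B, hB.conn, hB.disj, fun w w' hw => hB.adj w w' hw.ne⟩

theorem ContainsInduced.lift {V W : Type} {G : SimpleGraph V} {J : Set V} {H : SimpleGraph W} (h : ContainsInduced (G.induce J) H) :
    ContainsInduced G H := by
  obtain ⟨s, ⟨e⟩⟩ := h
  refine ⟨Subtype.val '' s, ⟨e.trans ⟨Equiv.Set.image Subtype.val s Subtype.val_injective, ?_⟩⟩⟩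
  intro a b
  rfl

end Paper

namespace Paper

/-- the family `𝓣₂` is helpful. -/
theorem statement2 (t : ℕ) (ht : 0 < t) :
    ∃ c : ℕ, ∀ (V : Type) [Fintype V] (G : SimpleGraph V),
      T2Free G → ¬HasTreewidthAtMost G c →
        ContainsInduced G (completeGraph (Fin t)) ∨
        ContainsInduced G (completeBipartiteGraph (Fin t) (Fin t)) ∨
        ContainsWallSubdiv G t ∨ ContainsLineWallSubdiv G t := by
  obtain ⟨N, hN⟩ := grid_thm (2*t+4) (2*t+5)
  refine ⟨3 * (2 * (N + t)), fun V _ G hG htw => ?_⟩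
  obtain ⟨J, 𝓑, hc⟩ := exists_crit (G := G) (k := 2 * (N + t)) (by by_contra h; exact htw (tw_of_no_bramble h))
  have hT := hG.t2f.induce J
  by_cases hnc : ∃ a b : J, a ≠ b ∧ ¬ (G.induce J).Adj a b
  · right; right; left
    have hTF := hT.tf (fun K hK => crit_no_clique_cutset hc hK) hnc
    obtain ⟨B, hB, hs⟩ := mod_of_grid (G := G.induce J) (N + t) (fun Q _ G' ⟨𝓒, h⟩ => hN Q G' ⟨𝓒, h.anti (by omega)⟩) hc.br
      (fun g h h' h1 h2 => h1.uniq hc hTF h2)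
    obtain ⟨α, S, hS, hS'⟩ := wall_of_mod hc hTF t hB hs
    exact ⟨α, S, hS, hS'.lift⟩
  · left
    push Not at hnc
    classical
    have := Fintype.ofFinite J
    have hcard : t ≤ Fintype.card J := by
      by_contra hlt
      obtain ⟨b, hb, hb'⟩ := hc.br.ord Finset.univ (by rw [Finset.card_univ]; omega)
      obtain ⟨x, hx⟩ := (hc.br.conn b hb).1
      exact hb' x (Finset.mem_univ _) hx
    obtain ⟨e⟩ : Nonempty (Fin t ↪ J) := by
      rw [Function.Embedding.nonempty_iff_card_le]; simpa using hcard
    refine ContainsInduced.lift (J := J) ⟨range e, ⟨Equiv.ofInjective e e.injective, ?_⟩⟩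
    intro a b
    change (G.induce J).Adj (e a) (e b) ↔ a ≠ b
    exact ⟨fun h h' => h.ne (by rw [h']), fun h => hnc _ _ (e.injective.ne h)⟩

end Paper
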